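/- arXiv:0807.0688 — 2 statements merged into one kernel-verified Lean document; each statement's English description precedes it below -/
import Mathlib

section
/- Let k ≥ 1 and t ≥ 3 be odd integers. Then dim_F T₁(B^{k,t}_0) = dim_F T₁(B^{k,t}_1) + 1; in particular the F-vector spaces T₁(B^{k,t}_0) and T₁(B^{k,t}_1) have different dimensions, and hence there is no F-algebra isomorphism Z(B^{k,t}_0) → Z(B^{k,t}_1) mapping T₁(B^{k,t}_0)^⊥ onto T₁(B^{k,t}_1)^⊥. -/
/- Common setup: the algebras B^{k,t}_c = SD(2B)₂^{k,t}(c) of semidihedral type,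
   over a field F, presented as a quotient of the free algebra on the paths-generators
   e₁, e₂ (trivial paths), α (loop at vertex 1), β (arrow 1 → 2),
   γ (arrow 2 → 1), η (loop at vertex 2), by the path-algebra relations
   together with Erdmann's relations  βη = (αβγ)^{k-1}αβ, γβ = η^{t-1},
   ηγ = (γαβ)^{k-1}γα, βη² = 0, η²γ = 0, α² = c(αβγ)^k. -/

noncomputable section

namespace SD2Paper

inductive Gen : Type
  | e1 | e2 | a | b | g | h

variable (F : Type) [Field F]

/-- The generators inside the free algebra. -/
def gen (t : Gen) : FreeAlgebra F Gen := FreeAlgebra.ι F t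

/-- The defining relations of `D(2B)^{k,s}(c)` (paths written from left to right). -/
inductive Rel (k t : ℕ) (c : F) : FreeAlgebra F Gen → FreeAlgebra F Gen → Prop
  | unit : Rel k t c (gen F .e1 + gen F .e2) 1
  | idem1 : Rel k t c (gen F .e1 * gen F .e1) (gen F .e1)
  | idem2 : Rel k t c (gen F .e2 * gen F .e2) (gen F .e2)
  | orth12 : Rel k t c (gen F .e1 * gen F .e2) 0
  | orth21 : Rel k t c (gen F .e2 * gen F .e1) 0
  | aL : Rel k t c (gen F .e1 * gen F .a) (gen F .a)
  | aR : Rel k t c (gen F .a * gen F .e1) (gen F .a)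
  | bL : Rel k t c (gen F .e1 * gen F .b) (gen F .b)
  | bR : Rel k t c (gen F .b * gen F .e2) (gen F .b)
  | gL : Rel k t c (gen F .e2 * gen F .g) (gen F .g)
  | gR : Rel k t c (gen F .g * gen F .e1) (gen F .g)
  | hL : Rel k t c (gen F .e2 * gen F .h) (gen F .h)
  | hR : Rel k t c (gen F .h * gen F .e2) (gen F .h)
  | bh : Rel k t c (gen F .b * gen F .h)
      ((gen F .a * gen F .b * gen F .g) ^ (k - 1) * (gen F .a * gen F .b))
  | gb : Rel k t c (gen F .g * gen F .b) ((gen F .h) ^ (t - 1))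
  | hg : Rel k t c (gen F .h * gen F .g)
      ((gen F .g * gen F .a * gen F .b) ^ (k - 1) * (gen F .g * gen F .a))
  | bh2 : Rel k t c (gen F .b * gen F .h * gen F .h) 0
  | h2g : Rel k t c (gen F .h * gen F .h * gen F .g) 0
  | asq : Rel k t c (gen F .a * gen F .a) (c • (gen F .a * gen F .b * gen F .g) ^ k)

/-- The algebra `B^{k,t}_c = SD(2B)₂^{k,t}(c)`. -/
def BA (k t : ℕ) (c : F) : Type := RingQuot (Rel F k t c)

instance (k t : ℕ) (c : F) : Ring (BA F k t c) :=
  inferInstanceAs (Ring (RingQuot (Rel F k t c)))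

instance (k t : ℕ) (c : F) : Algebra F (BA F k t c) :=
  inferInstanceAs (Algebra F (RingQuot (Rel F k t c)))

variable (k t : ℕ) (c : F)

/-- The canonical projection. -/
def mk : FreeAlgebra F Gen →ₐ[F] BA F k t c := RingQuot.mkAlgHom F (Rel F k t c)

def E1 : BA F k t c := mk F k t c (gen F .e1)
def E2 : BA F k t c := mk F k t c (gen F .e2)
/-- The image of the loop α at vertex 1. -/
def Al : BA F k t c := mk F k t c (gen F .a)
/-- The image of the arrow β : 1 → 2. -/
def Be : BA F k t c := mk F k t c (gen F .b)
/-- The image of the arrow γ : 2 → 1. -/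
def Ga : BA F k t c := mk F k t c (gen F .g)
/-- The image of the loop η at vertex 2. -/
def Et : BA F k t c := mk F k t c (gen F .h)

/-- The path αβγ. -/
def ABG : BA F k t c := Al F k t c * Be F k t c * Ga F k t c
/-- The path βγα. -/
def BGA : BA F k t c := Be F k t c * Ga F k t c * Al F k t c
/-- The path γαβ. -/
def GAB : BA F k t c := Ga F k t c * Al F k t c * Be F k t c

/-- The standard basis paths 𝓑₁₁ of e₁Ae₁. -/
def B11 : Set (BA F k t c) :=
  {E1 F k t c, Al F k t c, Be F k t c * Ga F k t c, (ABG F k t c) ^ k}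
    ∪ (fun i => (ABG F k t c) ^ i) '' Set.Icc 1 (k - 1)
    ∪ (fun i => (ABG F k t c) ^ i * Al F k t c) '' Set.Icc 1 (k - 1)
    ∪ (fun i => (BGA F k t c) ^ i) '' Set.Icc 1 (k - 1)
    ∪ (fun i => (BGA F k t c) ^ i * (Be F k t c * Ga F k t c)) '' Set.Icc 1 (k - 1)

/-- The standard basis paths 𝓑₁₂ of e₁Ae₂. -/
def B12 : Set (BA F k t c) :=
  {Be F k t c, Al F k t c * Be F k t c}
    ∪ (fun i => (BGA F k t c) ^ i * Be F k t c) '' Set.Icc 1 (k - 1)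
    ∪ (fun i => (ABG F k t c) ^ i * (Al F k t c * Be F k t c)) '' Set.Icc 1 (k - 1)

/-- The standard basis paths 𝓑₂₁ of e₂Ae₁. -/
def B21 : Set (BA F k t c) :=
  {Ga F k t c, Ga F k t c * Al F k t c}
    ∪ (fun i => (GAB F k t c) ^ i * Ga F k t c) '' Set.Icc 1 (k - 1)
    ∪ (fun i => (GAB F k t c) ^ i * (Ga F k t c * Al F k t c)) '' Set.Icc 1 (k - 1)

/-- The standard basis paths 𝓑₂₂ of e₂Ae₂. -/
def B22 : Set (BA F k t c) :=
  {E2 F k t c}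
    ∪ (fun i => (GAB F k t c) ^ i) '' Set.Icc 1 (k - 1)
    ∪ (fun j => (Et F k t c) ^ j) '' Set.Icc 1 t

/-- The standard path basis 𝓑 of `A^{k,s}_c`. -/
def BB : Set (BA F k t c) :=
  B11 F k t c ∪ B12 F k t c ∪ B21 F k t c ∪ B22 F k t c

/-- The commutator subspace K(A): the F-linear span of all commutators. -/
def Kspan (A : Type) [Ring A] [Algebra F A] : Submodule F A :=
  Submodule.span F {z : A | ∃ u v : A, z = u * v - v * u}

/-- The (left) socle of a ring: the sum of all simple (left) submodules. -/
def socle (A : Type) [Ring A] : Submodule A A := sSup {S : Submodule A A | IsAtom S}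

/-- `ψ` is the linear form sending each standard basis path lying in the socle to 1
    and every other standard basis path to 0. -/
def SoclePsi (ψ : BA F k t c →ₗ[F] F) : Prop :=
  ∀ p ∈ BB F k t c,
    (p ∈ socle (BA F k t c) → ψ p = 1) ∧ (p ∉ socle (BA F k t c) → ψ p = 0)

/-- `T₁(A) = {x : x² ∈ K(A)}`. -/
def T1set : Set (BA F k t c) := {z | z ^ 2 ∈ Kspan F (BA F k t c)}

/-- The orthogonal space `T₁(A)^⊥` with respect to the form `⟨x, y⟩ = ψ(xy)`. -/
def T1perp (ψ : BA F k t c →ₗ[F] F) : Set (BA F k t c) :=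
  {y | ∀ x ∈ T1set F k t c, ψ (y * x) = 0}

/-- The first generalized Reynolds ideal, as an ideal of the center `Z(A)`. -/
def ReynoldsIdeal (ψ : BA F k t c →ₗ[F] F) :
    Ideal (Subalgebra.center F (BA F k t c)) :=
  Ideal.span {z : Subalgebra.center F (BA F k t c) | (z : BA F k t c) ∈ T1perp F k t c ψ}

/-- Elements of an algebra satisfying the defining relations of `B^{k,t}_c`. -/
structure Realization (F : Type) [Field F] (k t : ℕ) (c : F) (A : Type) [Ring A] [Algebra F A] where
  (e1 e2 a b g h : A)
  unit : e1 + e2 = 1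
  idem1 : e1 * e1 = e1
  idem2 : e2 * e2 = e2
  orth12 : e1 * e2 = 0
  orth21 : e2 * e1 = 0
  aL : e1 * a = a
  aR : a * e1 = a
  bL : e1 * b = b
  bR : b * e2 = b
  gL : e2 * g = g
  gR : g * e1 = g
  hL : e2 * h = h
  hR : h * e2 = h
  bh : b * h = (a * b * g) ^ (k - 1) * (a * b)
  gb : g * b = h ^ (t - 1)
  hg : h * g = (g * a * b) ^ (k - 1) * (g * a)
  bh2 : b * h * h = 0
  h2g : h * h * g = 0
  asq : a * a = c • (a * b * g) ^ k

namespace Realization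

variable {F : Type} [Field F] {k t : ℕ} {c : F} {A : Type} [Ring A] [Algebra F A]
  (D : Realization F k t c A)

theorem mul_assoc_zero {x y : A} (h : x * y = 0) (r : A) : x * (y * r) = 0 := by
  rw [← mul_assoc, h, zero_mul]

theorem e2_a : D.e2 * D.a = 0 := by rw [← D.aL, ← mul_assoc, D.orth21, zero_mul]
theorem e2_b : D.e2 * D.b = 0 := by rw [← D.bL, ← mul_assoc, D.orth21, zero_mul]
theorem e1_g : D.e1 * D.g = 0 := by rw [← D.gL, ← mul_assoc, D.orth12, zero_mul]
theorem e1_h : D.e1 * D.h = 0 := by rw [← D.hL, ← mul_assoc, D.orth12, zero_mul]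
theorem a_e2 : D.a * D.e2 = 0 := by rw [← D.aR, mul_assoc, D.orth12, mul_zero]
theorem g_e2 : D.g * D.e2 = 0 := by rw [← D.gR, mul_assoc, D.orth12, mul_zero]
theorem b_e1 : D.b * D.e1 = 0 := by rw [← D.bR, mul_assoc, D.orth21, mul_zero]
theorem h_e1 : D.h * D.e1 = 0 := by rw [← D.hR, mul_assoc, D.orth21, mul_zero]
theorem a_g : D.a * D.g = 0 := by rw [← D.aR, mul_assoc, D.e1_g, mul_zero]
theorem a_h : D.a * D.h = 0 := by rw [← D.aR, mul_assoc, D.e1_h, mul_zero]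
theorem b_a : D.b * D.a = 0 := by rw [← D.bR, mul_assoc, D.e2_a, mul_zero]
theorem b_b : D.b * D.b = 0 := by nth_rw 1 [← D.bR, mul_assoc, D.e2_b, mul_zero]
theorem g_g : D.g * D.g = 0 := by nth_rw 1 [← D.gR, mul_assoc, D.e1_g, mul_zero]
theorem g_h : D.g * D.h = 0 := by rw [← D.gR, mul_assoc, D.e1_h, mul_zero]
theorem h_a : D.h * D.a = 0 := by rw [← D.hR, mul_assoc, D.e2_a, mul_zero]
theorem h_b : D.h * D.b = 0 := by rw [← D.hR, mul_assoc, D.e2_b, mul_zero]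

section

include D

theorem gbg (ht : 3 ≤ t) : D.g * (D.b * D.g) = 0 := by
  obtain ⟨m, rfl⟩ := Nat.exists_eq_add_of_le' ht
  rw [← mul_assoc, D.gb, show m + 3 - 1 = m + 2 by lia, pow_add, pow_two, mul_assoc, D.h2g,
    mul_zero]

theorem bgb (ht : 3 ≤ t) : D.b * (D.g * D.b) = 0 := by
  obtain ⟨m, rfl⟩ := Nat.exists_eq_add_of_le' ht
  rw [D.gb, show m + 3 - 1 = 2 + m by lia, pow_add, pow_two, ← mul_assoc, ← mul_assoc, D.bh2,
    zero_mul]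

theorem b_mul_gab_pow (n : ℕ) :
    D.b * (D.g * D.a * D.b) ^ n = (D.b * D.g * D.a) ^ n * D.b :=
  (SemiconjBy.pow_right (show SemiconjBy D.b (D.g * D.a * D.b) (D.b * D.g * D.a) by
    simp [SemiconjBy, mul_assoc]) n).eq

theorem g_mul_abg_pow (n : ℕ) :
    D.g * (D.a * D.b * D.g) ^ n = (D.g * D.a * D.b) ^ n * D.g :=
  (SemiconjBy.pow_right (show SemiconjBy D.g (D.a * D.b * D.g) (D.g * D.a * D.b) by
    simp [SemiconjBy, mul_assoc]) n).eq

theorem a_mul_bga_pow (n : ℕ) :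
    D.a * (D.b * D.g * D.a) ^ n = (D.a * D.b * D.g) ^ n * D.a :=
  (SemiconjBy.pow_right (show SemiconjBy D.a (D.b * D.g * D.a) (D.a * D.b * D.g) by
    simp [SemiconjBy, mul_assoc]) n).eq

theorem bhg_eq_abg (hk : 1 ≤ k) : D.b * D.h * D.g = (D.a * D.b * D.g) ^ k := by
  obtain ⟨m, rfl⟩ := Nat.exists_eq_add_of_le' hk
  rw [D.bh, Nat.add_sub_cancel, pow_succ, mul_assoc]

theorem bhg_eq_bga (hk : 1 ≤ k) : D.b * D.h * D.g = (D.b * D.g * D.a) ^ k := by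
  obtain ⟨m, rfl⟩ := Nat.exists_eq_add_of_le' hk
  rw [mul_assoc, D.hg, Nat.add_sub_cancel, ← mul_assoc, b_mul_gab_pow, pow_succ]
  simp only [mul_assoc]

theorem abg_pow_eq_bga_pow (hk : 1 ≤ k) :
    (D.a * D.b * D.g) ^ k = (D.b * D.g * D.a) ^ k := by
  rw [← D.bhg_eq_abg hk, D.bhg_eq_bga hk]

theorem h_pow_eq_gab_pow (hk : 1 ≤ k) (ht : 3 ≤ t) : D.h ^ t = (D.g * D.a * D.b) ^ k := by
  obtain ⟨m, rfl⟩ := Nat.exists_eq_add_of_le' hk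
  rw [← mul_pow_sub_one (by lia : t ≠ 0), ← D.gb, ← mul_assoc, D.hg,
    Nat.add_sub_cancel, pow_succ]
  simp only [mul_assoc]

theorem aab (hk : 1 ≤ k) (ht : 3 ≤ t) : D.a * (D.a * D.b) = 0 := by
  obtain ⟨m, rfl⟩ := Nat.exists_eq_add_of_le' hk
  rw [← mul_assoc, D.asq, pow_succ]
  simp [mul_assoc, D.bgb ht]

theorem gaa (hk : 1 ≤ k) (ht : 3 ≤ t) : D.g * (D.a * D.a) = 0 := by
  rw [D.asq, D.abg_pow_eq_bga_pow hk, mul_smul_comm]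
  obtain ⟨m, rfl⟩ := Nat.exists_eq_add_of_le' hk
  rw [pow_succ', ← mul_assoc, ← mul_assoc, D.gbg ht]
  simp

theorem hga (hk : 1 ≤ k) (ht : 3 ≤ t) : D.h * (D.g * D.a) = 0 := by
  rw [← mul_assoc, D.hg, mul_assoc, mul_assoc D.g D.a D.a, D.gaa hk ht, mul_zero]

theorem abh (hk : 1 ≤ k) (ht : 3 ≤ t) : D.a * (D.b * D.h) = 0 := by
  rw [D.bh]
  rcases Nat.eq_zero_or_pos (k - 1) with h0 | h0
  · rw [h0, pow_zero, one_mul, D.aab hk ht]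
  · obtain ⟨m, hm⟩ := Nat.exists_eq_add_of_le' h0
    rw [hm, pow_succ']
    simp only [mul_assoc]
    rw [← mul_assoc D.a D.b, mul_assoc_zero (D.aab hk ht)]

theorem aab_mul (hk : 1 ≤ k) (ht : 3 ≤ t) (r : A) : D.a * (D.a * (D.b * r)) = 0 := by
  rw [← mul_assoc D.a D.b, mul_assoc_zero (D.aab hk ht)]

theorem gbg_mul (ht : 3 ≤ t) (r : A) : D.g * (D.b * (D.g * r)) = 0 := by
  rw [← mul_assoc D.b D.g, mul_assoc_zero (D.gbg ht)]

theorem hga_mul (hk : 1 ≤ k) (ht : 3 ≤ t) (r : A) : D.h * (D.g * (D.a * r)) = 0 := by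
  rw [← mul_assoc D.g D.a, mul_assoc_zero (D.hga hk ht)]

end

/-- The letters of the path `⋯ βγα`, read from the right. -/
def lu (n : ℕ) : A := if n % 3 = 0 then D.a else if n % 3 = 1 then D.g else D.b
/-- The letters of the path `⋯ αβγ`, read from the right. -/
def lv (n : ℕ) : A := if n % 3 = 0 then D.g else if n % 3 = 1 then D.b else D.a
/-- The letters of the path `⋯ γαβ`, read from the right. -/
def lw (n : ℕ) : A := if n % 3 = 0 then D.b else if n % 3 = 1 then D.a else D.g

/-- The suffix of length `n` of the path `⋯ βγα`. -/
def u : ℕ → A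
  | 0 => D.e1
  | n + 1 => D.lu n * u n
/-- The suffix of length `n` of the path `⋯ αβγ`. -/
def v : ℕ → A
  | 0 => D.e1
  | n + 1 => D.lv n * v n
/-- The suffix of length `n` of the path `⋯ γαβ`. -/
def w : ℕ → A
  | 0 => D.e2
  | n + 1 => D.lw n * w n
/-- The powers of `η`, with `η ^ 0` read as the trivial path at vertex 2. -/
def y : ℕ → A
  | 0 => D.e2
  | n + 1 => D.h * y n

theorem u_succ (n : ℕ) : D.u (n + 1) = D.lu n * D.u n := rfl
theorem v_succ (n : ℕ) : D.v (n + 1) = D.lv n * D.v n := rfl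
theorem w_succ (n : ℕ) : D.w (n + 1) = D.lw n * D.w n := rfl
theorem y_succ (n : ℕ) : D.y (n + 1) = D.h * D.y n := rfl

theorem u_add_three (n : ℕ) : D.u (n + 3) = D.u n * (D.b * D.g * D.a) := by
  induction n with
  | zero => simp [u, lu, D.aR, ← mul_assoc, D.bL]
  | succ n ih => rw [show n + 1 + 3 = n + 3 + 1 by lia, u_succ, ih, u_succ, ← mul_assoc]; simp [lu]

theorem v_add_three (n : ℕ) : D.v (n + 3) = D.v n * (D.a * D.b * D.g) := by
  induction n with
  | zero => simp [v, lv, D.gR, ← mul_assoc, D.aL]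
  | succ n ih => rw [show n + 1 + 3 = n + 3 + 1 by lia, v_succ, ih, v_succ, ← mul_assoc]; simp [lv]

theorem w_add_three (n : ℕ) : D.w (n + 3) = D.w n * (D.g * D.a * D.b) := by
  induction n with
  | zero => simp [w, lw, D.bR, ← mul_assoc, D.gL]
  | succ n ih => rw [show n + 1 + 3 = n + 3 + 1 by lia, w_succ, ih, w_succ, ← mul_assoc]; simp [lw]

theorem u_add_mul (n i : ℕ) : D.u (n + 3 * i) = D.u n * (D.b * D.g * D.a) ^ i := by
  induction i with
  | zero => simp
  | succ i ih =>
    rw [show n + 3 * (i + 1) = n + 3 * i + 3 by lia, u_add_three, ih, pow_succ, mul_assoc]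

theorem v_add_mul (n i : ℕ) : D.v (n + 3 * i) = D.v n * (D.a * D.b * D.g) ^ i := by
  induction i with
  | zero => simp
  | succ i ih =>
    rw [show n + 3 * (i + 1) = n + 3 * i + 3 by lia, v_add_three, ih, pow_succ, mul_assoc]

theorem w_add_mul (n i : ℕ) : D.w (n + 3 * i) = D.w n * (D.g * D.a * D.b) ^ i := by
  induction i with
  | zero => simp
  | succ i ih =>
    rw [show n + 3 * (i + 1) = n + 3 * i + 3 by lia, w_add_three, ih, pow_succ, mul_assoc]

theorem y_add (n i : ℕ) : D.y (n + i) = D.y n * D.h ^ i := by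
  induction n with
  | zero =>
    induction i with
    | zero => simp
    | succ i ih =>
      rw [← add_assoc, y_succ, ih, y, pow_succ', ← mul_assoc, ← mul_assoc, D.hL, D.hR]
  | succ n ih => rw [show n + 1 + i = n + i + 1 by lia, y_succ, y_succ, ih, mul_assoc]

theorem e1_u (n : ℕ) : D.e1 * D.u n = if n % 3 = 2 then 0 else D.u n := by
  cases n with
  | zero => simp [u, D.idem1]
  | succ n => rw [u_succ, ← mul_assoc, lu]; split_ifs <;> first | lia | simp [D.aL, D.e1_g, D.bL]

theorem e1_v (n : ℕ) : D.e1 * D.v n = if n % 3 = 1 then 0 else D.v n := by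
  cases n with
  | zero => simp [v, D.idem1]
  | succ n => rw [v_succ, ← mul_assoc, lv]; split_ifs <;> first | lia | simp [D.aL, D.e1_g, D.bL]

theorem e1_w (n : ℕ) : D.e1 * D.w n = if n % 3 = 0 then 0 else D.w n := by
  cases n with
  | zero => simp [w, D.orth12]
  | succ n => rw [w_succ, ← mul_assoc, lw]; split_ifs <;> first | lia | simp [D.aL, D.e1_g, D.bL]

theorem e1_y (n : ℕ) : D.e1 * D.y n = 0 := by
  cases n with
  | zero => simp [y, D.orth12]
  | succ n => rw [y_succ, ← mul_assoc, D.e1_h, zero_mul]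

theorem e2_eq : D.e2 = 1 - D.e1 := by rw [← D.unit, add_sub_cancel_left]

theorem u_e1 (n : ℕ) : D.u n * D.e1 = D.u n := by
  induction n with
  | zero => exact D.idem1
  | succ n ih => rw [u_succ, mul_assoc, ih]

theorem v_e1 (n : ℕ) : D.v n * D.e1 = D.v n := by
  induction n with
  | zero => exact D.idem1
  | succ n ih => rw [v_succ, mul_assoc, ih]

theorem w_e1 (n : ℕ) : D.w n * D.e1 = 0 := by
  induction n with
  | zero => exact D.orth21
  | succ n ih => rw [w_succ, mul_assoc, ih, mul_zero]

theorem y_e1 (n : ℕ) : D.y n * D.e1 = 0 := by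
  induction n with
  | zero => exact D.orth21
  | succ n ih => rw [y_succ, mul_assoc, ih, mul_zero]

theorem u_three_mul (i : ℕ) : D.u (3 * i) = D.e1 * (D.b * D.g * D.a) ^ i := by
  rw [← zero_add (3 * i), u_add_mul, u]

theorem v_three_mul (i : ℕ) : D.v (3 * i) = D.e1 * (D.a * D.b * D.g) ^ i := by
  rw [← zero_add (3 * i), v_add_mul, v]

theorem w_three_mul (i : ℕ) : D.w (3 * i) = D.e2 * (D.g * D.a * D.b) ^ i := by
  rw [← zero_add (3 * i), w_add_mul, w]

theorem y_eq (i : ℕ) : D.y i = D.e2 * D.h ^ i := by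
  rw [← zero_add i, y_add, y, zero_add]

theorem u_top (hk : 1 ≤ k) : D.u (3 * k) = D.b * D.h * D.g := by
  rw [u_three_mul, ← D.bhg_eq_bga hk, ← mul_assoc, ← mul_assoc, D.bL]

theorem v_top (hk : 1 ≤ k) : D.v (3 * k) = D.u (3 * k) := by
  rw [u_top D hk, v_three_mul, ← D.bhg_eq_abg hk, ← mul_assoc, ← mul_assoc, D.bL]

theorem w_top (hk : 1 ≤ k) (ht : 3 ≤ t) : D.w (3 * k) = D.y t := by
  rw [w_three_mul, y_eq, D.h_pow_eq_gab_pow hk ht]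

theorem a_mul_a (hk : 1 ≤ k) : D.a * D.a = c • D.u (3 * k) := by
  rw [D.asq, D.u_top hk, D.bhg_eq_abg hk]

theorem a_u (hk : 1 ≤ k) (ht : 3 ≤ t) (n : ℕ) : D.a * D.u n =
    if n % 3 = 0 then D.u (n + 1) else if n = 1 then c • D.u (3 * k) else 0 := by
  match n with
  | 0 => simp [u, lu]
  | 1 => simpa [u, lu, D.aR] using D.a_mul_a hk
  | n + 2 =>
    by_cases h0 : (n + 2) % 3 = 0
    · rw [if_pos h0, u_succ _ (n + 2), lu, if_pos h0]
    · rw [if_neg h0, if_neg (by lia), u_succ, u_succ, lu, lu]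
      split_ifs <;> first | lia | simp [mul_assoc_zero D.a_g, D.aab_mul hk ht]

theorem g_u (ht : 3 ≤ t) (n : ℕ) : D.g * D.u n =
    if n = 0 then D.v 1 else if n % 3 = 1 then D.u (n + 1) else 0 := by
  match n with
  | 0 => simp [u, v, lv]
  | 1 => simp [u, lu]
  | n + 2 =>
    rw [if_neg (by lia)]
    by_cases h0 : (n + 2) % 3 = 1
    · rw [if_pos h0, u_succ _ (n + 2), lu, if_neg (by lia), if_pos h0]
    · rw [if_neg h0, u_succ, u_succ, lu, lu]
      split_ifs <;> first | lia | simp [mul_assoc_zero D.g_g, D.gbg_mul ht]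

theorem b_u (n : ℕ) : D.b * D.u n = if n % 3 = 2 then D.u (n + 1) else 0 := by
  cases n with
  | zero => simp [u, D.b_e1]
  | succ n =>
    rw [u_succ, lu]
    split_ifs <;> first | lia | skip
    · rw [mul_assoc_zero D.b_a]
    · rw [u_succ, u_succ, lu, lu, if_neg (by lia), if_neg (by lia), if_neg (by lia),
        if_pos (by lia)]
    · rw [mul_assoc_zero D.b_b]

theorem h_u (hk : 1 ≤ k) (ht : 3 ≤ t) (n : ℕ) : D.h * D.u n = 0 := by
  match n with
  | 0 => simp [u, D.h_e1]
  | 1 => rw [u, lu, if_pos rfl, mul_assoc_zero D.h_a]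
  | n + 2 =>
    rw [u_succ, u_succ, lu, lu]
    split_ifs <;> first | lia | simp [mul_assoc_zero D.h_a, mul_assoc_zero D.h_b, D.hga_mul hk ht]

theorem a_v (hk : 1 ≤ k) (ht : 3 ≤ t) (n : ℕ) : D.a * D.v n =
    if n = 0 then D.u 1 else if n % 3 = 2 then D.v (n + 1) else 0 := by
  match n with
  | 0 => simp [u, v, lu]
  | 1 => simp [v, lv, D.gR, D.a_g]
  | n + 2 =>
    rw [if_neg (by lia)]
    by_cases h0 : (n + 2) % 3 = 2
    · rw [if_pos h0, v_succ _ (n + 2), lv, if_neg (by lia), if_neg (by lia)]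
    · rw [if_neg h0, v_succ, v_succ, lv, lv]
      split_ifs <;> first | lia | simp [mul_assoc_zero D.a_g, D.aab_mul hk ht]

theorem g_v (ht : 3 ≤ t) (n : ℕ) : D.g * D.v n = if n % 3 = 0 then D.v (n + 1) else 0 := by
  match n with
  | 0 => simp [v, lv]
  | 1 => simp [v, lv, D.gR, D.g_g]
  | n + 2 =>
    by_cases h0 : (n + 2) % 3 = 0
    · rw [if_pos h0, v_succ _ (n + 2), lv, if_pos h0]
    · rw [if_neg h0, v_succ, v_succ, lv, lv]
      split_ifs <;> first | lia | simp [mul_assoc_zero D.g_g, D.gbg_mul ht]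

theorem b_v (n : ℕ) : D.b * D.v n = if n % 3 = 1 then D.v (n + 1) else 0 := by
  cases n with
  | zero => simp [v, D.b_e1]
  | succ n =>
    by_cases h0 : (n + 1) % 3 = 1
    · rw [if_pos h0, v_succ _ (n + 1), lv, if_neg (by lia), if_pos h0]
    · rw [if_neg h0, v_succ, lv]
      split_ifs <;> first | lia | simp [mul_assoc_zero D.b_a, mul_assoc_zero D.b_b]

theorem ga_bga_pow (n : ℕ) : D.g * D.a * (D.b * D.g * D.a) ^ n =
    (D.g * D.a * D.b) ^ n * (D.g * D.a) :=
  (SemiconjBy.pow_right (show SemiconjBy (D.g * D.a) (D.b * D.g * D.a) (D.g * D.a * D.b) by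
    simp [SemiconjBy, mul_assoc]) n).eq

theorem ab_gab_pow (n : ℕ) : D.a * D.b * (D.g * D.a * D.b) ^ n =
    (D.a * D.b * D.g) ^ n * (D.a * D.b) :=
  (SemiconjBy.pow_right (show SemiconjBy (D.a * D.b) (D.g * D.a * D.b) (D.a * D.b * D.g) by
    simp [SemiconjBy, mul_assoc]) n).eq

theorem bg_abg_pow (n : ℕ) : D.b * D.g * (D.a * D.b * D.g) ^ n =
    (D.b * D.g * D.a) ^ n * (D.b * D.g) :=
  (SemiconjBy.pow_right (show SemiconjBy (D.b * D.g) (D.a * D.b * D.g) (D.b * D.g * D.a) by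
    simp [SemiconjBy, mul_assoc]) n).eq

theorem u_three_mul_add_one (i : ℕ) : D.u (3 * i + 1) = (D.a * D.b * D.g) ^ i * D.a := by
  rw [← a_mul_bga_pow, add_comm, u_add_mul]
  simp [u, lu, D.aR]

theorem u_three_mul_add_two (i : ℕ) : D.u (3 * i + 2) = (D.g * D.a * D.b) ^ i * (D.g * D.a) := by
  rw [← ga_bga_pow, add_comm, u_add_mul]
  simp [u, lu, D.aR]

theorem v_three_mul_add_one (i : ℕ) : D.v (3 * i + 1) = (D.g * D.a * D.b) ^ i * D.g := by
  rw [← g_mul_abg_pow, add_comm, v_add_mul]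
  simp [v, lv, D.gR]

theorem v_three_mul_add_two (i : ℕ) : D.v (3 * i + 2) = (D.b * D.g * D.a) ^ i * (D.b * D.g) := by
  rw [← bg_abg_pow, add_comm, v_add_mul]
  simp [v, lv, D.gR]

theorem w_three_mul_add_one (i : ℕ) : D.w (3 * i + 1) = (D.b * D.g * D.a) ^ i * D.b := by
  rw [← b_mul_gab_pow, add_comm, w_add_mul]
  simp [w, lw, D.bR]

theorem w_three_mul_add_two (i : ℕ) : D.w (3 * i + 2) = (D.a * D.b * D.g) ^ i * (D.a * D.b) := by
  rw [← ab_gab_pow, add_comm, w_add_mul]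
  simp [w, lw, D.bR]

theorem h_mul_g (hk : 1 ≤ k) : D.h * D.g = D.u (3 * k - 1) := by
  rw [D.hg, show 3 * k - 1 = 3 * (k - 1) + 2 by lia, u_three_mul_add_two]

theorem b_mul_h (hk : 1 ≤ k) : D.b * D.h = D.w (3 * k - 1) := by
  rw [D.bh, show 3 * k - 1 = 3 * (k - 1) + 2 by lia, w_three_mul_add_two]

theorem g_mul_b (ht : 3 ≤ t) : D.g * D.b = D.y (t - 1) := by
  rw [D.gb, show t - 1 = t - 2 + 1 by lia, y_eq, pow_succ', ← mul_assoc, D.hL]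

theorem h_v (hk : 1 ≤ k) (ht : 3 ≤ t) (n : ℕ) : D.h * D.v n =
    if n = 1 then D.u (3 * k - 1) else 0 := by
  match n with
  | 0 => simp [v, D.h_e1]
  | 1 => simp [v, lv, D.gR, D.h_mul_g hk]
  | n + 2 =>
    rw [if_neg (by lia), v_succ, v_succ, lv, lv]
    split_ifs <;> first | lia | simp [mul_assoc_zero D.h_a, mul_assoc_zero D.h_b, D.hga_mul hk ht]

theorem a_w (hk : 1 ≤ k) (ht : 3 ≤ t) (n : ℕ) : D.a * D.w n =
    if n % 3 = 1 then D.w (n + 1) else 0 := by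
  match n with
  | 0 => simp [w, D.a_e2]
  | 1 => simp [w, lw]
  | n + 2 =>
    by_cases h0 : (n + 2) % 3 = 1
    · rw [if_pos h0, w_succ _ (n + 2), lw, if_neg (by lia), if_pos h0]
    · rw [if_neg h0, w_succ, w_succ, lw, lw]
      split_ifs <;> first | lia | simp [mul_assoc_zero D.a_g, D.aab_mul hk ht]

theorem b_w (n : ℕ) : D.b * D.w n = if n % 3 = 0 then D.w (n + 1) else 0 := by
  cases n with
  | zero => simp [w, lw]
  | succ n =>
    by_cases h0 : (n + 1) % 3 = 0
    · rw [if_pos h0, w_succ _ (n + 1), lw, if_pos h0]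
    · rw [if_neg h0, w_succ, lw]
      split_ifs <;> first | lia | simp [mul_assoc_zero D.b_a, mul_assoc_zero D.b_b]

theorem g_w (ht : 3 ≤ t) (n : ℕ) : D.g * D.w n =
    if n % 3 = 2 then D.w (n + 1) else if n = 1 then D.y (t - 1) else 0 := by
  match n with
  | 0 => simp [w, D.g_e2]
  | 1 => simp [w, lw, D.bR, D.g_mul_b ht]
  | n + 2 =>
    by_cases h0 : (n + 2) % 3 = 2
    · rw [if_pos h0, w_succ _ (n + 2), lw, if_neg (by lia), if_neg (by lia)]
    · rw [if_neg h0, if_neg (by lia), w_succ, w_succ, lw, lw]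
      split_ifs <;> first | lia | simp [mul_assoc_zero D.g_g, D.gbg_mul ht]

theorem h_w (hk : 1 ≤ k) (ht : 3 ≤ t) (n : ℕ) : D.h * D.w n = if n = 0 then D.y 1 else 0 := by
  match n with
  | 0 => simp [w, y]
  | 1 => simp [w, lw, D.bR, D.h_b]
  | n + 2 =>
    rw [if_neg (by lia), w_succ, w_succ, lw, lw]
    split_ifs <;> first | lia | simp [mul_assoc_zero D.h_a, mul_assoc_zero D.h_b, D.hga_mul hk ht]

theorem a_y (n : ℕ) : D.a * D.y n = 0 := by
  cases n with
  | zero => exact D.a_e2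
  | succ n => rw [y_succ, mul_assoc_zero D.a_h]

theorem g_y (n : ℕ) : D.g * D.y n = 0 := by
  cases n with
  | zero => exact D.g_e2
  | succ n => rw [y_succ, mul_assoc_zero D.g_h]

theorem b_y (hk : 1 ≤ k) (n : ℕ) : D.b * D.y n =
    if n = 0 then D.w 1 else if n = 1 then D.w (3 * k - 1) else 0 := by
  match n with
  | 0 => simp [w, y, lw]
  | 1 => simp [y, D.hR, D.b_mul_h hk]
  | n + 2 =>
    rw [if_neg (by lia), if_neg (by lia), y_succ, y_succ, ← mul_assoc, ← mul_assoc, D.bh2,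
      zero_mul]

theorem h_y (n : ℕ) : D.h * D.y n = D.y (n + 1) := rfl

theorem u_a (hk : 1 ≤ k) (ht : 3 ≤ t) (n : ℕ) : D.u n * D.a =
    if n = 0 then D.u 1 else if n = 1 then c • D.u (3 * k) else 0 := by
  match n with
  | 0 => simp [u, lu, D.aL, D.aR]
  | 1 => simp [u, lu, D.aR, D.a_mul_a hk]
  | n + 2 =>
    rw [if_neg (by lia), if_neg (by lia)]
    induction n with
    | zero => simp [u, lu, D.aR, mul_assoc, D.gaa hk ht]
    | succ n ih => rw [u_succ, mul_assoc, ih, mul_zero]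

theorem u_b (n : ℕ) : D.u n * D.b = D.w (n + 1) := by
  induction n with
  | zero => simp [u, w, lw, D.bL, D.bR]
  | succ n ih =>
    rw [u_succ, mul_assoc, ih, w_succ _ (n + 1), lu, lw]
    split_ifs <;> first | rfl | lia

theorem u_g (n : ℕ) : D.u n * D.g = 0 := by
  rw [← u_e1, mul_assoc, D.e1_g, mul_zero]

theorem u_h (n : ℕ) : D.u n * D.h = 0 := by
  rw [← u_e1, mul_assoc, D.e1_h, mul_zero]

theorem v_a (n : ℕ) : D.v n * D.a = D.u (n + 1) := by
  induction n with
  | zero => simp [u, v, lu, D.aL, D.aR]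
  | succ n ih =>
    rw [v_succ, mul_assoc, ih, u_succ _ (n + 1), lu, lv]
    split_ifs <;> first | rfl | lia

theorem v_b (ht : 3 ≤ t) (n : ℕ) : D.v n * D.b =
    if n = 0 then D.w 1 else if n = 1 then D.y (t - 1) else 0 := by
  match n with
  | 0 => simp [v, w, lw, D.bL, D.bR]
  | 1 => simp [v, lv, D.gR, D.g_mul_b ht]
  | n + 2 =>
    rw [if_neg (by lia), if_neg (by lia)]
    induction n with
    | zero => simp [v, lv, D.gR, mul_assoc, D.bgb ht]
    | succ n ih => rw [v_succ, mul_assoc, ih, mul_zero]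

theorem v_g (n : ℕ) : D.v n * D.g = 0 := by
  rw [← v_e1, mul_assoc, D.e1_g, mul_zero]

theorem v_h (n : ℕ) : D.v n * D.h = 0 := by
  rw [← v_e1, mul_assoc, D.e1_h, mul_zero]

theorem w_a (n : ℕ) : D.w n * D.a = 0 := by
  rw [← D.aL, ← mul_assoc, w_e1, zero_mul]

theorem w_b (n : ℕ) : D.w n * D.b = 0 := by
  rw [← D.bL, ← mul_assoc, w_e1, zero_mul]

theorem w_g (n : ℕ) : D.w n * D.g = D.v (n + 1) := by
  induction n with
  | zero => simp [v, w, lv, D.gL, D.gR]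
  | succ n ih =>
    rw [w_succ, mul_assoc, ih, v_succ _ (n + 1), lv, lw]
    split_ifs <;> first | rfl | lia

theorem w_h (hk : 1 ≤ k) (ht : 3 ≤ t) (n : ℕ) : D.w n * D.h =
    if n = 0 then D.y 1 else if n = 1 then D.w (3 * k - 1) else 0 := by
  match n with
  | 0 => simp [y, w, D.hL, D.hR]
  | 1 => simp [w, lw, D.bR, D.b_mul_h hk]
  | n + 2 =>
    rw [if_neg (by lia), if_neg (by lia)]
    induction n with
    | zero => simp [w, lw, D.bR, mul_assoc, D.abh hk ht]
    | succ n ih => rw [w_succ, mul_assoc, ih, mul_zero]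

theorem y_a (n : ℕ) : D.y n * D.a = 0 := by
  rw [← D.aL, ← mul_assoc, y_e1, zero_mul]

theorem y_b (n : ℕ) : D.y n * D.b = 0 := by
  rw [← D.bL, ← mul_assoc, y_e1, zero_mul]

theorem y_h (n : ℕ) : D.y n * D.h = D.y (n + 1) := by
  rw [y_add, pow_one]

theorem y_g (hk : 1 ≤ k) (n : ℕ) : D.y n * D.g =
    if n = 0 then D.v 1 else if n = 1 then D.u (3 * k - 1) else 0 := by
  match n with
  | 0 => simp [y, v, lv, D.gL, D.gR]
  | 1 => simp [y, D.hR, D.h_mul_g hk]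
  | n + 2 =>
    rw [if_neg (by lia), if_neg (by lia)]
    induction n with
    | zero => simp [y, D.hR, D.h2g]
    | succ n ih => rw [y_succ, mul_assoc, ih, mul_zero]

theorem y_eq_zero (ht : 3 ≤ t) {n : ℕ} (hn : t < n) : D.y n = 0 := by
  obtain ⟨m, rfl⟩ : ∃ m, n = t - 1 + 2 + m := ⟨n - t - 1, by lia⟩
  rw [y_add, y_succ, y_succ, ← D.g_mul_b ht, ← mul_assoc, ← mul_assoc, D.h2g, zero_mul, zero_mul]

theorem u_eq_zero (hk : 1 ≤ k) (ht : 3 ≤ t) {n : ℕ} (hn : 3 * k < n) : D.u n = 0 := by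
  obtain ⟨m, rfl⟩ := Nat.exists_eq_add_of_lt hn
  induction m with
  | zero =>
    rw [add_zero, u_succ, lu, if_pos (by lia), ← v_top D hk, D.a_v hk ht, if_neg (by lia),
      if_neg (by lia)]
  | succ m ih => rw [← add_assoc, u_succ, ih (by lia), mul_zero]

theorem v_eq_zero (hk : 1 ≤ k) (ht : 3 ≤ t) {n : ℕ} (hn : 3 * k < n) : D.v n = 0 := by
  obtain ⟨m, rfl⟩ := Nat.exists_eq_add_of_lt hn
  induction m with
  | zero =>
    rw [add_zero, v_succ, lv, if_pos (by lia), v_top D hk, D.g_u ht, if_neg (by lia),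
      if_neg (by lia)]
  | succ m ih => rw [← add_assoc, v_succ, ih (by lia), mul_zero]

theorem w_eq_zero (hk : 1 ≤ k) (ht : 3 ≤ t) {n : ℕ} (hn : 3 * k < n) : D.w n = 0 := by
  obtain ⟨m, rfl⟩ := Nat.exists_eq_add_of_lt hn
  induction m with
  | zero =>
    rw [add_zero, w_succ, lw, if_pos (by lia), w_top D hk ht, D.b_y hk, if_neg (by lia),
      if_neg (by lia)]
  | succ m ih => rw [← add_assoc, w_succ, ih (by lia), mul_zero]

end Realization

namespace Realization

variable {F : Type} [Field F] {k t : ℕ} {c : F} {A : Type} [Ring A] [Algebra F A]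
  (D : Realization F k t c A)

/-- The images of the generators. -/
def toFun : Gen → A
  | .e1 => D.e1
  | .e2 => D.e2
  | .a => D.a
  | .b => D.b
  | .g => D.g
  | .h => D.h

/-- The algebra homomorphism from `B^{k,t}_c` determined by a realization. -/
def lift : BA F k t c →ₐ[F] A :=
  RingQuot.liftAlgHom F ⟨FreeAlgebra.lift F D.toFun, by
    intro x y hxy
    cases hxy <;>
      simp only [gen, map_mul, map_add, map_one, map_zero, map_pow, map_smul,
        FreeAlgebra.lift_ι_apply, toFun]
    exacts [D.unit, D.idem1, D.idem2, D.orth12, D.orth21, D.aL, D.aR, D.bL, D.bR, D.gL, D.gR,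
      D.hL, D.hR, D.bh, D.gb, D.hg, D.bh2, D.h2g, D.asq]⟩

theorem lift_mk (x : FreeAlgebra F Gen) :
    D.lift (SD2Paper.mk F k t c x) = FreeAlgebra.lift F D.toFun x :=
  RingQuot.liftAlgHom_mkAlgHom_apply F _ _ x

theorem lift_gen (x : Gen) : D.lift (SD2Paper.mk F k t c (gen F x)) = D.toFun x := by
  rw [lift_mk, gen, FreeAlgebra.lift_ι_apply]

/-- The span of the paths of length at least `m`. -/
def fil (m : ℕ) : Submodule F A :=
  Submodule.span F {z | ∃ n, m ≤ n ∧ (z = D.u n ∨ z = D.v n ∨ z = D.w n ∨ z = D.y n)}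

theorem u_mem {m n : ℕ} (h : m ≤ n) : D.u n ∈ D.fil m := Submodule.subset_span ⟨n, h, by simp⟩
theorem v_mem {m n : ℕ} (h : m ≤ n) : D.v n ∈ D.fil m := Submodule.subset_span ⟨n, h, by simp⟩
theorem w_mem {m n : ℕ} (h : m ≤ n) : D.w n ∈ D.fil m := Submodule.subset_span ⟨n, h, by simp⟩
theorem y_mem {m n : ℕ} (h : m ≤ n) : D.y n ∈ D.fil m := Submodule.subset_span ⟨n, h, by simp⟩

theorem fil_le {m : ℕ} {M : Submodule F A} (hu : ∀ n, m ≤ n → D.u n ∈ M)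
    (hv : ∀ n, m ≤ n → D.v n ∈ M) (hw : ∀ n, m ≤ n → D.w n ∈ M) (hy : ∀ n, m ≤ n → D.y n ∈ M) :
    D.fil m ≤ M := by
  refine Submodule.span_le.2 ?_
  rintro _ ⟨n, hn, rfl | rfl | rfl | rfl⟩
  exacts [hu n hn, hv n hn, hw n hn, hy n hn]

theorem fil_anti {m n : ℕ} (h : m ≤ n) : D.fil n ≤ D.fil m :=
  D.fil_le (fun _ hn => D.u_mem (h.trans hn)) (fun _ hn => D.v_mem (h.trans hn))
    (fun _ hn => D.w_mem (h.trans hn)) (fun _ hn => D.y_mem (h.trans hn))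

theorem a_mul_mem (hk : 1 ≤ k) (ht : 3 ≤ t) (m : ℕ) :
    D.fil m ≤ (D.fil (m + 1)).comap (LinearMap.mulLeft F D.a) := by
  refine D.fil_le ?_ ?_ ?_ ?_ <;> intro n hn <;>
    simp only [Submodule.mem_comap, LinearMap.mulLeft_apply]
  · rw [D.a_u hk ht]
    split_ifs
    exacts [D.u_mem (by lia), Submodule.smul_mem _ _ (D.u_mem (by lia)), zero_mem _]
  · rw [D.a_v hk ht]
    split_ifs
    exacts [D.u_mem (by lia), D.v_mem (by lia), zero_mem _]
  · rw [D.a_w hk ht]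
    split_ifs
    exacts [D.w_mem (by lia), zero_mem _]
  · rw [D.a_y]
    exact zero_mem _

theorem b_mul_mem (hk : 1 ≤ k) (m : ℕ) :
    D.fil m ≤ (D.fil (m + 1)).comap (LinearMap.mulLeft F D.b) := by
  refine D.fil_le ?_ ?_ ?_ ?_ <;> intro n hn <;>
    simp only [Submodule.mem_comap, LinearMap.mulLeft_apply]
  · rw [D.b_u]
    split_ifs
    exacts [D.u_mem (by lia), zero_mem _]
  · rw [D.b_v]
    split_ifs
    exacts [D.v_mem (by lia), zero_mem _]
  · rw [D.b_w]
    split_ifs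
    exacts [D.w_mem (by lia), zero_mem _]
  · rw [D.b_y hk]
    split_ifs
    exacts [D.w_mem (by lia), D.w_mem (by lia), zero_mem _]

theorem g_mul_mem (ht : 3 ≤ t) (m : ℕ) :
    D.fil m ≤ (D.fil (m + 1)).comap (LinearMap.mulLeft F D.g) := by
  refine D.fil_le ?_ ?_ ?_ ?_ <;> intro n hn <;>
    simp only [Submodule.mem_comap, LinearMap.mulLeft_apply]
  · rw [D.g_u ht]
    split_ifs
    exacts [D.v_mem (by lia), D.u_mem (by lia), zero_mem _]
  · rw [D.g_v ht]
    split_ifs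
    exacts [D.v_mem (by lia), zero_mem _]
  · rw [D.g_w ht]
    split_ifs
    exacts [D.w_mem (by lia), D.y_mem (by lia), zero_mem _]
  · rw [D.g_y]
    exact zero_mem _

theorem h_mul_mem (hk : 1 ≤ k) (ht : 3 ≤ t) (m : ℕ) :
    D.fil m ≤ (D.fil (m + 1)).comap (LinearMap.mulLeft F D.h) := by
  refine D.fil_le ?_ ?_ ?_ ?_ <;> intro n hn <;>
    simp only [Submodule.mem_comap, LinearMap.mulLeft_apply]
  · rw [D.h_u hk ht]
    exact zero_mem _
  · rw [D.h_v hk ht]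
    split_ifs
    exacts [D.u_mem (by lia), zero_mem _]
  · rw [D.h_w hk ht]
    split_ifs
    exacts [D.y_mem (by lia), zero_mem _]
  · rw [D.h_y]
    exact D.y_mem (by lia)

theorem e1_mul_mem (m : ℕ) : D.fil m ≤ (D.fil m).comap (LinearMap.mulLeft F D.e1) := by
  refine D.fil_le ?_ ?_ ?_ ?_ <;> intro n hn <;>
    simp only [Submodule.mem_comap, LinearMap.mulLeft_apply]
  · rw [D.e1_u]
    split_ifs
    exacts [zero_mem _, D.u_mem hn]
  · rw [D.e1_v]
    split_ifs
    exacts [zero_mem _, D.v_mem hn]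
  · rw [D.e1_w]
    split_ifs
    exacts [zero_mem _, D.w_mem hn]
  · rw [D.e1_y]
    exact zero_mem _

theorem e2_mul_mem (m : ℕ) : D.fil m ≤ (D.fil m).comap (LinearMap.mulLeft F D.e2) := by
  intro x hx
  simp only [Submodule.mem_comap, LinearMap.mulLeft_apply]
  rw [e2_eq, sub_mul, one_mul]
  exact sub_mem hx (D.e1_mul_mem m hx)

theorem one_mem_fil : (1 : A) ∈ D.fil 0 := by
  rw [← D.unit]
  exact add_mem (D.u_mem le_rfl) (D.w_mem le_rfl)

theorem fil_eq_bot (hk : 1 ≤ k) (ht : 3 ≤ t) {m : ℕ} (hm : 3 * k + t < m) : D.fil m = ⊥ := by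
  rw [eq_bot_iff]
  refine D.fil_le ?_ ?_ ?_ ?_ <;> intro n hn <;> rw [Submodule.mem_bot]
  exacts [D.u_eq_zero hk ht (by lia), D.v_eq_zero hk ht (by lia), D.w_eq_zero hk ht (by lia),
    D.y_eq_zero ht (by lia)]

theorem finite_fil (hk : 1 ≤ k) (ht : 3 ≤ t) : Module.Finite F (D.fil 0) := by
  refine Module.Finite.span_of_finite F (Set.Finite.subset (s := insert 0
    ((D.u '' Set.Iic (3 * k)) ∪ (D.v '' Set.Iic (3 * k)) ∪ (D.w '' Set.Iic (3 * k)) ∪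
      (D.y '' Set.Iic t))) ?_ ?_)
  · exact ((((Set.finite_Iic _).image _).union ((Set.finite_Iic _).image _)).union
      ((Set.finite_Iic _).image _)).union ((Set.finite_Iic _).image _) |>.insert _
  · rintro _ ⟨n, -, rfl | rfl | rfl | rfl⟩
    · rcases le_or_gt n (3 * k) with h | h
      · exact .inr <| .inl <| .inl <| .inl ⟨n, h, rfl⟩
      · exact .inl (D.u_eq_zero hk ht h)
    · rcases le_or_gt n (3 * k) with h | h
      · exact .inr <| .inl <| .inl <| .inr ⟨n, h, rfl⟩
      · exact .inl (D.v_eq_zero hk ht h)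
    · rcases le_or_gt n (3 * k) with h | h
      · exact .inr <| .inl <| .inr ⟨n, h, rfl⟩
      · exact .inl (D.w_eq_zero hk ht h)
    · rcases le_or_gt n t with h | h
      · exact .inr <| .inr ⟨n, h, rfl⟩
      · exact .inl (D.y_eq_zero ht h)

end Realization

section Standard

variable {F : Type} [Field F] {k t : ℕ} {c : F}

theorem mk_rel {x y : FreeAlgebra F Gen} (h : Rel F k t c x y) : mk F k t c x = mk F k t c y :=
  RingQuot.mkAlgHom_rel F h

variable (F k t c) in
/-- The generators of `B^{k,t}_c`. -/
def std : Realization F k t c (BA F k t c) where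
  e1 := E1 F k t c
  e2 := E2 F k t c
  a := Al F k t c
  b := Be F k t c
  g := Ga F k t c
  h := Et F k t c
  unit := by
    have h := mk_rel (.unit (F := F) (k := k) (t := t) (c := c))
    simp only [map_add, map_one] at h
    exact h
  idem1 := by
    have h := mk_rel (.idem1 (F := F) (k := k) (t := t) (c := c))
    simp only [map_mul] at h
    exact h
  idem2 := by
    have h := mk_rel (.idem2 (F := F) (k := k) (t := t) (c := c))
    simp only [map_mul] at h
    exact h
  orth12 := by
    have h := mk_rel (.orth12 (F := F) (k := k) (t := t) (c := c))
    simp only [map_mul, map_zero] at h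
    exact h
  orth21 := by
    have h := mk_rel (.orth21 (F := F) (k := k) (t := t) (c := c))
    simp only [map_mul, map_zero] at h
    exact h
  aL := by
    have h := mk_rel (.aL (F := F) (k := k) (t := t) (c := c))
    simp only [map_mul] at h
    exact h
  aR := by
    have h := mk_rel (.aR (F := F) (k := k) (t := t) (c := c))
    simp only [map_mul] at h
    exact h
  bL := by
    have h := mk_rel (.bL (F := F) (k := k) (t := t) (c := c))
    simp only [map_mul] at h
    exact h
  bR := by
    have h := mk_rel (.bR (F := F) (k := k) (t := t) (c := c))
    simp only [map_mul] at h
    exact h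
  gL := by
    have h := mk_rel (.gL (F := F) (k := k) (t := t) (c := c))
    simp only [map_mul] at h
    exact h
  gR := by
    have h := mk_rel (.gR (F := F) (k := k) (t := t) (c := c))
    simp only [map_mul] at h
    exact h
  hL := by
    have h := mk_rel (.hL (F := F) (k := k) (t := t) (c := c))
    simp only [map_mul] at h
    exact h
  hR := by
    have h := mk_rel (.hR (F := F) (k := k) (t := t) (c := c))
    simp only [map_mul] at h
    exact h
  bh := by
    have h := mk_rel (.bh (F := F) (k := k) (t := t) (c := c))
    simp only [map_mul, map_pow] at h
    exact h
  gb := by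
    have h := mk_rel (.gb (F := F) (k := k) (t := t) (c := c))
    simp only [map_mul, map_pow] at h
    exact h
  hg := by
    have h := mk_rel (.hg (F := F) (k := k) (t := t) (c := c))
    simp only [map_mul, map_pow] at h
    exact h
  bh2 := by
    have h := mk_rel (.bh2 (F := F) (k := k) (t := t) (c := c))
    simp only [map_mul, map_zero] at h
    exact h
  h2g := by
    have h := mk_rel (.h2g (F := F) (k := k) (t := t) (c := c))
    simp only [map_mul, map_zero] at h
    exact h
  asq := by
    have h := mk_rel (.asq (F := F) (k := k) (t := t) (c := c))
    simp only [map_mul, map_pow, map_smul] at h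
    exact h

theorem subalgebra_eq_top {S : Subalgebra F (BA F k t c)} (h1 : (std F k t c).e1 ∈ S)
    (h2 : (std F k t c).e2 ∈ S) (ha : (std F k t c).a ∈ S) (hb : (std F k t c).b ∈ S)
    (hg : (std F k t c).g ∈ S) (hh : (std F k t c).h ∈ S) : S = ⊤ := by
  rw [eq_top_iff]
  rintro x -
  obtain ⟨p, rfl⟩ := RingQuot.mkAlgHom_surjective F (Rel F k t c) x
  have hp : Algebra.adjoin F (Set.range (FreeAlgebra.ι F)) ≤ S.comap (mk F k t c) := by
    refine Algebra.adjoin_le ?_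
    rintro _ ⟨x, rfl⟩
    cases x
    exacts [h1, h2, ha, hb, hg, hh]
  rw [FreeAlgebra.adjoin_range_ι] at hp
  exact hp (Algebra.mem_top (x := p))

theorem mul_mem_fil (hk : 1 ≤ k) (ht : 3 ≤ t) (m : ℕ) (x : BA F k t c) {z : BA F k t c}
    (hz : z ∈ (std F k t c).fil m) : x * z ∈ (std F k t c).fil m := by
  let S : Subalgebra F (BA F k t c) :=
    { carrier := {x | ∀ z ∈ (std F k t c).fil m, x * z ∈ (std F k t c).fil m}
      mul_mem' := fun {x y} hx hy m hm => by rw [mul_assoc]; exact hx _ (hy _ hm)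
      add_mem' := fun {x y} hx hy m hm => by rw [add_mul]; exact add_mem (hx _ hm) (hy _ hm)
      algebraMap_mem' := fun r m hm => by
        rw [← Algebra.smul_def]; exact Submodule.smul_mem _ r hm }
  have hS : S = ⊤ := subalgebra_eq_top (fun z hz => (std F k t c).e1_mul_mem m hz)
    (fun z hz => (std F k t c).e2_mul_mem m hz)
    (fun z hz => (std F k t c).fil_anti m.le_succ ((std F k t c).a_mul_mem hk ht m hz))
    (fun z hz => (std F k t c).fil_anti m.le_succ ((std F k t c).b_mul_mem hk m hz))
    (fun z hz => (std F k t c).fil_anti m.le_succ ((std F k t c).g_mul_mem ht m hz))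
    (fun z hz => (std F k t c).fil_anti m.le_succ ((std F k t c).h_mul_mem hk ht m hz))
  have hx : x ∈ S := hS ▸ Algebra.mem_top
  exact hx z hz

theorem fil_zero (hk : 1 ≤ k) (ht : 3 ≤ t) : (std F k t c).fil 0 = ⊤ := by
  rw [eq_top_iff]
  rintro x -
  simpa using mul_mem_fil hk ht 0 x (std F k t c).one_mem_fil

theorem finite_BA (hk : 1 ≤ k) (ht : 3 ≤ t) : Module.Finite F (BA F k t c) := by
  have h := (std F k t c).finite_fil hk ht
  rw [fil_zero hk ht] at h
  exact Module.Finite.equiv Submodule.topEquiv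

/-- A submodule containing all the basis paths is everything. -/
theorem eq_top_of_paths (hk : 1 ≤ k) (ht : 3 ≤ t) {M : Submodule F (BA F k t c)}
    (hu : ∀ n, (std F k t c).u n ∈ M) (hv : ∀ n, (std F k t c).v n ∈ M)
    (hw : ∀ n, (std F k t c).w n ∈ M) (hy : ∀ n, (std F k t c).y n ∈ M) : M = ⊤ := by
  rw [eq_top_iff, ← fil_zero hk ht]
  exact Realization.fil_le _ (fun n _ => hu n) (fun n _ => hv n) (fun n _ => hw n) fun n _ => hy n

theorem isNilpotent_mul (hk : 1 ≤ k) (ht : 3 ≤ t) {x : BA F k t c}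
    (hx : ∀ m, (std F k t c).fil m ≤
      ((std F k t c).fil (m + 1)).comap (LinearMap.mulLeft F x)) (r : BA F k t c) :
    IsNilpotent (r * x) := by
  have h (m : ℕ) : (r * x) ^ m ∈ (std F k t c).fil m := by
    induction m with
    | zero => rw [pow_zero]; exact Realization.one_mem_fil _
    | succ m ih =>
      rw [pow_succ', mul_assoc]
      exact mul_mem_fil hk ht _ _ (hx m ih)
  refine ⟨3 * k + t + 1, ?_⟩
  have := h (3 * k + t + 1)
  rwa [Realization.fil_eq_bot _ hk ht (by lia), Submodule.mem_bot] at this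

theorem mul_eq_zero_of_mem_socle {R : Type} [Ring R] {x : R} (hx : ∀ r, IsNilpotent (r * x))
    {v : R} (hv : v ∈ socle R) : x * v = 0 := by
  let N : Submodule R R :=
    { carrier := {v | ∀ r, x * (r * v) = 0}
      add_mem' := fun {v w} hv hw r => by rw [mul_add, mul_add, hv r, hw r, add_zero]
      zero_mem' := fun r => by simp
      smul_mem' := fun s v hv r => by
        rw [smul_eq_mul, ← mul_assoc r]
        exact hv _ }
  have hN : socle R ≤ N := by
    refine sSup_le fun S hS v hv r => ?_
    by_contra hne
    have hr : r * v ∈ S := S.smul_mem r hv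
    have hspan : Submodule.span R {x * (r * v)} = S := by
      refine (hS.le_iff.1 ((Submodule.span_singleton_le_iff_mem _ _).2
        (S.smul_mem x hr))).resolve_left ?_
      rwa [Submodule.span_singleton_eq_bot]
    rw [← hspan, Submodule.mem_span_singleton] at hr
    obtain ⟨s, hs⟩ := hr
    rw [smul_eq_mul, ← mul_assoc] at hs
    obtain ⟨n, hn⟩ := hx s
    have hpow (n : ℕ) : (s * x) ^ n * (r * v) = r * v := by
      induction n with
      | zero => simp
      | succ n ih => rw [pow_succ, mul_assoc, hs, ih]
    have := hpow n
    rw [hn, zero_mul] at this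
    rw [← this, mul_zero] at hne
    exact hne rfl
  simpa using hN hv 1

theorem mem_socle_of_eigenvector {A : Type} [Ring A] [Algebra F A] {s : A}
    (h : ∀ r : A, ∃ d : F, r * s = d • s) : s ∈ socle A := by
  rcases eq_or_ne s 0 with rfl | hs
  · exact zero_mem _
  refine le_sSup (a := Submodule.span A {s}) ?_ (Submodule.mem_span_singleton_self s)
  refine ⟨by rwa [Ne, Submodule.span_singleton_eq_bot], fun B hB => ?_⟩
  by_contra hne
  obtain ⟨b, hb, hb0⟩ := Submodule.exists_mem_ne_zero_of_ne_bot hne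
  obtain ⟨r, rfl⟩ := Submodule.mem_span_singleton.1 (hB.le hb)
  obtain ⟨d, hd⟩ := h r
  rw [smul_eq_mul, hd] at hb hb0
  have hd0 : d ≠ 0 := fun h0 => hb0 (by rw [h0, zero_smul])
  refine hB.not_ge ((Submodule.span_singleton_le_iff_mem _ _).2 ?_)
  have := B.smul_mem (algebraMap F A d⁻¹) hb
  rwa [smul_eq_mul, ← Algebra.smul_def, inv_smul_smul₀ hd0] at this

theorem exists_mul_eq_smul {s : BA F k t c} (h1 : ∃ d : F, (std F k t c).e1 * s = d • s)
    (ha : (std F k t c).a * s = 0) (hb : (std F k t c).b * s = 0)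
    (hg : (std F k t c).g * s = 0) (hh : (std F k t c).h * s = 0) (r : BA F k t c) :
    ∃ d : F, r * s = d • s := by
  let S : Subalgebra F (BA F k t c) :=
    { carrier := {x | ∃ d : F, x * s = d • s}
      mul_mem' := by
        rintro x y ⟨d, hd⟩ ⟨e, he⟩
        exact ⟨e * d, by rw [mul_assoc, he, mul_smul_comm, hd, smul_smul]⟩
      add_mem' := by
        rintro x y ⟨d, hd⟩ ⟨e, he⟩
        exact ⟨d + e, by rw [add_mul, hd, he, add_smul]⟩
      algebraMap_mem' := fun r => ⟨r, by rw [← Algebra.smul_def]⟩ }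
  have hS : S = ⊤ := by
    refine subalgebra_eq_top h1 ?_ ⟨0, by rw [ha, zero_smul]⟩ ⟨0, by rw [hb, zero_smul]⟩
      ⟨0, by rw [hg, zero_smul]⟩ ⟨0, by rw [hh, zero_smul]⟩
    obtain ⟨d, hd⟩ := h1
    exact ⟨1 - d, by rw [Realization.e2_eq, sub_mul, hd, one_mul, sub_smul, one_smul]⟩
  have hr : r ∈ S := hS ▸ Algebra.mem_top
  exact hr

end Standard

section SocleForm

variable {F : Type} [Field F] {k t : ℕ} {c : F}

theorem std_u_mem_BB (hk : 1 ≤ k) {n : ℕ} (hn : n ≤ 3 * k) : (std F k t c).u n ∈ BB F k t c := by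
  obtain ⟨i, rfl | rfl | rfl⟩ : ∃ i, n = 3 * i ∨ n = 3 * i + 1 ∨ n = 3 * i + 2 :=
    ⟨n / 3, by lia⟩
  · rcases Nat.eq_zero_or_pos i with rfl | hi
    · exact .inl <| .inl <| .inl <| .inl <| .inl <| .inl <| .inl <| .inl rfl
    rcases (show i ≤ k by lia).eq_or_lt with rfl | hik
    · rw [Realization.u_top _ hk, Realization.bhg_eq_abg _ hk]
      exact .inl <| .inl <| .inl <| .inl <| .inl <| .inl <| .inl <| .inr <| .inr <| .inr rfl
    · rw [Realization.u_three_mul]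
      refine .inl <| .inl <| .inl <| .inl <| .inr ⟨i, ⟨hi, by lia⟩, ?_⟩
      obtain ⟨j, rfl⟩ := Nat.exists_eq_add_of_le' hi
      simp only [pow_succ', ← mul_assoc, Realization.bL]
      rfl
  · rw [Realization.u_three_mul_add_one]
    rcases Nat.eq_zero_or_pos i with rfl | hi
    · rw [pow_zero, one_mul]
      exact .inl <| .inl <| .inl <| .inl <| .inl <| .inl <| .inl <| .inr <| .inl rfl
    · exact .inl <| .inl <| .inl <| .inl <| .inl <| .inr ⟨i, ⟨hi, by lia⟩, rfl⟩
  · rw [Realization.u_three_mul_add_two]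
    rcases Nat.eq_zero_or_pos i with rfl | hi
    · rw [pow_zero, one_mul]
      exact .inl <| .inr <| .inl <| .inl <| .inr rfl
    · exact .inl <| .inr <| .inr ⟨i, ⟨hi, by lia⟩, rfl⟩

theorem std_v_mem_BB (hk : 1 ≤ k) {n : ℕ} (hn : n ≤ 3 * k) : (std F k t c).v n ∈ BB F k t c := by
  obtain ⟨i, rfl | rfl | rfl⟩ : ∃ i, n = 3 * i ∨ n = 3 * i + 1 ∨ n = 3 * i + 2 :=
    ⟨n / 3, by lia⟩
  · rcases Nat.eq_zero_or_pos i with rfl | hi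
    · exact std_u_mem_BB hk (n := 0) (Nat.zero_le _)
    rcases (show i ≤ k by lia).eq_or_lt with rfl | hik
    · rw [Realization.v_top _ hk]
      exact std_u_mem_BB hk le_rfl
    · rw [Realization.v_three_mul]
      refine .inl <| .inl <| .inl <| .inl <| .inl <| .inl <| .inr ⟨i, ⟨hi, by lia⟩, ?_⟩
      obtain ⟨j, rfl⟩ := Nat.exists_eq_add_of_le' hi
      simp only [pow_succ', ← mul_assoc, Realization.aL]
      rfl
  · rw [Realization.v_three_mul_add_one]
    rcases Nat.eq_zero_or_pos i with rfl | hi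
    · rw [pow_zero, one_mul]
      exact .inl <| .inr <| .inl <| .inl <| .inl rfl
    · exact .inl <| .inr <| .inl <| .inr ⟨i, ⟨hi, by lia⟩, rfl⟩
  · rw [Realization.v_three_mul_add_two]
    rcases Nat.eq_zero_or_pos i with rfl | hi
    · rw [pow_zero, one_mul]
      exact .inl <| .inl <| .inl <| .inl <| .inl <| .inl <| .inl <| .inr <| .inr <| .inl rfl
    · exact .inl <| .inl <| .inl <| .inr ⟨i, ⟨hi, by lia⟩, rfl⟩

theorem std_y_mem_BB {n : ℕ} (hn : n ≤ t) : (std F k t c).y n ∈ BB F k t c := by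
  rcases Nat.eq_zero_or_pos n with rfl | hi
  · exact .inr <| .inl <| .inl rfl
  · refine .inr <| .inr ⟨n, ⟨hi, hn⟩, ?_⟩
    rw [Realization.y_eq]
    obtain ⟨j, rfl⟩ := Nat.exists_eq_add_of_le' hi
    simp only [pow_succ', ← mul_assoc, Realization.hL]
    rfl

theorem std_w_mem_BB (hk : 1 ≤ k) (ht : 3 ≤ t) {n : ℕ} (hn : n ≤ 3 * k) :
    (std F k t c).w n ∈ BB F k t c := by
  obtain ⟨i, rfl | rfl | rfl⟩ : ∃ i, n = 3 * i ∨ n = 3 * i + 1 ∨ n = 3 * i + 2 :=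
    ⟨n / 3, by lia⟩
  · rcases Nat.eq_zero_or_pos i with rfl | hi
    · exact std_y_mem_BB (n := 0) (Nat.zero_le _)
    rcases (show i ≤ k by lia).eq_or_lt with rfl | hik
    · rw [Realization.w_top _ hk ht]
      exact std_y_mem_BB le_rfl
    · rw [Realization.w_three_mul]
      refine .inr <| .inl <| .inr ⟨i, ⟨hi, by lia⟩, ?_⟩
      obtain ⟨j, rfl⟩ := Nat.exists_eq_add_of_le' hi
      simp only [pow_succ', ← mul_assoc, Realization.gL]
      rfl
  · rw [Realization.w_three_mul_add_one]
    rcases Nat.eq_zero_or_pos i with rfl | hi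
    · rw [pow_zero, one_mul]
      exact .inl <| .inl <| .inr <| .inl <| .inl <| .inl rfl
    · exact .inl <| .inl <| .inr <| .inl <| .inr ⟨i, ⟨hi, by lia⟩, rfl⟩
  · rw [Realization.w_three_mul_add_two]
    rcases Nat.eq_zero_or_pos i with rfl | hi
    · rw [pow_zero, one_mul]
      exact .inl <| .inl <| .inr <| .inl <| .inl <| .inr rfl
    · exact .inl <| .inl <| .inr <| .inr ⟨i, ⟨hi, by lia⟩, rfl⟩

theorem std_u_top_mem_socle (hk : 1 ≤ k) (ht : 3 ≤ t) :
    (std F k t c).u (3 * k) ∈ socle (BA F k t c) := by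
  refine mem_socle_of_eigenvector (exists_mul_eq_smul ⟨1, ?_⟩ ?_ ?_ ?_ ?_)
  · rw [Realization.e1_u, if_neg (by lia), one_smul]
  · rw [Realization.a_u _ hk ht, if_pos (by lia), Realization.u_eq_zero _ hk ht (by lia)]
  · rw [Realization.b_u, if_neg (by lia)]
  · rw [Realization.g_u _ ht, if_neg (by lia), if_neg (by lia)]
  · rw [Realization.h_u _ hk ht]

theorem std_y_top_mem_socle (hk : 1 ≤ k) (ht : 3 ≤ t) :
    (std F k t c).y t ∈ socle (BA F k t c) := by
  refine mem_socle_of_eigenvector (exists_mul_eq_smul ⟨0, ?_⟩ ?_ ?_ ?_ ?_)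
  · rw [Realization.e1_y, zero_smul]
  · rw [Realization.a_y]
  · rw [Realization.b_y _ hk, if_neg (by lia), if_neg (by lia)]
  · rw [Realization.g_y]
  · rw [Realization.h_y, Realization.y_eq_zero _ ht (by lia)]

/-- A proper suffix of a nonzero path with letters in the radical does not lie in the socle. -/
theorem notMem_socle_of_seq {R : Type} [Ring R] {s l : ℕ → R} (hs : ∀ n, s (n + 1) = l n * s n)
    (hl : ∀ n r, IsNilpotent (r * l n)) {m n : ℕ} (hmn : m < n) (hn : s n ≠ 0) :
    s m ∉ socle R := by
  intro hm
  have h0 : s (m + 1) = 0 := by rw [hs, mul_eq_zero_of_mem_socle (hl m) hm]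
  obtain ⟨d, rfl⟩ := Nat.exists_eq_add_of_lt hmn
  refine hn ?_
  clear hmn hn
  induction d with
  | zero => exact h0
  | succ d ih => rw [show m + (d + 1) + 1 = m + d + 1 + 1 by lia, hs, ih, mul_zero]

theorem isNilpotent_mul_a (hk : 1 ≤ k) (ht : 3 ≤ t) (r : BA F k t c) :
    IsNilpotent (r * (std F k t c).a) := isNilpotent_mul hk ht (Realization.a_mul_mem _ hk ht) r

theorem isNilpotent_mul_b (hk : 1 ≤ k) (ht : 3 ≤ t) (r : BA F k t c) :
    IsNilpotent (r * (std F k t c).b) := isNilpotent_mul hk ht (Realization.b_mul_mem _ hk) r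

theorem isNilpotent_mul_g (hk : 1 ≤ k) (ht : 3 ≤ t) (r : BA F k t c) :
    IsNilpotent (r * (std F k t c).g) := isNilpotent_mul hk ht (Realization.g_mul_mem _ ht) r

theorem isNilpotent_mul_h (hk : 1 ≤ k) (ht : 3 ≤ t) (r : BA F k t c) :
    IsNilpotent (r * (std F k t c).h) := isNilpotent_mul hk ht (Realization.h_mul_mem _ hk ht) r

variable {ψ : BA F k t c →ₗ[F] F} (hψ : SoclePsi F k t c ψ)
include hψ

theorem SoclePsi.apply_u_top (hk : 1 ≤ k) (ht : 3 ≤ t) : ψ ((std F k t c).u (3 * k)) = 1 :=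
  (hψ _ (std_u_mem_BB hk le_rfl)).1 (std_u_top_mem_socle hk ht)

theorem SoclePsi.apply_y_top (hk : 1 ≤ k) (ht : 3 ≤ t) : ψ ((std F k t c).y t) = 1 :=
  (hψ _ (std_y_mem_BB le_rfl)).1 (std_y_top_mem_socle hk ht)

theorem SoclePsi.apply_u (hk : 1 ≤ k) (ht : 3 ≤ t) (n : ℕ) :
    ψ ((std F k t c).u n) = if n = 3 * k then 1 else 0 := by
  have htop := hψ.apply_u_top hk ht
  rcases lt_trichotomy n (3 * k) with h | rfl | h
  · rw [if_neg h.ne]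
    refine (hψ _ (std_u_mem_BB hk h.le)).2 (notMem_socle_of_seq (Realization.u_succ _)
      (fun n r => ?_) h fun h0 => by simp [h0] at htop)
    rw [Realization.lu]
    split_ifs
    exacts [isNilpotent_mul_a hk ht r, isNilpotent_mul_g hk ht r, isNilpotent_mul_b hk ht r]
  · rw [if_pos rfl, htop]
  · rw [if_neg h.ne', Realization.u_eq_zero _ hk ht h, map_zero]

theorem SoclePsi.apply_v (hk : 1 ≤ k) (ht : 3 ≤ t) (n : ℕ) :
    ψ ((std F k t c).v n) = if n = 3 * k then 1 else 0 := by
  have htop := hψ.apply_u_top hk ht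
  rw [← Realization.v_top _ hk] at htop
  rcases lt_trichotomy n (3 * k) with h | rfl | h
  · rw [if_neg h.ne]
    refine (hψ _ (std_v_mem_BB hk h.le)).2 (notMem_socle_of_seq (Realization.v_succ _)
      (fun n r => ?_) h fun h0 => by simp [h0] at htop)
    rw [Realization.lv]
    split_ifs
    exacts [isNilpotent_mul_g hk ht r, isNilpotent_mul_b hk ht r, isNilpotent_mul_a hk ht r]
  · rw [if_pos rfl, htop]
  · rw [if_neg h.ne', Realization.v_eq_zero _ hk ht h, map_zero]

theorem SoclePsi.apply_w (hk : 1 ≤ k) (ht : 3 ≤ t) (n : ℕ) :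
    ψ ((std F k t c).w n) = if n = 3 * k then 1 else 0 := by
  have htop := hψ.apply_y_top hk ht
  rw [← Realization.w_top _ hk ht] at htop
  rcases lt_trichotomy n (3 * k) with h | rfl | h
  · rw [if_neg h.ne]
    refine (hψ _ (std_w_mem_BB hk ht h.le)).2 (notMem_socle_of_seq (Realization.w_succ _)
      (fun n r => ?_) h fun h0 => by simp [h0] at htop)
    rw [Realization.lw]
    split_ifs
    exacts [isNilpotent_mul_b hk ht r, isNilpotent_mul_a hk ht r, isNilpotent_mul_g hk ht r]
  · rw [if_pos rfl, htop]
  · rw [if_neg h.ne', Realization.w_eq_zero _ hk ht h, map_zero]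

theorem SoclePsi.apply_y (hk : 1 ≤ k) (ht : 3 ≤ t) (n : ℕ) :
    ψ ((std F k t c).y n) = if n = t then 1 else 0 := by
  have htop := hψ.apply_y_top hk ht
  rcases lt_trichotomy n t with h | rfl | h
  · rw [if_neg h.ne]
    exact (hψ _ (std_y_mem_BB h.le)).2 (notMem_socle_of_seq (Realization.y_succ _)
      (fun n r => isNilpotent_mul_h hk ht r) h fun h0 => by simp [h0] at htop)
  · rw [if_pos rfl, htop]
  · rw [if_neg h.ne', Realization.y_eq_zero _ ht h, map_zero]

/-- The form `⟨x, y⟩ = ψ (x * y)` is symmetric. -/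
theorem SoclePsi.mul_comm (hk : 1 ≤ k) (ht : 3 ≤ t) (x z : BA F k t c) :
    ψ (x * z) = ψ (z * x) := by
  let S : Subalgebra F (BA F k t c) :=
    { carrier := {x | ∀ z, ψ (x * z) = ψ (z * x)}
      mul_mem' := fun {x y} hx hy z => by rw [mul_assoc, hx, mul_assoc, hy, mul_assoc]
      add_mem' := fun {x y} hx hy z => by rw [add_mul, mul_add, map_add, map_add, hx, hy]
      algebraMap_mem' := fun r z => by rw [Algebra.commutes] }
  have key (x : BA F k t c)
      (hu : ∀ n, ψ (x * (std F k t c).u n) = ψ ((std F k t c).u n * x))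
      (hv : ∀ n, ψ (x * (std F k t c).v n) = ψ ((std F k t c).v n * x))
      (hw : ∀ n, ψ (x * (std F k t c).w n) = ψ ((std F k t c).w n * x))
      (hy : ∀ n, ψ (x * (std F k t c).y n) = ψ ((std F k t c).y n * x)) : x ∈ S := by
    have htop := eq_top_of_paths hk ht
      (M := LinearMap.eqLocus (ψ ∘ₗ LinearMap.mulLeft F x) (ψ ∘ₗ LinearMap.mulRight F x))
      hu hv hw hy
    intro z
    have hz : z ∈ LinearMap.eqLocus (ψ ∘ₗ LinearMap.mulLeft F x) (ψ ∘ₗ LinearMap.mulRight F x) :=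
      htop ▸ Submodule.mem_top
    exact hz
  have h1 : (std F k t c).e1 ∈ S := by
    refine key _ ?_ ?_ ?_ ?_ <;> intro n
    · rw [Realization.e1_u, Realization.u_e1, apply_ite ψ, map_zero, hψ.apply_u hk ht]
      split_ifs <;> lia
    · rw [Realization.e1_v, Realization.v_e1, apply_ite ψ, map_zero, hψ.apply_v hk ht]
      split_ifs <;> lia
    · rw [Realization.e1_w, Realization.w_e1, apply_ite ψ, map_zero, hψ.apply_w hk ht]
      split_ifs <;> lia
    · rw [Realization.e1_y, Realization.y_e1]
  have hS : S = ⊤ := by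
    refine subalgebra_eq_top h1 ?_ ?_ ?_ ?_ ?_
    · rw [Realization.e2_eq]
      exact sub_mem (one_mem _) h1
    all_goals refine key _ ?_ ?_ ?_ ?_ <;> intro n
    · simp only [Realization.a_u _ hk ht, Realization.u_a _ hk ht, apply_ite ψ, map_zero, map_smul,
        hψ.apply_u hk ht]
      split_ifs <;> lia
    · simp only [Realization.a_v _ hk ht, Realization.v_a, apply_ite ψ, map_zero,
        hψ.apply_u hk ht, hψ.apply_v hk ht]
      split_ifs <;> lia
    · simp only [Realization.a_w _ hk ht, Realization.w_a, apply_ite ψ, map_zero,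
        hψ.apply_w hk ht]
      split_ifs <;> lia
    · rw [Realization.a_y, Realization.y_a]
    · simp only [Realization.b_u, Realization.u_b, apply_ite ψ, map_zero,
        hψ.apply_u hk ht, hψ.apply_w hk ht]
      split_ifs <;> lia
    · simp only [Realization.b_v, Realization.v_b _ ht, apply_ite ψ, map_zero,
        hψ.apply_v hk ht, hψ.apply_w hk ht, hψ.apply_y hk ht]
      split_ifs <;> lia
    · simp only [Realization.b_w, Realization.w_b, apply_ite ψ, map_zero,
        hψ.apply_w hk ht]
      split_ifs <;> lia
    · simp only [Realization.b_y _ hk, Realization.y_b, apply_ite ψ, map_zero,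
        hψ.apply_w hk ht]
      split_ifs <;> lia
    · simp only [Realization.g_u _ ht, Realization.u_g, apply_ite ψ, map_zero,
        hψ.apply_u hk ht, hψ.apply_v hk ht]
      split_ifs <;> lia
    · simp only [Realization.g_v _ ht, Realization.v_g, apply_ite ψ, map_zero,
        hψ.apply_v hk ht]
      split_ifs <;> lia
    · simp only [Realization.g_w _ ht, Realization.w_g, apply_ite ψ, map_zero,
        hψ.apply_w hk ht, hψ.apply_v hk ht, hψ.apply_y hk ht]
      split_ifs <;> lia
    · simp only [Realization.g_y, Realization.y_g _ hk, apply_ite ψ, map_zero,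
        hψ.apply_u hk ht, hψ.apply_v hk ht]
      split_ifs <;> lia
    · rw [Realization.h_u _ hk ht, Realization.u_h]
    · simp only [Realization.h_v _ hk ht, Realization.v_h, apply_ite ψ, map_zero,
        hψ.apply_u hk ht]
      split_ifs <;> lia
    · simp only [Realization.h_w _ hk ht, Realization.w_h _ hk ht, apply_ite ψ, map_zero,
        hψ.apply_w hk ht, hψ.apply_y hk ht]
      split_ifs <;> lia
    · rw [Realization.h_y, Realization.y_h]
  have hx : x ∈ S := hS ▸ Algebra.mem_top
  exact hx z

theorem SoclePsi.exists_dual_u (hk : 1 ≤ k) (ht : 3 ≤ t) {m : ℕ} (hm : m ≤ 3 * k) :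
    ∃ q, (∀ n, ψ (q * (std F k t c).u n) = if n = m then 1 else 0) ∧
      ∀ n, 1 ≤ n → n < 3 * k → ψ (q * (std F k t c).v n) = 0 := by
  induction hm using Nat.decreasingInduction with
  | self =>
    refine ⟨1, fun n => ?_, fun n _ hn => ?_⟩
    · rw [one_mul, hψ.apply_u hk ht]
    · rw [one_mul, hψ.apply_v hk ht, if_neg hn.ne]
  | of_succ m hm ih =>
    obtain ⟨q, hu, hv⟩ := ih
    have hq := hu (3 * k)
    rw [← Realization.v_top _ hk] at hq
    refine ⟨q * (std F k t c).lu m, fun n => ?_, fun n h1 hn => ?_⟩ <;>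
      rw [mul_assoc, Realization.lu]
    · split_ifs <;>
        simp only [Realization.a_u _ hk ht, Realization.g_u _ ht, Realization.b_u] <;>
        split_ifs <;> (try simp only [mul_zero, map_zero, mul_smul_comm, map_smul, hu]) <;>
        first
          | lia
          | (rw [hv 1 le_rfl (by lia)])
          | (rw [if_neg (by lia), smul_zero])
    · rcases eq_or_ne (n + 1) (3 * k) with h | h
      · split_ifs <;>
          simp only [Realization.a_v _ hk ht, Realization.g_v _ ht, Realization.b_v] <;>
          split_ifs <;> (try simp only [mul_zero, map_zero]) <;> lia
      · split_ifs <;>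
          simp only [Realization.a_v _ hk ht, Realization.g_v _ ht, Realization.b_v] <;>
          split_ifs <;> (try simp only [mul_zero, map_zero]) <;>
          first
            | lia
            | exact hv _ (by lia) (by lia)

theorem SoclePsi.exists_dual_v (hk : 1 ≤ k) (ht : 3 ≤ t) {m : ℕ} (hm : m ≤ 3 * k) :
    ∃ q, ∀ n, 1 ≤ n → ψ (q * (std F k t c).v n) = if n = m then 1 else 0 := by
  induction hm using Nat.decreasingInduction with
  | self => exact ⟨1, fun n _ => by rw [one_mul, hψ.apply_v hk ht]⟩
  | of_succ m hm ih =>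
    obtain ⟨q, hv⟩ := ih
    refine ⟨q * (std F k t c).lv m, fun n h1 => ?_⟩
    rw [mul_assoc, Realization.lv]
    split_ifs <;>
      simp only [Realization.a_v _ hk ht, Realization.g_v _ ht, Realization.b_v] <;>
      split_ifs <;> (try simp only [mul_zero, map_zero]) <;>
      first
        | lia
        | (rw [hv _ (by lia)]; lia)

theorem SoclePsi.exists_dual_w (hk : 1 ≤ k) (ht : 3 ≤ t) {m : ℕ} (hm : m ≤ 3 * k) :
    ∃ q, (∀ n, ψ (q * (std F k t c).w n) = if n = m then 1 else 0) ∧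
      ∀ n, 1 ≤ n → n < t → ψ (q * (std F k t c).y n) = 0 := by
  induction hm using Nat.decreasingInduction with
  | self =>
    refine ⟨1, fun n => ?_, fun n _ hn => ?_⟩
    · rw [one_mul, hψ.apply_w hk ht]
    · rw [one_mul, hψ.apply_y hk ht, if_neg hn.ne]
  | of_succ m hm ih =>
    obtain ⟨q, hw, hy⟩ := ih
    refine ⟨q * (std F k t c).lw m, fun n => ?_, fun n h1 hn => ?_⟩ <;>
      rw [mul_assoc, Realization.lw]
    · split_ifs <;>
        simp only [Realization.a_w _ hk ht, Realization.g_w _ ht, Realization.b_w] <;>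
        split_ifs <;> (try simp only [mul_zero, map_zero, hw]) <;>
        first
          | lia
          | exact hy _ (by lia) (by lia)
    · split_ifs <;>
        simp only [Realization.a_y, Realization.g_y, Realization.b_y _ hk] <;>
        (try split_ifs) <;> simp only [mul_zero, map_zero, hw] <;> lia

theorem SoclePsi.exists_dual_y (hk : 1 ≤ k) (ht : 3 ≤ t) {m : ℕ} (hm : m ≤ t) :
    ∃ q, ∀ n, ψ (q * (std F k t c).y n) = if n = m then 1 else 0 := by
  induction hm using Nat.decreasingInduction with
  | self => exact ⟨1, fun n => by rw [one_mul, hψ.apply_y hk ht]⟩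
  | of_succ m hm ih =>
    obtain ⟨q, hy⟩ := ih
    refine ⟨q * (std F k t c).h, fun n => ?_⟩
    rw [mul_assoc, Realization.h_y, hy]
    lia

omit hψ in
theorem exists_eq_sum_paths (hk : 1 ≤ k) (ht : 3 ≤ t) (x : BA F k t c) :
    ∃ p q r s : ℕ → F, x = (∑ n ∈ Finset.range (3 * k + 1), p n • (std F k t c).u n) +
      (∑ n ∈ Finset.Ico 1 (3 * k), q n • (std F k t c).v n) +
      (∑ n ∈ Finset.range (3 * k + 1), r n • (std F k t c).w n) +
      (∑ n ∈ Finset.Ico 1 t, s n • (std F k t c).y n) := by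
  let U := Submodule.span F ((std F k t c).u '' (Finset.range (3 * k + 1)))
  let V := Submodule.span F ((std F k t c).v '' (Finset.Ico 1 (3 * k)))
  let W := Submodule.span F ((std F k t c).w '' (Finset.range (3 * k + 1)))
  let Y := Submodule.span F ((std F k t c).y '' (Finset.Ico 1 t))
  have hu (n : ℕ) : (std F k t c).u n ∈ U := by
    rcases le_or_gt n (3 * k) with h | h
    · exact Submodule.subset_span ⟨n, by simp; lia, rfl⟩
    · rw [Realization.u_eq_zero _ hk ht h]
      exact zero_mem _
  have hw (n : ℕ) : (std F k t c).w n ∈ W := by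
    rcases le_or_gt n (3 * k) with h | h
    · exact Submodule.subset_span ⟨n, by simp; lia, rfl⟩
    · rw [Realization.w_eq_zero _ hk ht h]
      exact zero_mem _
  have hv (n : ℕ) : (std F k t c).v n ∈ U ⊔ V := by
    rcases Nat.eq_zero_or_pos n with rfl | h0
    · exact Submodule.mem_sup_left (hu 0)
    rcases lt_trichotomy n (3 * k) with h | rfl | h
    · exact Submodule.mem_sup_right (Submodule.subset_span ⟨n, by simp; lia, rfl⟩)
    · rw [Realization.v_top _ hk]
      exact Submodule.mem_sup_left (hu _)
    · rw [Realization.v_eq_zero _ hk ht h]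
      exact zero_mem _
  have hy (n : ℕ) : (std F k t c).y n ∈ W ⊔ Y := by
    rcases Nat.eq_zero_or_pos n with rfl | h0
    · exact Submodule.mem_sup_left (hw 0)
    rcases lt_trichotomy n t with h | rfl | h
    · exact Submodule.mem_sup_right (Submodule.subset_span ⟨n, by simp; lia, rfl⟩)
    · rw [← Realization.w_top _ hk ht]
      exact Submodule.mem_sup_left (hw _)
    · rw [Realization.y_eq_zero _ ht h]
      exact zero_mem _
  have htop : (U ⊔ V) ⊔ (W ⊔ Y) = ⊤ := eq_top_of_paths hk ht
    (fun n => Submodule.mem_sup_left (Submodule.mem_sup_left (hu n)))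
    (fun n => Submodule.mem_sup_left (hv n))
    (fun n => Submodule.mem_sup_right (Submodule.mem_sup_left (hw n)))
    (fun n => Submodule.mem_sup_right (hy n))
  have hx : x ∈ (U ⊔ V) ⊔ (W ⊔ Y) := htop ▸ Submodule.mem_top
  obtain ⟨_, hl, _, hr, rfl⟩ := Submodule.mem_sup.1 hx
  obtain ⟨_, h1, _, h2, rfl⟩ := Submodule.mem_sup.1 hl
  obtain ⟨_, h3, _, h4, rfl⟩ := Submodule.mem_sup.1 hr
  obtain ⟨p, rfl⟩ := (Submodule.mem_span_image_finset_iff_exists_fun' F).1 h1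
  obtain ⟨q, rfl⟩ := (Submodule.mem_span_image_finset_iff_exists_fun' F).1 h2
  obtain ⟨r, rfl⟩ := (Submodule.mem_span_image_finset_iff_exists_fun' F).1 h3
  obtain ⟨s, rfl⟩ := (Submodule.mem_span_image_finset_iff_exists_fun' F).1 h4
  exact ⟨p, q, r, s, (add_assoc _ _ _).symm⟩

omit hψ in
/-- Coefficients are recovered from a dual family of multipliers. -/
theorem coeff_eq_zero {s : ℕ → BA F k t c} {I : Finset ℕ} {p : ℕ → F} {m : ℕ} (hm : m ∈ I)
    {q : BA F k t c} (hq : ∀ n ∈ I, ψ (q * s n) = if n = m then 1 else 0)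
    (h : ψ (q * ∑ n ∈ I, p n • s n) = 0) : p m = 0 := by
  rw [Finset.mul_sum, map_sum, Finset.sum_congr rfl fun n hn => by
    rw [mul_smul_comm, map_smul, hq n hn, smul_eq_mul, mul_ite, mul_one, mul_zero],
    Finset.sum_ite_eq' I m p, if_pos hm] at h
  exact h

omit hψ in
theorem apply_mul_sum_eq_zero {s : ℕ → BA F k t c} {I : Finset ℕ} (p : ℕ → F) {q : BA F k t c}
    (hq : ∀ n ∈ I, ψ (q * s n) = 0) : ψ (q * ∑ n ∈ I, p n • s n) = 0 := by
  rw [Finset.mul_sum, map_sum]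
  refine Finset.sum_eq_zero fun n hn => ?_
  rw [mul_smul_comm, map_smul, hq n hn, smul_zero]

/-- The form `⟨x, y⟩ = ψ (x * y)` is nondegenerate. -/
theorem SoclePsi.eq_zero (hk : 1 ≤ k) (ht : 3 ≤ t) {x : BA F k t c}
    (hx : ∀ z, ψ (z * x) = 0) : x = 0 := by
  obtain ⟨p, q, r, s, h⟩ := exists_eq_sum_paths hk ht x
  set X := ∑ n ∈ Finset.range (3 * k + 1), p n • (std F k t c).u n with hX
  set Y := ∑ n ∈ Finset.Ico 1 (3 * k), q n • (std F k t c).v n with hY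
  set Z := ∑ n ∈ Finset.range (3 * k + 1), r n • (std F k t c).w n with hZ
  set T := ∑ n ∈ Finset.Ico 1 t, s n • (std F k t c).y n with hT
  have h1 : x * (std F k t c).e1 = X + Y := by
    simp only [h, hX, hY, hZ, hT, add_mul, Finset.sum_mul, smul_mul_assoc, Realization.u_e1,
      Realization.v_e1, Realization.w_e1, Realization.y_e1, smul_zero, Finset.sum_const_zero,
      add_zero]
  have hl (z : BA F k t c) : ψ (z * X) + ψ (z * Y) = 0 := by
    rw [← map_add, ← mul_add, ← h1, ← mul_assoc, hψ.mul_comm hk ht, ← mul_assoc, hx]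
  have hr (z : BA F k t c) : ψ (z * Z) + ψ (z * T) = 0 := by
    have := hx z
    rwa [h, add_assoc, mul_add, map_add, mul_add, map_add, hl, zero_add, mul_add, map_add] at this
  have hX0 : X = 0 := Finset.sum_eq_zero fun m hm => by
    obtain ⟨d, hu, hv⟩ := hψ.exists_dual_u hk ht (Finset.mem_range_succ_iff.1 hm)
    rw [coeff_eq_zero (p := p) hm (fun n _ => hu n), zero_smul]
    have := hl d
    rwa [hY, apply_mul_sum_eq_zero q (fun n hn => hv n (Finset.mem_Ico.1 hn).1
      (Finset.mem_Ico.1 hn).2), add_zero] at this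
  have hZ0 : Z = 0 := Finset.sum_eq_zero fun m hm => by
    obtain ⟨d, hu, hv⟩ := hψ.exists_dual_w hk ht (Finset.mem_range_succ_iff.1 hm)
    rw [coeff_eq_zero (p := r) hm (fun n _ => hu n), zero_smul]
    have := hr d
    rwa [hT, apply_mul_sum_eq_zero s (fun n hn => hv n (Finset.mem_Ico.1 hn).1
      (Finset.mem_Ico.1 hn).2), add_zero] at this
  have hY0 : Y = 0 := Finset.sum_eq_zero fun m hm => by
    obtain ⟨d, hv⟩ := hψ.exists_dual_v hk ht (Finset.mem_Ico.1 hm).2.le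
    rw [coeff_eq_zero (p := q) hm (fun n hn => hv n (Finset.mem_Ico.1 hn).1), zero_smul]
    simpa [hX0] using hl d
  have hT0 : T = 0 := Finset.sum_eq_zero fun m hm => by
    obtain ⟨d, hv⟩ := hψ.exists_dual_y hk ht (Finset.mem_Ico.1 hm).2.le
    rw [coeff_eq_zero (p := s) hm (fun n _ => hv n), zero_smul]
    simpa [hZ0] using hr d
  rw [h, hX0, hY0, hZ0, hT0]
  simp

end SocleForm

section CommutatorSubspace

theorem add_self_eq_zero_of_charTwo (F : Type) [Field F] [CharP F 2] {A : Type} [Ring A]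
    [Algebra F A] (x : A) : x + x = 0 := by
  rw [← two_smul F, CharTwo.two_eq_zero, zero_smul]

variable {F : Type} [Field F] {A : Type} [Ring A] [Algebra F A]

theorem commutator_mem_Kspan (x y : A) : x * y - y * x ∈ Kspan F A :=
  Submodule.subset_span ⟨x, y, rfl⟩

theorem Kspan_le_comap_mul_left {z : A} (hz : ∀ x, z * x = x * z) :
    Kspan F A ≤ (Kspan F A).comap (LinearMap.mulLeft F z) := by
  refine Submodule.span_le.2 ?_
  rintro _ ⟨x, y, rfl⟩
  have h := commutator_mem_Kspan (F := F) (z * x) y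
  rwa [mul_assoc, ← mul_assoc y, ← hz y, mul_assoc, ← mul_sub] at h

theorem map_eq_zero_of_mem_Kspan {ψ : A →ₗ[F] F} (hψ : ∀ x y, ψ (x * y) = ψ (y * x)) {x : A}
    (hx : x ∈ Kspan F A) : ψ x = 0 := by
  have h : Kspan F A ≤ LinearMap.ker ψ := by
    refine Submodule.span_le.2 ?_
    rintro _ ⟨x, y, rfl⟩
    rw [SetLike.mem_coe, LinearMap.mem_ker, map_sub, hψ, sub_self]
  exact h hx

variable [CharP F 2]

theorem add_sq_sub_mem_Kspan (x y : A) : (x + y) ^ 2 - (x ^ 2 + y ^ 2) ∈ Kspan F A := by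
  have h : (x + y) ^ 2 - (x ^ 2 + y ^ 2) = x * y - y * x + (y * x + y * x) := by noncomm_ring
  rw [h, add_self_eq_zero_of_charTwo F, add_zero]
  exact commutator_mem_Kspan x y

theorem commutator_sq_mem_Kspan (x y : A) : (x * y - y * x) ^ 2 ∈ Kspan F A := by
  have h : (x * y - y * x) ^ 2 =
      (x * (y * x * y) - y * x * y * x) - (x * (y * y * x) - y * y * x * x) -
        (y * (x * x * y) - x * x * y * y) - (y * y * (x * x) - x * x * (y * y)) +
        (y * x * y * x + y * x * y * x) - (x * x * y * y + x * x * y * y) := by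
    noncomm_ring
  rw [h, add_self_eq_zero_of_charTwo F (y * x * y * x), add_zero,
    add_self_eq_zero_of_charTwo F (x * x * y * y), sub_zero]
  exact sub_mem (sub_mem (sub_mem (commutator_mem_Kspan _ _) (commutator_mem_Kspan _ _))
    (commutator_mem_Kspan _ _)) (commutator_mem_Kspan _ _)

variable (F A) in
/-- The subspace `T₁(A)` of a finite-dimensional algebra in characteristic 2. -/
def T1space : Submodule F A where
  carrier := {x | x ^ 2 ∈ Kspan F A}
  zero_mem' := by simp
  add_mem' {x y} hx hy := by
    have h := add_mem (add_sq_sub_mem_Kspan (F := F) x y) (add_mem hx hy)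
    rwa [sub_add_cancel] at h
  smul_mem' r x hx := by
    change (r • x) ^ 2 ∈ Kspan F A
    rw [smul_pow]
    exact Submodule.smul_mem _ _ hx

theorem mem_T1space {x : A} : x ∈ T1space F A ↔ x ^ 2 ∈ Kspan F A := Iff.rfl

theorem Kspan_le_T1space : Kspan F A ≤ T1space F A := by
  refine Submodule.span_le.2 ?_
  rintro _ ⟨x, y, rfl⟩
  exact commutator_sq_mem_Kspan x y

theorem span_T1set (k t : ℕ) (c : F) :
    Submodule.span F (T1set F k t c) = T1space F (BA F k t c) :=
  Submodule.span_eq (T1space F (BA F k t c))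

end CommutatorSubspace

section Reynolds

variable {F : Type} [Field F] {k t : ℕ} {c : F} {ψ : BA F k t c →ₗ[F] F}
  (hψ : SoclePsi F k t c ψ)
include hψ

theorem SoclePsi.nondegenerate (hk : 1 ≤ k) (ht : 3 ≤ t) :
    LinearMap.BilinForm.Nondegenerate ((LinearMap.mul F (BA F k t c)).compr₂ ψ) := by
  refine ⟨fun x hx => hψ.eq_zero hk ht fun z => ?_, fun x hx => hψ.eq_zero hk ht hx⟩
  rw [hψ.mul_comm hk ht]
  exact hx z

variable [CharP F 2]

theorem SoclePsi.mem_T1perp_iff (hk : 1 ≤ k) (ht : 3 ≤ t) {x : BA F k t c} :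
    x ∈ T1perp F k t c ψ ↔
      x ∈ LinearMap.BilinForm.orthogonal ((LinearMap.mul F (BA F k t c)).compr₂ ψ)
        (T1space F (BA F k t c)) := by
  refine forall₂_congr fun z _ => ?_
  rw [hψ.mul_comm hk ht]
  rfl

theorem SoclePsi.mem_center (hk : 1 ≤ k) (ht : 3 ≤ t) {x : BA F k t c}
    (hx : x ∈ T1perp F k t c ψ) : x ∈ Subalgebra.center F (BA F k t c) := by
  rw [Subalgebra.mem_center_iff]
  intro r
  refine sub_eq_zero.1 (hψ.eq_zero hk ht fun z => ?_)
  have h := hx _ (Kspan_le_T1space (commutator_mem_Kspan z r))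
  rwa [mul_sub, map_sub, ← mul_assoc z r x, hψ.mul_comm hk ht (z * r), hψ.mul_comm hk ht z,
    mul_assoc x, ← map_sub, ← mul_sub]

omit hψ [CharP F 2] in
theorem mem_ReynoldsIdeal_iff {z : Subalgebra.center F (BA F k t c)} :
    z ∈ ReynoldsIdeal F k t c ψ ↔ (z : BA F k t c) ∈ T1perp F k t c ψ := by
  let I : Ideal (Subalgebra.center F (BA F k t c)) :=
    { carrier := {z | (z : BA F k t c) ∈ T1perp F k t c ψ}
      zero_mem' := fun x _ => by rw [ZeroMemClass.coe_zero, zero_mul, map_zero]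
      add_mem' := fun {y z} hy hz x hx => by
        have hy := hy x hx
        have hz := hz x hx
        rw [AddMemClass.coe_add, add_mul, map_add, hy, hz, add_zero]
      smul_mem' := fun z y hy x hx => by
        have hz (x : BA F k t c) : (z : BA F k t c) * x = x * z :=
          (Subalgebra.mem_center_iff.1 z.2 x).symm
        have hzx : (z : BA F k t c) * x ∈ T1set F k t c := by
          change ((z : BA F k t c) * x) ^ 2 ∈ Kspan F (BA F k t c)
          rw [(show Commute (z : BA F k t c) x from hz x).mul_pow, pow_two (z : BA F k t c),
            mul_assoc]
          exact Kspan_le_comap_mul_left hz (Kspan_le_comap_mul_left hz hx)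
        have h := hy _ hzx
        rwa [← mul_assoc, ← hz y] at h }
  have h : ReynoldsIdeal F k t c ψ = I := Ideal.span_eq I
  rw [h]
  rfl

theorem SoclePsi.finrank_ReynoldsIdeal (hk : 1 ≤ k) (ht : 3 ≤ t) :
    Module.finrank F ((ReynoldsIdeal F k t c ψ).restrictScalars F) =
      Module.finrank F (BA F k t c) - Module.finrank F (T1space F (BA F k t c)) := by
  have := finite_BA (F := F) (c := c) hk ht
  rw [← LinearMap.BilinForm.finrank_orthogonal (hψ.nondegenerate hk ht)]
  refine (LinearEquiv.finrank_eq (Submodule.equivMapOfInjective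
    (Subalgebra.center F (BA F k t c)).val.toLinearMap Subtype.val_injective _)).trans
    (congrArg (fun M : Submodule F (BA F k t c) => Module.finrank F M) ?_)
  ext x
  rw [← hψ.mem_T1perp_iff hk ht]
  constructor
  · rintro ⟨z, hz, rfl⟩
    exact mem_ReynoldsIdeal_iff.1 hz
  · exact fun hx => ⟨⟨x, hψ.mem_center hk ht hx⟩, mem_ReynoldsIdeal_iff.2 hx, rfl⟩

end Reynolds

/-- Data for deforming an algebra along a derivation-like functional `lam` and a socle element
`s`. -/
structure TwistData (F : Type) [Field F] (A : Type) [Ring A] [Algebra F A] where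
  eps : A →ₐ[F] F
  lam : A →ₗ[F] F
  s : A
  δ : F
  lam_mul : ∀ x y, lam (x * y) = eps x * lam y + lam x * eps y
  mul_s : ∀ x, x * s = eps x • s
  s_mul : ∀ x, s * x = eps x • s
  lam_s : lam s = 0

namespace TwistData

variable {F : Type} [Field F] {A : Type} [Ring A] [Algebra F A] (D : TwistData F A)

theorem lam_one : D.lam 1 = 0 := by
  have h := D.lam_mul 1 1
  rwa [mul_one, map_one D.eps, one_mul, mul_one, left_eq_add] at h

/-- The vector space `A` with product `x * y + (δ * lam x * lam y) • s`. -/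
def Twist (_ : TwistData F A) : Type := A

instance : AddCommGroup D.Twist := inferInstanceAs (AddCommGroup A)

instance : Module F D.Twist := inferInstanceAs (Module F A)

/-- The identity map from `A` to its deformation. -/
def of : A ≃ₗ[F] D.Twist := LinearEquiv.refl F A

instance : Mul D.Twist :=
  ⟨fun x y => D.of (D.of.symm x * D.of.symm y +
    (D.δ * D.lam (D.of.symm x) * D.lam (D.of.symm y)) • D.s)⟩

instance : One D.Twist := ⟨D.of 1⟩

theorem of_mul_of (x y : A) :
    D.of x * D.of y = D.of (x * y + (D.δ * D.lam x * D.lam y) • D.s) := rfl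

theorem of_one : D.of 1 = 1 := rfl

instance : Ring D.Twist :=
  { (inferInstance : AddCommGroup D.Twist), (inferInstance : Mul D.Twist),
    (inferInstance : One D.Twist) with
    left_distrib := fun x y z => by
      obtain ⟨x, rfl⟩ := D.of.surjective x
      obtain ⟨y, rfl⟩ := D.of.surjective y
      obtain ⟨z, rfl⟩ := D.of.surjective z
      rw [← map_add, of_mul_of, of_mul_of, of_mul_of, ← map_add, map_add D.lam, mul_add,
        mul_add, add_smul, add_add_add_comm]
    right_distrib := fun x y z => by
      obtain ⟨x, rfl⟩ := D.of.surjective x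
      obtain ⟨y, rfl⟩ := D.of.surjective y
      obtain ⟨z, rfl⟩ := D.of.surjective z
      rw [← map_add, of_mul_of, of_mul_of, of_mul_of, ← map_add, map_add D.lam, add_mul,
        mul_add, add_mul, add_smul, add_add_add_comm]
    zero_mul := fun x => by
      obtain ⟨x, rfl⟩ := D.of.surjective x
      rw [← map_zero D.of, of_mul_of, map_zero, zero_mul, mul_zero, zero_mul, zero_smul, add_zero]
    mul_zero := fun x => by
      obtain ⟨x, rfl⟩ := D.of.surjective x
      rw [← map_zero D.of, of_mul_of, map_zero, mul_zero, mul_zero, zero_smul, add_zero]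
    one_mul := fun x => by
      obtain ⟨x, rfl⟩ := D.of.surjective x
      rw [← of_one, of_mul_of, lam_one, one_mul, mul_zero, zero_mul, zero_smul, add_zero]
    mul_one := fun x => by
      obtain ⟨x, rfl⟩ := D.of.surjective x
      rw [← of_one, of_mul_of, lam_one, mul_one, mul_zero, zero_smul, add_zero]
    mul_assoc := fun x y z => by
      obtain ⟨x, rfl⟩ := D.of.surjective x
      obtain ⟨y, rfl⟩ := D.of.surjective y
      obtain ⟨z, rfl⟩ := D.of.surjective z
      rw [of_mul_of, of_mul_of, of_mul_of, of_mul_of]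
      simp only [map_add D.lam, map_smul D.lam, D.lam_mul, D.lam_s, add_mul, mul_add,
        smul_mul_assoc, mul_smul_comm, D.mul_s, D.s_mul, smul_smul, smul_zero, add_zero, mul_assoc]
      rw [add_assoc, add_assoc, ← add_smul, ← add_smul]
      congr 3
      ring }

instance : Algebra F D.Twist :=
  Algebra.ofModule
    (fun r x y => by
      obtain ⟨x, rfl⟩ := D.of.surjective x
      obtain ⟨y, rfl⟩ := D.of.surjective y
      rw [← map_smul, of_mul_of, of_mul_of, ← map_smul, map_smul D.lam, smul_add, smul_mul_assoc,
        smul_smul, smul_eq_mul]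
      congr 3
      ring)
    (fun r x y => by
      obtain ⟨x, rfl⟩ := D.of.surjective x
      obtain ⟨y, rfl⟩ := D.of.surjective y
      rw [← map_smul, of_mul_of, of_mul_of, ← map_smul, map_smul D.lam, smul_add, mul_smul_comm,
        smul_smul, smul_eq_mul]
      congr 3
      ring)

theorem of_mul_of_left {x : A} (hx : D.lam x = 0) (y : A) : D.of x * D.of y = D.of (x * y) := by
  rw [of_mul_of, hx, mul_zero, zero_mul, zero_smul, add_zero]

theorem of_mul_of_right (x : A) {y : A} (hy : D.lam y = 0) : D.of x * D.of y = D.of (x * y) := by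
  rw [of_mul_of, hy, mul_zero, zero_smul, add_zero]

theorem of_pow {x : A} (hx : D.lam x = 0) (n : ℕ) : D.of x ^ n = D.of (x ^ n) := by
  induction n with
  | zero => rw [pow_zero, pow_zero, of_one]
  | succ n ih => rw [pow_succ, pow_succ, ih, D.of_mul_of_right _ hx]

theorem lam_mul_right {x y : A} (hx : D.eps y = 0) (hy : D.lam y = 0) : D.lam (x * y) = 0 := by
  rw [D.lam_mul, hx, hy, mul_zero, mul_zero, add_zero]

/-- A realization whose generators other than the loop `a` are killed by `lam` can be moved to the
deformed algebra, at the expense of changing the parameter. -/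
def realization {k t : ℕ} {c c' : F} (R : Realization F k t c' A) (hδ : c = c' + D.δ)
    (h1 : D.lam R.e1 = 0) (h2 : D.lam R.e2 = 0) (ha : D.lam R.a = 1) (hb : D.lam R.b = 0)
    (hb' : D.eps R.b = 0) (hg : D.lam R.g = 0) (hg' : D.eps R.g = 0) (hh : D.lam R.h = 0)
    (hs : (R.a * R.b * R.g) ^ k = D.s) : Realization F k t c D.Twist where
  e1 := D.of R.e1
  e2 := D.of R.e2
  a := D.of R.a
  b := D.of R.b
  g := D.of R.g
  h := D.of R.h
  unit := by rw [← map_add, R.unit, of_one]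
  idem1 := by rw [D.of_mul_of_left h1, R.idem1]
  idem2 := by rw [D.of_mul_of_left h2, R.idem2]
  orth12 := by rw [D.of_mul_of_left h1, R.orth12, map_zero]
  orth21 := by rw [D.of_mul_of_left h2, R.orth21, map_zero]
  aL := by rw [D.of_mul_of_left h1, R.aL]
  aR := by rw [D.of_mul_of_right _ h1, R.aR]
  bL := by rw [D.of_mul_of_left h1, R.bL]
  bR := by rw [D.of_mul_of_left hb, R.bR]
  gL := by rw [D.of_mul_of_left h2, R.gL]
  gR := by rw [D.of_mul_of_left hg, R.gR]
  hL := by rw [D.of_mul_of_left h2, R.hL]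
  hR := by rw [D.of_mul_of_left hh, R.hR]
  bh := by
    rw [D.of_mul_of_left hb, D.of_mul_of_right _ hb, D.of_mul_of_right _ hg,
      D.of_pow (D.lam_mul_right hg' hg), D.of_mul_of_right _ (D.lam_mul_right hb' hb), R.bh]
  gb := by rw [D.of_mul_of_left hg, D.of_pow hh, R.gb]
  hg := by
    have hga : D.lam (R.g * R.a) = 0 := by rw [D.lam_mul, hg, hg', zero_mul, zero_mul, add_zero]
    rw [D.of_mul_of_left hh, D.of_mul_of_left hg, D.of_mul_of_right _ hb,
      D.of_pow (D.lam_mul_right hb' hb), D.of_mul_of_right _ hga, R.hg]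
  bh2 := by rw [D.of_mul_of_left hb, D.of_mul_of_right _ hh, R.bh2, map_zero]
  h2g := by rw [D.of_mul_of_left hh, D.of_mul_of_right _ hg, R.h2g, map_zero]
  asq := by
    rw [D.of_mul_of_right _ hb, D.of_mul_of_right _ hg, D.of_pow (D.lam_mul_right hg' hg),
      D.of_mul_of, ha, R.asq, hs, mul_one, mul_one, ← add_smul, map_smul, hδ]

end TwistData

section LoopFunctional

variable {F : Type} [Field F] {k t : ℕ} {c : F}

variable (F c) in
/-- The algebra homomorphism to the dual numbers that kills `e₂`, `β`, `γ` and `η`. -/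
def toDual (hk : 1 ≤ k) (ht : 3 ≤ t) : BA F k t c →ₐ[F] DualNumber F :=
  Realization.lift
    { e1 := 1
      e2 := 0
      a := DualNumber.eps
      b := 0
      g := 0
      h := 0
      unit := add_zero 1
      idem1 := mul_one 1
      idem2 := mul_zero 0
      orth12 := mul_zero 1
      orth21 := zero_mul 1
      aL := one_mul _
      aR := mul_one _
      bL := mul_zero _
      bR := mul_zero _
      gL := mul_zero _
      gR := zero_mul _
      hL := mul_zero _
      hR := mul_zero _
      bh := by simp only [mul_zero]
      gb := by rw [mul_zero, zero_pow (by lia)]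
      hg := by simp only [mul_zero, zero_mul]
      bh2 := mul_zero _
      h2g := mul_zero _
      asq := by rw [mul_zero, zero_pow (by lia), smul_zero, DualNumber.eps_mul_eps] }

theorem toDual_e1 (hk : 1 ≤ k) (ht : 3 ≤ t) : toDual F c hk ht (std F k t c).e1 = 1 :=
  Realization.lift_gen _ .e1

theorem toDual_e2 (hk : 1 ≤ k) (ht : 3 ≤ t) : toDual F c hk ht (std F k t c).e2 = 0 :=
  Realization.lift_gen _ .e2

theorem toDual_a (hk : 1 ≤ k) (ht : 3 ≤ t) :
    toDual F c hk ht (std F k t c).a = DualNumber.eps :=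
  Realization.lift_gen _ .a

theorem toDual_b (hk : 1 ≤ k) (ht : 3 ≤ t) : toDual F c hk ht (std F k t c).b = 0 :=
  Realization.lift_gen _ .b

theorem toDual_g (hk : 1 ≤ k) (ht : 3 ≤ t) : toDual F c hk ht (std F k t c).g = 0 :=
  Realization.lift_gen _ .g

theorem toDual_h (hk : 1 ≤ k) (ht : 3 ≤ t) : toDual F c hk ht (std F k t c).h = 0 :=
  Realization.lift_gen _ .h

theorem toDual_u_top (hk : 1 ≤ k) (ht : 3 ≤ t) :
    toDual F c hk ht ((std F k t c).u (3 * k)) = 0 := by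
  rw [Realization.u_top _ hk, map_mul, toDual_g, mul_zero]

theorem mul_u_top (hk : 1 ≤ k) (ht : 3 ≤ t) (x : BA F k t c) :
    x * (std F k t c).u (3 * k) = (toDual F c hk ht x).fst • (std F k t c).u (3 * k) := by
  let S : Subalgebra F (BA F k t c) :=
    { carrier := {x | x * (std F k t c).u (3 * k) =
        (toDual F c hk ht x).fst • (std F k t c).u (3 * k)}
      mul_mem' := fun {x y} hx hy => by
        change x * _ = _ at hx
        change y * _ = _ at hy
        change x * y * _ = _
        rw [mul_assoc, hy, mul_smul_comm, hx, smul_smul, map_mul, TrivSqZeroExt.fst_mul,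
          _root_.mul_comm]
      add_mem' := fun {x y} hx hy => by
        change x * _ = _ at hx
        change y * _ = _ at hy
        change (x + y) * _ = _
        rw [add_mul, hx, hy, map_add, TrivSqZeroExt.fst_add, add_smul]
      algebraMap_mem' := fun r => by
        change algebraMap F _ r * _ = _
        rw [AlgHom.commutes, Algebra.algebraMap_eq_smul_one, smul_mul_assoc, one_mul]
        rfl }
  have hu (n : ℕ) (hn : 3 * k < n) := (std F k t c).u_eq_zero hk ht hn
  have he1 : (std F k t c).e1 * (std F k t c).u (3 * k) = (std F k t c).u (3 * k) := by
    rw [Realization.e1_u, if_neg (by lia)]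
  have hS : S = ⊤ := by
    refine subalgebra_eq_top ?_ ?_ ?_ ?_ ?_ ?_ <;> change _ * _ = _
    · rw [he1, toDual_e1, TrivSqZeroExt.fst_one, one_smul]
    · rw [Realization.e2_eq, sub_mul, he1, ← Realization.e2_eq, toDual_e2, TrivSqZeroExt.fst_zero,
        zero_smul, one_mul, sub_self]
    · rw [Realization.a_u _ hk ht, if_pos (by lia), hu _ (by lia), toDual_a, DualNumber.fst_eps,
        zero_smul]
    · rw [Realization.b_u, if_neg (by lia), toDual_b, TrivSqZeroExt.fst_zero, zero_smul]
    · rw [Realization.g_u _ ht, if_neg (by lia), if_neg (by lia), toDual_g,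
        TrivSqZeroExt.fst_zero, zero_smul]
    · rw [Realization.h_u _ hk ht, toDual_h, TrivSqZeroExt.fst_zero, zero_smul]
  exact (hS ▸ Algebra.mem_top : x ∈ S)

theorem u_top_mul (hk : 1 ≤ k) (ht : 3 ≤ t) (x : BA F k t c) :
    (std F k t c).u (3 * k) * x = (toDual F c hk ht x).fst • (std F k t c).u (3 * k) := by
  let S : Subalgebra F (BA F k t c) :=
    { carrier := {x | (std F k t c).u (3 * k) * x =
        (toDual F c hk ht x).fst • (std F k t c).u (3 * k)}
      mul_mem' := fun {x y} hx hy => by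
        change _ * x = _ at hx
        change _ * y = _ at hy
        change _ * (x * y) = _
        rw [← mul_assoc, hx, smul_mul_assoc, hy, smul_smul, map_mul, TrivSqZeroExt.fst_mul]
      add_mem' := fun {x y} hx hy => by
        change _ * x = _ at hx
        change _ * y = _ at hy
        change _ * (x + y) = _
        rw [mul_add, hx, hy, map_add, TrivSqZeroExt.fst_add, add_smul]
      algebraMap_mem' := fun r => by
        change _ * algebraMap F _ r = _
        rw [AlgHom.commutes, Algebra.algebraMap_eq_smul_one, mul_smul_comm, mul_one]
        rfl }
  have hS : S = ⊤ := by
    refine subalgebra_eq_top ?_ ?_ ?_ ?_ ?_ ?_ <;> change _ * _ = _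
    · rw [Realization.u_e1, toDual_e1, TrivSqZeroExt.fst_one, one_smul]
    · rw [Realization.e2_eq, mul_sub, Realization.u_e1, ← Realization.e2_eq, toDual_e2,
        TrivSqZeroExt.fst_zero, zero_smul, mul_one, sub_self]
    · rw [Realization.u_a _ hk ht, if_neg (by lia), if_neg (by lia), toDual_a,
        DualNumber.fst_eps, zero_smul]
    · rw [Realization.u_b, Realization.w_eq_zero _ hk ht (by lia), toDual_b,
        TrivSqZeroExt.fst_zero, zero_smul]
    · rw [Realization.u_g, toDual_g, TrivSqZeroExt.fst_zero, zero_smul]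
    · rw [Realization.u_h, toDual_h, TrivSqZeroExt.fst_zero, zero_smul]
  exact (hS ▸ Algebra.mem_top : x ∈ S)

variable (F) in
/-- The twist of `B^{k,t}_c` by `δ` times the square of the functional reading off the coefficient
of the loop `α`. -/
def loopTwist (hk : 1 ≤ k) (ht : 3 ≤ t) (c δ : F) : TwistData F (BA F k t c) where
  eps := (TrivSqZeroExt.fstHom F F F).comp (toDual F c hk ht)
  lam := (TrivSqZeroExt.sndHom F F).comp (toDual F c hk ht).toLinearMap
  s := (std F k t c).u (3 * k)
  δ := δ
  lam_mul x y := by simp [TrivSqZeroExt.snd_mul]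
  mul_s := mul_u_top hk ht
  s_mul := u_top_mul hk ht
  lam_s := congrArg TrivSqZeroExt.snd (toDual_u_top hk ht)

theorem std_abg_pow (hk : 1 ≤ k) :
    ((std F k t c).a * (std F k t c).b * (std F k t c).g) ^ k = (std F k t c).u (3 * k) := by
  rw [Realization.u_top _ hk, Realization.bhg_eq_abg _ hk]

variable (F) in
/-- The linear map `B^{k,t}_c → B^{k,t}_{c'}` matching the generators, which is multiplicative up
to a multiple of the socle element `βηγ`. -/
def changeParam (hk : 1 ≤ k) (ht : 3 ≤ t) (c c' : F) : BA F k t c →ₗ[F] BA F k t c' :=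
  (loopTwist F hk ht c' (c - c')).of.symm.toLinearMap ∘ₗ
    ((loopTwist F hk ht c' (c - c')).realization (std F k t c')
      (add_sub_cancel c' c).symm
      (congrArg TrivSqZeroExt.snd (toDual_e1 hk ht))
      (congrArg TrivSqZeroExt.snd (toDual_e2 hk ht))
      (congrArg TrivSqZeroExt.snd (toDual_a hk ht))
      (congrArg TrivSqZeroExt.snd (toDual_b hk ht))
      (congrArg TrivSqZeroExt.fst (toDual_b hk ht))
      (congrArg TrivSqZeroExt.snd (toDual_g hk ht))
      (congrArg TrivSqZeroExt.fst (toDual_g hk ht))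
      (congrArg TrivSqZeroExt.snd (toDual_h hk ht)) (std_abg_pow hk)).lift.toLinearMap

theorem changeParam_mul (hk : 1 ≤ k) (ht : 3 ≤ t) {c c' : F} (x y : BA F k t c) :
    changeParam F hk ht c c' (x * y) = changeParam F hk ht c c' x * changeParam F hk ht c c' y +
      ((c - c') * (toDual F c' hk ht (changeParam F hk ht c c' x)).snd *
        (toDual F c' hk ht (changeParam F hk ht c c' y)).snd) • (std F k t c').u (3 * k) := by
  rw [changeParam, LinearMap.comp_apply, AlgHom.toLinearMap_apply, map_mul]
  rfl

theorem changeParam_one (hk : 1 ≤ k) (ht : 3 ≤ t) {c c' : F} :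
    changeParam F hk ht c c' 1 = 1 := by
  rw [changeParam, LinearMap.comp_apply, AlgHom.toLinearMap_apply, map_one]
  rfl

theorem changeParam_mk (hk : 1 ≤ k) (ht : 3 ≤ t) {c c' : F} (x : Gen) :
    changeParam F hk ht c c' (mk F k t c (gen F x)) = mk F k t c' (gen F x) := by
  rw [changeParam, LinearMap.comp_apply, AlgHom.toLinearMap_apply, Realization.lift_gen]
  cases x <;> rfl

end LoopFunctional

section ParameterChange

variable {F : Type} [Field F] {k t : ℕ} {c c' : F}

theorem toDual_changeParam (hk : 1 ≤ k) (ht : 3 ≤ t) (x : BA F k t c) :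
    toDual F c' hk ht (changeParam F hk ht c c' x) = toDual F c hk ht x := by
  let S : Subalgebra F (BA F k t c) :=
    { carrier := {x | toDual F c' hk ht (changeParam F hk ht c c' x) = toDual F c hk ht x}
      mul_mem' := fun {x y} hx hy => by
        change toDual _ _ _ _ _ = _ at hx hy ⊢
        rw [changeParam_mul, map_add, map_smul, toDual_u_top, smul_zero, add_zero, map_mul, hx, hy,
          map_mul]
      add_mem' := fun {x y} hx hy => by
        change toDual _ _ _ _ _ = _ at hx hy ⊢
        rw [map_add, map_add, hx, hy, map_add]
      algebraMap_mem' := fun r => by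
        change toDual _ _ _ _ _ = _
        rw [Algebra.algebraMap_eq_smul_one, map_smul, changeParam_one, map_smul, map_smul, map_one,
          map_one] }
  have hS : S = ⊤ := by
    refine subalgebra_eq_top ?_ ?_ ?_ ?_ ?_ ?_
    · exact (congrArg _ (changeParam_mk hk ht .e1)).trans
        ((toDual_e1 hk ht).trans (toDual_e1 hk ht).symm)
    · exact (congrArg _ (changeParam_mk hk ht .e2)).trans
        ((toDual_e2 hk ht).trans (toDual_e2 hk ht).symm)
    · exact (congrArg _ (changeParam_mk hk ht .a)).trans
        ((toDual_a hk ht).trans (toDual_a hk ht).symm)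
    · exact (congrArg _ (changeParam_mk hk ht .b)).trans
        ((toDual_b hk ht).trans (toDual_b hk ht).symm)
    · exact (congrArg _ (changeParam_mk hk ht .g)).trans
        ((toDual_g hk ht).trans (toDual_g hk ht).symm)
    · exact (congrArg _ (changeParam_mk hk ht .h)).trans
        ((toDual_h hk ht).trans (toDual_h hk ht).symm)
  exact (hS ▸ Algebra.mem_top : x ∈ S)

theorem changeParam_u_top (hk : 1 ≤ k) (ht : 3 ≤ t) :
    changeParam F hk ht c c' ((std F k t c).u (3 * k)) = (std F k t c').u (3 * k) := by
  have hb : changeParam F hk ht c c' (std F k t c).b = (std F k t c').b := changeParam_mk hk ht .b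
  have hg : changeParam F hk ht c c' (std F k t c).g = (std F k t c').g := changeParam_mk hk ht .g
  have hh : changeParam F hk ht c c' (std F k t c).h = (std F k t c').h := changeParam_mk hk ht .h
  rw [Realization.u_top _ hk, changeParam_mul, changeParam_mul, hb, hg, hh, toDual_g, toDual_h,
    TrivSqZeroExt.snd_zero, mul_zero, mul_zero, zero_smul, add_zero, add_zero,
    Realization.u_top _ hk]

theorem changeParam_changeParam (hk : 1 ≤ k) (ht : 3 ≤ t) (x : BA F k t c) :
    changeParam F hk ht c' c (changeParam F hk ht c c' x) = x := by
  let S : Subalgebra F (BA F k t c) :=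
    { carrier := {x | changeParam F hk ht c' c (changeParam F hk ht c c' x) = x}
      mul_mem' := fun {x y} hx hy => by
        change changeParam _ _ _ _ _ _ = _ at hx hy ⊢
        rw [changeParam_mul, map_add, map_smul, changeParam_u_top, changeParam_mul, hx, hy,
          toDual_changeParam, toDual_changeParam, add_assoc, ← add_smul, mul_assoc, mul_assoc,
          ← add_mul, sub_add_sub_cancel, sub_self, zero_mul, zero_smul, add_zero]
      add_mem' := fun {x y} hx hy => by
        change changeParam _ _ _ _ _ _ = _ at hx hy ⊢
        rw [map_add, map_add, hx, hy]
      algebraMap_mem' := fun r => by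
        change changeParam _ _ _ _ _ _ = _
        rw [Algebra.algebraMap_eq_smul_one, map_smul, changeParam_one, map_smul, changeParam_one] }
  have hmk (x : Gen) :
      changeParam F hk ht c' c (changeParam F hk ht c c' (mk F k t c (gen F x))) =
        mk F k t c (gen F x) := by
    rw [changeParam_mk, changeParam_mk]
  have hS : S = ⊤ :=
    subalgebra_eq_top (hmk .e1) (hmk .e2) (hmk .a) (hmk .b) (hmk .g) (hmk .h)
  exact (hS ▸ Algebra.mem_top : x ∈ S)

variable (F) in
/-- The map `changeParam` as a linear equivalence. -/
def changeParamEquiv (hk : 1 ≤ k) (ht : 3 ≤ t) (c c' : F) : BA F k t c ≃ₗ[F] BA F k t c' :=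
  LinearEquiv.ofLinearMap (changeParam F hk ht c c') (changeParam F hk ht c' c)
    (LinearMap.ext (changeParam_changeParam hk ht)) (LinearMap.ext (changeParam_changeParam hk ht))

theorem changeParam_mem_Kspan (hk : 1 ≤ k) (ht : 3 ≤ t) {x : BA F k t c}
    (hx : x ∈ Kspan F (BA F k t c)) :
    changeParam F hk ht c c' x ∈ Kspan F (BA F k t c') := by
  have h : Kspan F (BA F k t c) ≤ (Kspan F (BA F k t c')).comap (changeParam F hk ht c c') := by
    refine Submodule.span_le.2 ?_
    rintro _ ⟨x, y, rfl⟩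
    rw [SetLike.mem_coe, Submodule.mem_comap, map_sub, changeParam_mul, changeParam_mul,
      mul_right_comm, add_sub_add_right_eq_sub]
    exact commutator_mem_Kspan _ _
  exact h hx

theorem changeParam_mem_Kspan_iff (hk : 1 ≤ k) (ht : 3 ≤ t) {x : BA F k t c} :
    changeParam F hk ht c c' x ∈ Kspan F (BA F k t c') ↔ x ∈ Kspan F (BA F k t c) := by
  refine ⟨fun h => ?_, changeParam_mem_Kspan hk ht⟩
  rw [← changeParam_changeParam (c' := c') hk ht x]
  exact changeParam_mem_Kspan hk ht h

variable [CharP F 2]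

theorem SoclePsi.apply_sq {ψ : BA F k t 0 →ₗ[F] F} (hψ : SoclePsi F k t 0 ψ) (hk : 1 ≤ k)
    (ht : 3 ≤ t) (hk' : Odd k) (ht' : Odd t) (x : BA F k t 0) : ψ (x ^ 2) = 0 := by
  let M : Submodule F (BA F k t 0) :=
    { carrier := {x | ψ (x ^ 2) = 0}
      zero_mem' := by simp
      add_mem' := fun {x y} hx hy => by
        change ψ (x ^ 2) = 0 at hx
        change ψ (y ^ 2) = 0 at hy
        change ψ ((x + y) ^ 2) = 0
        have h := map_eq_zero_of_mem_Kspan (hψ.mul_comm hk ht) (add_sq_sub_mem_Kspan x y)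
        rwa [map_sub, map_add, hx, hy, add_zero, sub_zero] at h
      smul_mem' := fun r x hx => by
        change ψ (x ^ 2) = 0 at hx
        change ψ ((r • x) ^ 2) = 0
        rw [smul_pow, map_smul, hx, smul_zero] }
  have hM : M = ⊤ := by
    obtain ⟨p, hp⟩ := hk'
    obtain ⟨q, hq⟩ := ht'
    refine eq_top_of_paths hk ht ?_ ?_ ?_ ?_ <;> intro n <;> change ψ (_ ^ 2) = 0
    · rcases (by lia : n % 3 = 0 ∨ n % 3 = 1 ∨ n % 3 = 2) with h | h | h
      · obtain ⟨i, rfl⟩ : ∃ i, n = 3 * i := ⟨n / 3, by lia⟩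
        rw [pow_two]
        nth_rw 2 [Realization.u_three_mul]
        rw [← mul_assoc, Realization.u_e1, ← Realization.u_add_mul, hψ.apply_u hk ht,
          if_neg (by lia)]
      · obtain ⟨i, rfl⟩ : ∃ i, n = 3 * i + 1 := ⟨n / 3, by lia⟩
        have ha : (std F k t 0).u (3 * i + 1) * (std F k t 0).a = 0 := by
          rw [Realization.u_a _ hk ht, if_neg (by lia), zero_smul, ite_self]
        have hu : (std F k t 0).a * (std F k t 0).u (3 * i) = (std F k t 0).u (3 * i + 1) := by
          rw [Realization.a_u _ hk ht, if_pos (by lia)]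
        rw [pow_two]
        nth_rw 2 [← hu]
        rw [← mul_assoc, ha, zero_mul, map_zero]
      · rw [pow_two]
        nth_rw 1 [← Realization.u_e1]
        rw [mul_assoc, Realization.e1_u, if_pos h, mul_zero, map_zero]
    · rcases (by lia : n % 3 = 0 ∨ n % 3 = 1 ∨ n % 3 = 2) with h | h | h
      · obtain ⟨i, rfl⟩ : ∃ i, n = 3 * i := ⟨n / 3, by lia⟩
        rw [pow_two]
        nth_rw 2 [Realization.v_three_mul]
        rw [← mul_assoc, Realization.v_e1, ← Realization.v_add_mul, hψ.apply_v hk ht,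
          if_neg (by lia)]
      · rw [pow_two]
        nth_rw 1 [← Realization.v_e1]
        rw [mul_assoc, Realization.e1_v, if_pos h, mul_zero, map_zero]
      · obtain ⟨i, rfl⟩ : ∃ i, n = 3 * i + 1 + 1 := ⟨n / 3, by lia⟩
        have hb : (std F k t 0).v (3 * i + 1 + 1) * (std F k t 0).b = 0 := by
          rw [Realization.v_b _ ht, if_neg (by lia), if_neg (by lia)]
        have hv : (std F k t 0).b * (std F k t 0).v (3 * i + 1) =
            (std F k t 0).v (3 * i + 1 + 1) := by
          rw [Realization.b_v, if_pos (by lia)]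
        rw [pow_two]
        nth_rw 2 [← hv]
        rw [← mul_assoc, hb, zero_mul, map_zero]
    · by_cases h : n % 3 = 0
      · obtain ⟨i, rfl⟩ : ∃ i, n = 3 * i := ⟨n / 3, by lia⟩
        rw [pow_two]
        nth_rw 2 [Realization.w_three_mul]
        rw [← mul_assoc, Realization.e2_eq, mul_sub, mul_one, Realization.w_e1, sub_zero,
          ← Realization.w_add_mul, hψ.apply_w hk ht, if_neg (by lia)]
      · have hw : (std F k t 0).e1 * (std F k t 0).w n = (std F k t 0).w n := by
          rw [Realization.e1_w, if_neg h]
        rw [pow_two]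
        nth_rw 2 [← hw]
        rw [← mul_assoc, Realization.w_e1, zero_mul, map_zero]
    · rw [pow_two]
      nth_rw 2 [Realization.y_eq]
      rw [← mul_assoc, Realization.e2_eq, mul_sub, mul_one, Realization.y_e1, sub_zero,
        ← Realization.y_add, hψ.apply_y hk ht, if_neg (by lia)]
  exact (hM ▸ Submodule.mem_top : x ∈ M)

end ParameterChange

section Dimension

theorem finrank_inf_ker_add_one {F V : Type} [Field F] [AddCommGroup V] [Module F V]
    [Module.Finite F V] (M : Submodule F V) (f : V →ₗ[F] F) {x : V} (hx : x ∈ M) (hf : f x ≠ 0) :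
    Module.finrank F ↥(M ⊓ LinearMap.ker f) + 1 = Module.finrank F M := by
  have hne : f.domRestrict M ≠ 0 := fun h => hf (LinearMap.congr_fun h ⟨x, hx⟩)
  have h := (f.domRestrict M).finrank_range_add_finrank_ker
  rw [LinearMap.range_eq_top.2 (LinearMap.surjective_of_ne_zero hne), finrank_top,
    Module.finrank_self] at h
  have hker : (LinearMap.ker (f.domRestrict M)).map M.subtype = M ⊓ LinearMap.ker f := by
    rw [← Submodule.map_comap_subtype]
    rfl
  rw [← hker, Submodule.finrank_map_subtype_eq, add_comm, h]

variable {F : Type} [Field F] {k t : ℕ}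

variable (F) in
/-- The coefficient of the loop `α`. -/
def loopCoeff (hk : 1 ≤ k) (ht : 3 ≤ t) (c : F) : BA F k t c →ₗ[F] F :=
  (TrivSqZeroExt.sndHom F F).comp (toDual F c hk ht).toLinearMap

theorem changeParam_sq (hk : 1 ≤ k) (ht : 3 ≤ t) (x : BA F k t 1) :
    changeParam F hk ht 1 0 (x ^ 2) = changeParam F hk ht 1 0 x ^ 2 +
      loopCoeff F hk ht 0 (changeParam F hk ht 1 0 x) ^ 2 • (std F k t 0).u (3 * k) := by
  rw [pow_two, changeParam_mul, sub_zero, one_mul, ← pow_two, ← pow_two]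
  rfl

variable [CharP F 2]

theorem SoclePsi.mem_T1space_iff {ψ : BA F k t 0 →ₗ[F] F} (hψ : SoclePsi F k t 0 ψ) (hk : 1 ≤ k)
    (ht : 3 ≤ t) (hk' : Odd k) (ht' : Odd t) (x : BA F k t 1) :
    x ∈ T1space F (BA F k t 1) ↔
      changeParam F hk ht 1 0 x ∈ T1space F (BA F k t 0) ⊓ LinearMap.ker (loopCoeff F hk ht 0) := by
  rw [mem_T1space, ← changeParam_mem_Kspan_iff (c' := 0) hk ht, changeParam_sq, Submodule.mem_inf,
    mem_T1space, LinearMap.mem_ker]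
  refine ⟨fun h => ?_, fun ⟨h, h0⟩ => ?_⟩
  · have h0 := map_eq_zero_of_mem_Kspan (hψ.mul_comm hk ht) h
    rw [map_add, hψ.apply_sq hk ht hk' ht', zero_add, map_smul, hψ.apply_u_top hk ht, smul_eq_mul,
      mul_one, sq_eq_zero_iff] at h0
    rw [h0, zero_pow two_ne_zero, zero_smul, add_zero] at h
    exact ⟨h, h0⟩
  · rwa [h0, zero_pow two_ne_zero, zero_smul, add_zero]

theorem SoclePsi.finrank_T1space {ψ : BA F k t 0 →ₗ[F] F} (hψ : SoclePsi F k t 0 ψ) (hk : 1 ≤ k)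
    (ht : 3 ≤ t) (hk' : Odd k) (ht' : Odd t) :
    Module.finrank F (T1space F (BA F k t 0)) = Module.finrank F (T1space F (BA F k t 1)) + 1 := by
  have := finite_BA (F := F) (c := 0) hk ht
  have ha : (std F k t 0).a ∈ T1space F (BA F k t 0) := by
    rw [mem_T1space, pow_two, (std F k t 0).asq, zero_smul]
    exact zero_mem _
  have hmap : (T1space F (BA F k t 1)).map (changeParamEquiv F hk ht 1 0).toLinearMap =
      T1space F (BA F k t 0) ⊓ LinearMap.ker (loopCoeff F hk ht 0) := by
    ext x
    rw [Submodule.mem_map_equiv, hψ.mem_T1space_iff hk ht hk' ht']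
    exact iff_of_eq (congrArg (· ∈ _) (changeParam_changeParam hk ht x))
  have hl : loopCoeff F hk ht 0 (std F k t 0).a ≠ 0 := by
    rw [show loopCoeff F hk ht 0 (std F k t 0).a = 1 from
      congrArg TrivSqZeroExt.snd (toDual_a hk ht)]
    exact one_ne_zero
  rw [← finrank_inf_ker_add_one _ _ ha hl, ← hmap, LinearEquiv.finrank_map_eq]

end Dimension

/-- **Theorem (Holm–Zimmermann, semidihedral type, second family).**  Let `F` be an
algebraically closed field of characteristic 2 and let `k ≥ 1` and `t ≥ 3` be odd.
Then `dim_F T₁(B^{k,t}_0) = dim_F T₁(B^{k,t}_1) + 1`; in particular the two spaces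
have different dimensions and there is no F-algebra isomorphism
`Z(B^{k,t}_0) → Z(B^{k,t}_1)` mapping `T₁(B^{k,t}_0)^⊥` onto `T₁(B^{k,t}_1)^⊥`. -/
theorem semidihedral_two_T1_dimensions_differ
    (F : Type) [Field F] [IsAlgClosed F] [CharP F 2]
    (k t : ℕ) (hk : 1 ≤ k) (ht : 3 ≤ t) (hkodd : Odd k) (htodd : Odd t)
    (ψ0 : BA F k t 0 →ₗ[F] F) (hψ0 : SoclePsi F k t 0 ψ0)
    (ψ1 : BA F k t 1 →ₗ[F] F) (hψ1 : SoclePsi F k t 1 ψ1) :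
    Module.finrank F ↥(Submodule.span F (T1set F k t 0))
      = Module.finrank F ↥(Submodule.span F (T1set F k t 1)) + 1 ∧
    Module.finrank F ↥(Submodule.span F (T1set F k t 0))
      ≠ Module.finrank F ↥(Submodule.span F (T1set F k t 1)) ∧
    ∀ φ : Subalgebra.center F (BA F k t 0) ≃ₐ[F] Subalgebra.center F (BA F k t 1),
      ¬ (φ '' (ReynoldsIdeal F k t 0 ψ0 : Set (Subalgebra.center F (BA F k t 0)))
          = (ReynoldsIdeal F k t 1 ψ1 : Set (Subalgebra.center F (BA F k t 1)))) := by
  have h := hψ0.finrank_T1space hk ht hkodd htodd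
  rw [span_T1set, span_T1set]
  refine ⟨h, by lia, fun φ hφ => ?_⟩
  have hmap : ((ReynoldsIdeal F k t 0 ψ0).restrictScalars F).map φ.toLinearEquiv.toLinearMap =
      (ReynoldsIdeal F k t 1 ψ1).restrictScalars F := SetLike.coe_injective hφ
  have hR := LinearEquiv.finrank_map_eq φ.toLinearEquiv
    ((ReynoldsIdeal F k t 0 ψ0).restrictScalars F)
  have := finite_BA (F := F) (c := 0) hk ht
  have hle := Submodule.finrank_le (T1space F (BA F k t 0))
  rw [hmap, hψ0.finrank_ReynoldsIdeal hk ht, hψ1.finrank_ReynoldsIdeal hk ht,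
    (changeParamEquiv F hk ht 1 0).finrank_eq] at hR
  lia

end SD2Paper

end
end

section
/- For all integers k,s ≥ 1 and c ∈ {0,1}, the bilinear form ⟨x,y⟩ := ψ(xy) on A^{k,s}_c is associative (⟨xy,z⟩ = ⟨x,yz⟩ for all x,y,z), symmetric, and non-degenerate. In particular A^{k,s}_c is a symmetric F-algebra. -/
/- Common setup: the algebras D(2B)^{k,s}(c) of dihedral type, over a field F,
   presented as a quotient of the free algebra on the paths-generators
   e₁, e₂ (trivial paths), α (loop at vertex 1), β (arrow 1 → 2),
   γ (arrow 2 → 1), η (loop at vertex 2), by the path-algebra relations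
   together with Erdmann's relations
   βη = 0, ηγ = 0, γβ = 0, α² = c(αβγ)^k, (αβγ)^k = (βγα)^k, η^s = (γαβ)^k. -/

noncomputable section

namespace DihedralPaper

inductive Gen : Type
  | e1 | e2 | a | b | g | h

variable (F : Type) [Field F]

/-- The generators inside the free algebra. -/
def gen (t : Gen) : FreeAlgebra F Gen := FreeAlgebra.ι F t

/-- The defining relations of `D(2B)^{k,s}(c)` (paths written from left to right). -/
inductive Rel (k s : ℕ) (c : F) : FreeAlgebra F Gen → FreeAlgebra F Gen → Prop
  | unit : Rel k s c (gen F .e1 + gen F .e2) 1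
  | idem1 : Rel k s c (gen F .e1 * gen F .e1) (gen F .e1)
  | idem2 : Rel k s c (gen F .e2 * gen F .e2) (gen F .e2)
  | orth12 : Rel k s c (gen F .e1 * gen F .e2) 0
  | orth21 : Rel k s c (gen F .e2 * gen F .e1) 0
  | aL : Rel k s c (gen F .e1 * gen F .a) (gen F .a)
  | aR : Rel k s c (gen F .a * gen F .e1) (gen F .a)
  | bL : Rel k s c (gen F .e1 * gen F .b) (gen F .b)
  | bR : Rel k s c (gen F .b * gen F .e2) (gen F .b)
  | gL : Rel k s c (gen F .e2 * gen F .g) (gen F .g)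
  | gR : Rel k s c (gen F .g * gen F .e1) (gen F .g)
  | hL : Rel k s c (gen F .e2 * gen F .h) (gen F .h)
  | hR : Rel k s c (gen F .h * gen F .e2) (gen F .h)
  | bh : Rel k s c (gen F .b * gen F .h) 0
  | hg : Rel k s c (gen F .h * gen F .g) 0
  | gb : Rel k s c (gen F .g * gen F .b) 0
  | asq : Rel k s c (gen F .a * gen F .a) (c • (gen F .a * gen F .b * gen F .g) ^ k)
  | abg : Rel k s c ((gen F .a * gen F .b * gen F .g) ^ k) ((gen F .b * gen F .g * gen F .a) ^ k)
  | hs : Rel k s c ((gen F .h) ^ s) ((gen F .g * gen F .a * gen F .b) ^ k)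

/-- The algebra `A^{k,s}_c = D(2B)^{k,s}(c)`. -/
def DA (k s : ℕ) (c : F) : Type := RingQuot (Rel F k s c)

instance (k s : ℕ) (c : F) : Ring (DA F k s c) :=
  inferInstanceAs (Ring (RingQuot (Rel F k s c)))

instance (k s : ℕ) (c : F) : Algebra F (DA F k s c) :=
  inferInstanceAs (Algebra F (RingQuot (Rel F k s c)))

variable (k s : ℕ) (c : F)

/-- The canonical projection. -/
def mk : FreeAlgebra F Gen →ₐ[F] DA F k s c := RingQuot.mkAlgHom F (Rel F k s c)

def E1 : DA F k s c := mk F k s c (gen F .e1)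
def E2 : DA F k s c := mk F k s c (gen F .e2)
/-- The image of the loop α at vertex 1. -/
def Al : DA F k s c := mk F k s c (gen F .a)
/-- The image of the arrow β : 1 → 2. -/
def Be : DA F k s c := mk F k s c (gen F .b)
/-- The image of the arrow γ : 2 → 1. -/
def Ga : DA F k s c := mk F k s c (gen F .g)
/-- The image of the loop η at vertex 2. -/
def Et : DA F k s c := mk F k s c (gen F .h)

/-- The path αβγ. -/
def ABG : DA F k s c := Al F k s c * Be F k s c * Ga F k s c
/-- The path βγα. -/
def BGA : DA F k s c := Be F k s c * Ga F k s c * Al F k s c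
/-- The path γαβ. -/
def GAB : DA F k s c := Ga F k s c * Al F k s c * Be F k s c

/-- The standard basis paths 𝓑₁₁ of e₁Ae₁. -/
def B11 : Set (DA F k s c) :=
  {E1 F k s c, Al F k s c, Be F k s c * Ga F k s c, (ABG F k s c) ^ k}
    ∪ (fun i => (ABG F k s c) ^ i) '' Set.Icc 1 (k - 1)
    ∪ (fun i => (ABG F k s c) ^ i * Al F k s c) '' Set.Icc 1 (k - 1)
    ∪ (fun i => (BGA F k s c) ^ i) '' Set.Icc 1 (k - 1)
    ∪ (fun i => (BGA F k s c) ^ i * (Be F k s c * Ga F k s c)) '' Set.Icc 1 (k - 1)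

/-- The standard basis paths 𝓑₁₂ of e₁Ae₂. -/
def B12 : Set (DA F k s c) :=
  {Be F k s c, Al F k s c * Be F k s c}
    ∪ (fun i => (BGA F k s c) ^ i * Be F k s c) '' Set.Icc 1 (k - 1)
    ∪ (fun i => (ABG F k s c) ^ i * (Al F k s c * Be F k s c)) '' Set.Icc 1 (k - 1)

/-- The standard basis paths 𝓑₂₁ of e₂Ae₁. -/
def B21 : Set (DA F k s c) :=
  {Ga F k s c, Ga F k s c * Al F k s c}
    ∪ (fun i => (GAB F k s c) ^ i * Ga F k s c) '' Set.Icc 1 (k - 1)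
    ∪ (fun i => (GAB F k s c) ^ i * (Ga F k s c * Al F k s c)) '' Set.Icc 1 (k - 1)

/-- The standard basis paths 𝓑₂₂ of e₂Ae₂. -/
def B22 : Set (DA F k s c) :=
  {E2 F k s c}
    ∪ (fun i => (GAB F k s c) ^ i) '' Set.Icc 1 (k - 1)
    ∪ (fun j => (Et F k s c) ^ j) '' Set.Icc 1 s

/-- The standard path basis 𝓑 of `A^{k,s}_c`. -/
def BB : Set (DA F k s c) :=
  B11 F k s c ∪ B12 F k s c ∪ B21 F k s c ∪ B22 F k s c

/-- The commutator subspace K(A): the F-linear span of all commutators. -/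
def Kspan (A : Type) [Ring A] [Algebra F A] : Submodule F A :=
  Submodule.span F {z : A | ∃ u v : A, z = u * v - v * u}

/-- The (left) socle of a ring: the sum of all simple (left) submodules. -/
def socle (A : Type) [Ring A] : Submodule A A := sSup {S : Submodule A A | IsAtom S}

/-- `ψ` is the linear form sending each standard basis path lying in the socle to 1
    and every other standard basis path to 0. -/
def SoclePsi (ψ : DA F k s c →ₗ[F] F) : Prop :=
  ∀ p ∈ BB F k s c,
    (p ∈ socle (DA F k s c) → ψ p = 1) ∧ (p ∉ socle (DA F k s c) → ψ p = 0)

/-- `T₁(A) = {x : x² ∈ K(A)}`. -/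
def T1set : Set (DA F k s c) := {z | z ^ 2 ∈ Kspan F (DA F k s c)}

/-- The orthogonal space `T₁(A)^⊥` with respect to the form `⟨x, y⟩ = ψ(xy)`. -/
def T1perp (ψ : DA F k s c →ₗ[F] F) : Set (DA F k s c) :=
  {y | ∀ x ∈ T1set F k s c, ψ (y * x) = 0}

/-- The first generalized Reynolds ideal, as an ideal of the center `Z(A)`. -/
def ReynoldsIdeal (ψ : DA F k s c →ₗ[F] F) :
    Ideal (Subalgebra.center F (DA F k s c)) :=
  Ideal.span {z : Subalgebra.center F (DA F k s c) | (z : DA F k s c) ∈ T1perp F k s c ψ}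



section Abstract

/-- The product of `n` consecutive factors of the cyclic word `a 0 * a 1 * a 2 * a 0 * ⋯`,
starting with `a i`. -/
def path {A : Type} [Ring A] (a : ZMod 3 → A) : ZMod 3 → ℕ → A
  | _, 0 => 1
  | i, n + 1 => a i * path a (i + 1) n

/-- The elements `e₁, e₂, a 0 = α, a 1 = β, a 2 = γ, η` generate `A` and satisfy the relations of
`D(2B)^{k,s}(c)`. -/
structure IsDihedral {F A : Type} [Field F] [Ring A] [Algebra F A] (k s : ℕ) (c : F)
    (e₁ e₂ : A) (a : ZMod 3 → A) (η : A) : Prop where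
  unit : e₁ + e₂ = 1
  idem₁ : e₁ * e₁ = e₁
  idem₂ : e₂ * e₂ = e₂
  orth₁₂ : e₁ * e₂ = 0
  orth₂₁ : e₂ * e₁ = 0
  e₁_α : e₁ * a 0 = a 0
  α_e₁ : a 0 * e₁ = a 0
  e₁_β : e₁ * a 1 = a 1
  β_e₂ : a 1 * e₂ = a 1
  e₂_γ : e₂ * a 2 = a 2
  γ_e₁ : a 2 * e₁ = a 2
  e₂_η : e₂ * η = η
  η_e₂ : η * e₂ = η
  β_η : a 1 * η = 0
  η_γ : η * a 2 = 0
  γ_β : a 2 * a 1 = 0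
  sq : a 0 * a 0 = c • path a 0 (3 * k)
  path_eq : path a 0 (3 * k) = path a 1 (3 * k)
  η_pow : η ^ s = path a 2 (3 * k)
  generates : ∀ S : Subalgebra F A,
    e₁ ∈ S → e₂ ∈ S → (∀ i, a i ∈ S) → η ∈ S → ∀ x, x ∈ S

variable {F A : Type} [Field F] [Ring A] [Algebra F A] {k s : ℕ} {c : F}
  {e₁ e₂ : A} {a : ZMod 3 → A} {η : A}

lemma zmod_three_cases (i : ZMod 3) : i = 0 ∨ i = 1 ∨ i = 2 := by
  revert i; decide

lemma cast_three_mul (k : ℕ) : ((3 * k : ℕ) : ZMod 3) = 0 :=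
  (ZMod.natCast_eq_zero_iff _ _).2 ⟨k, rfl⟩

lemma path_add (a : ZMod 3 → A) (i : ZMod 3) (n m : ℕ) :
    path a i (n + m) = path a i n * path a (i + n) m := by
  induction n generalizing i with
  | zero => simp [path]
  | succ n ih =>
    rw [show n + 1 + m = (n + m) + 1 by ring, path, ih, path, mul_assoc]
    congr 3
    push_cast; ring

lemma path_succ_right (a : ZMod 3 → A) (i : ZMod 3) (n : ℕ) :
    path a i (n + 1) = path a i n * a (i + n) := by
  rw [path_add]; simp [path]

lemma path_three_mul (a : ZMod 3 → A) (i : ZMod 3) (n : ℕ) :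
    path a i (3 * n) = path a i 3 ^ n := by
  induction n with
  | zero => simp [path]
  | succ n ih => rw [mul_add, path_add, ih, cast_three_mul, pow_succ]; simp

lemma path_three_mul_add (a : ZMod 3 → A) (i : ZMod 3) (n r : ℕ) :
    path a i (3 * n + r) = path a i 3 ^ n * path a i r := by
  rw [path_add, path_three_mul, cast_three_mul, add_zero]

namespace IsDihedral

variable (H : IsDihedral k s c e₁ e₂ a η)
include H

lemma e₁_arrow (i : ZMod 3) : e₁ * a i = if i = 2 then 0 else a i := by
  rcases zmod_three_cases i with rfl | rfl | rfl
  · rw [if_neg (by decide), H.e₁_α]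
  · rw [if_neg (by decide), H.e₁_β]
  · rw [if_pos rfl, ← H.e₂_γ, ← mul_assoc, H.orth₁₂, zero_mul]

lemma arrow_e₁ (i : ZMod 3) : a i * e₁ = if i = 1 then 0 else a i := by
  rcases zmod_three_cases i with rfl | rfl | rfl
  · rw [if_neg (by decide), H.α_e₁]
  · rw [if_pos rfl, ← H.β_e₂, mul_assoc, H.orth₂₁, mul_zero]
  · rw [if_neg (by decide), H.γ_e₁]

lemma e₂_eq : e₂ = 1 - e₁ := by rw [← H.unit]; abel

lemma e₂_arrow (i : ZMod 3) : e₂ * a i = if i = 2 then a i else 0 := by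
  rw [H.e₂_eq, sub_mul, H.e₁_arrow]; split_ifs <;> simp

lemma arrow_e₂ (i : ZMod 3) : a i * e₂ = if i = 1 then a i else 0 := by
  rw [H.e₂_eq, mul_sub, H.arrow_e₁]; split_ifs <;> simp

lemma e₁_η : e₁ * η = 0 := by rw [← H.e₂_η, ← mul_assoc, H.orth₁₂, zero_mul]

lemma η_e₁ : η * e₁ = 0 := by rw [← H.η_e₂, mul_assoc, H.orth₂₁, mul_zero]

lemma η_arrow (i : ZMod 3) : η * a i = 0 := by
  have key : ∀ x, e₁ * x = x → η * x = 0 := fun x hx => by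
    rw [← hx, ← mul_assoc, H.η_e₁, zero_mul]
  rcases zmod_three_cases i with rfl | rfl | rfl
  exacts [key _ H.e₁_α, key _ H.e₁_β, H.η_γ]

lemma arrow_η (i : ZMod 3) : a i * η = 0 := by
  have key : ∀ x, x * e₁ = x → x * η = 0 := fun x hx => by
    rw [← hx, mul_assoc, H.e₁_η, mul_zero]
  rcases zmod_three_cases i with rfl | rfl | rfl
  exacts [key _ H.α_e₁, H.β_η, key _ H.γ_e₁]

lemma arrow_mul_arrow {i j : ZMod 3} (hij : j ≠ i + 1) (h0 : ¬ (i = 0 ∧ j = 0)) :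
    a i * a j = 0 := by
  have h₁ : i ≠ 1 → j = 2 → a i * a j = 0 := fun hi hj => by
    have := H.arrow_e₁ i
    have h' := H.e₁_arrow j
    rw [if_neg hi] at this
    rw [if_pos hj] at h'
    rw [← this, mul_assoc, h', mul_zero]
  have h₂ : i = 1 → j ≠ 2 → a i * a j = 0 := fun hi hj => by
    have := H.arrow_e₁ i
    have h' := H.e₁_arrow j
    rw [if_pos hi] at this
    rw [if_neg hj] at h'
    rw [← h', ← mul_assoc, this, zero_mul]
  rcases zmod_three_cases i with rfl | rfl | rfl <;>
    rcases zmod_three_cases j with rfl | rfl | rfl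
  · exact absurd ⟨rfl, rfl⟩ h0
  · exact absurd (by decide) hij
  · exact h₁ (by decide) rfl
  · exact h₂ rfl (by decide)
  · exact h₂ rfl (by decide)
  · exact absurd (by decide) hij
  · exact absurd (by decide) hij
  · exact H.γ_β
  · exact h₁ (by decide) rfl

lemma e₁_path (i : ZMod 3) (n : ℕ) :
    e₁ * path a i (n + 1) = if i = 2 then 0 else path a i (n + 1) := by
  rw [path, ← mul_assoc, H.e₁_arrow]; split_ifs <;> simp

lemma path_e₁ (i : ZMod 3) (n : ℕ) :
    path a i (n + 1) * e₁ = if i + n = 1 then 0 else path a i (n + 1) := by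
  rw [path_succ_right, mul_assoc, H.arrow_e₁]; split_ifs <;> simp

lemma e₂_path (i : ZMod 3) (n : ℕ) :
    e₂ * path a i (n + 1) = if i = 2 then path a i (n + 1) else 0 := by
  rw [path, ← mul_assoc, H.e₂_arrow]; split_ifs <;> simp

lemma path_e₂ (i : ZMod 3) (n : ℕ) :
    path a i (n + 1) * e₂ = if i + n = 1 then path a i (n + 1) else 0 := by
  rw [path_succ_right, mul_assoc, H.arrow_e₂]; split_ifs <;> simp

lemma η_path (i : ZMod 3) (n : ℕ) : η * path a i (n + 1) = 0 := by
  rw [path, ← mul_assoc, H.η_arrow, zero_mul]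

lemma path_η (i : ZMod 3) (n : ℕ) : path a i (n + 1) * η = 0 := by
  rw [path_succ_right, mul_assoc, H.arrow_η, mul_zero]

lemma γ_path (hk : 1 ≤ k) : a 2 * path a 0 (3 * k) = 0 := by
  obtain ⟨m, hm⟩ : ∃ m, 3 * k = m + 1 := ⟨3 * k - 1, by omega⟩
  rw [H.path_eq, hm, path, ← mul_assoc, H.γ_β, zero_mul]

lemma path_succ_eq_zero (hk : 1 ≤ k) (i : ZMod 3) : path a i (3 * k + 1) = 0 := by
  obtain ⟨m, hm⟩ : ∃ m, 3 * k = (m + 1) + 1 := ⟨3 * k - 2, by omega⟩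
  have hm' : (m : ZMod 3) + 1 + 1 = 0 := by
    have := cast_three_mul k
    rw [hm] at this
    exact_mod_cast this
  have hm₁ : (m : ZMod 3) = 1 := by
    rw [show (m : ZMod 3) = m + 1 + 1 - 2 by ring, hm']; decide
  rcases zmod_three_cases i with rfl | rfl | rfl
  · rw [path_add, H.path_eq, cast_three_mul, hm, path_succ_right, path_succ_right]
    have e2 : (1 : ZMod 3) + (m : ℕ) = 2 := by rw [hm₁]; decide
    have e0 : (1 : ZMod 3) + ((m + 1 : ℕ) : ZMod 3) = 0 := by push_cast; rw [hm₁]; decide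
    rw [e2, e0]
    simp only [path, add_zero, mul_one]
    rw [mul_assoc, H.sq, mul_assoc, mul_smul_comm, H.γ_path hk, smul_zero, mul_zero]
  · rw [path_add, ← H.path_eq, cast_three_mul, hm, path_succ_right]
    have e2 : (0 : ZMod 3) + ((m + 1 : ℕ) : ZMod 3) = 2 := by push_cast; rw [hm₁]; decide
    rw [e2]
    simp only [path, add_zero, mul_one]
    rw [mul_assoc, H.γ_β, mul_zero]
  · rw [path, show (2 : ZMod 3) + 1 = 0 by decide, H.γ_path hk]

lemma path_eq_zero (hk : 1 ≤ k) (i : ZMod 3) {n : ℕ} (hn : 3 * k < n) : path a i n = 0 := by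
  obtain ⟨m, rfl⟩ := Nat.exists_eq_add_of_le (Nat.succ_le_of_lt hn)
  rw [Nat.succ_eq_add_one, path_add, H.path_succ_eq_zero hk, zero_mul]

lemma η_pow_eq_zero (hk : 1 ≤ k) {n : ℕ} (hn : s < n) : η ^ n = 0 := by
  obtain ⟨m, rfl⟩ := Nat.exists_eq_add_of_le (Nat.succ_le_of_lt hn)
  obtain ⟨l, hl⟩ : ∃ l, 3 * k = l + 1 := ⟨3 * k - 1, by omega⟩
  rw [pow_add, pow_succ, H.η_pow, hl, H.path_η, zero_mul]

lemma path_mul_path_of_ne (hk : 1 ≤ k) {i j : ZMod 3} {n m : ℕ} (hij : j ≠ i + (n + 1 : ℕ))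
    (h0 : ¬ (i = 0 ∧ j = 0 ∧ n = 0 ∧ m = 0)) :
    path a i (n + 1) * path a j (m + 1) = 0 := by
  rw [path_succ_right, path, mul_assoc, ← mul_assoc (a _) (a _)]
  by_cases h : i + n = 0 ∧ j = 0
  · rw [h.1, h.2, H.sq]
    by_cases hn : n = 0
    · have hm : m ≠ 0 := fun hm => h0 ⟨by simpa [hn] using h.1, h.2, hn, hm⟩
      have : path a 0 (3 * k) * path a (0 + 1) m = 0 := by
        have h' := path_add a 1 (3 * k) m
        rw [cast_three_mul, H.path_eq_zero hk _ (by omega)] at h'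
        rw [H.path_eq, zero_add, ← add_zero (1 : ZMod 3), ← h'.symm]
        simp
      rw [smul_mul_assoc, this, smul_zero, mul_zero]
    · have : path a i n * path a 0 (3 * k) = 0 := by
        have h' := path_add a i n (3 * k)
        rw [h.1, H.path_eq_zero hk _ (by omega)] at h'
        exact h'.symm
      rw [smul_mul_assoc, mul_smul_comm, ← mul_assoc, this, zero_mul, smul_zero]
  · rw [H.arrow_mul_arrow _ h, zero_mul, mul_zero]
    intro h'
    exact hij (by rw [h']; push_cast; ring)

/-- A closure principle for linear properties of the elements of `A`. -/
lemma induction (hk : 1 ≤ k) (M : Submodule F A) (h₁ : e₁ ∈ M) (h₂ : e₂ ∈ M)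
    (hp : ∀ i n, path a i (n + 1) ∈ M) (hη : ∀ n, η ^ (n + 1) ∈ M) (x : A) : x ∈ M := by
  let B : Set A := {e₁, e₂} ∪ (Set.range fun p : ZMod 3 × ℕ => path a p.1 (p.2 + 1)) ∪
    (Set.range fun n : ℕ => η ^ (n + 1))
  have hBM : Submodule.span F B ≤ M := by
    rw [Submodule.span_le]
    rintro _ (((rfl | rfl) | ⟨p, rfl⟩) | ⟨n, rfl⟩)
    exacts [h₁, h₂, hp _ _, hη _]
  have b₁ : e₁ ∈ Submodule.span F B := Submodule.subset_span (by simp [B])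
  have b₂ : e₂ ∈ Submodule.span F B := Submodule.subset_span (by simp [B])
  have bp : ∀ i n, path a i (n + 1) ∈ Submodule.span F B := fun i n =>
    Submodule.subset_span (Or.inl (Or.inr ⟨(i, n), rfl⟩))
  have bη : ∀ n, η ^ (n + 1) ∈ Submodule.span F B := fun n =>
    Submodule.subset_span (Or.inr ⟨n, rfl⟩)
  let S : Subalgebra F A :=
    { carrier := {y | ∀ m ∈ Submodule.span F B, y * m ∈ Submodule.span F B}
      mul_mem' := fun {y z} hy hz m hm => by
        rw [mul_assoc]; exact hy _ (hz _ hm)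
      add_mem' := fun {y z} hy hz m hm => by
        rw [add_mul]; exact add_mem (hy _ hm) (hz _ hm)
      algebraMap_mem' := fun r m hm => by
        rw [← Algebra.smul_def]; exact Submodule.smul_mem _ _ hm }
  have hS : ∀ y, (∀ b ∈ B, y * b ∈ Submodule.span F B) → y ∈ S := fun y hy m hm => by
    induction hm using Submodule.span_induction with
    | mem b hb => exact hy b hb
    | zero => simp
    | add u v _ _ hu hv => rw [mul_add]; exact add_mem hu hv
    | smul r u _ hu => rw [mul_smul_comm]; exact Submodule.smul_mem _ _ hu
  have hx : x ∈ S := by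
    have s₁ : e₁ ∈ S := by
      refine hS _ ?_
      rintro _ (((rfl | rfl) | ⟨⟨i, n⟩, rfl⟩) | ⟨n, rfl⟩)
      · rwa [H.idem₁]
      · rw [H.orth₁₂]; exact zero_mem _
      · dsimp only; rw [H.e₁_path]; split_ifs
        exacts [zero_mem _, bp _ _]
      · dsimp only; rw [pow_succ', ← mul_assoc, H.e₁_η, zero_mul]; exact zero_mem _
    have s₂ : e₂ ∈ S := by rw [H.e₂_eq]; exact sub_mem (one_mem _) s₁
    refine H.generates S s₁ s₂ (fun i => hS _ ?_) (hS _ ?_) x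
    · have pi : a i = path a i (0 + 1) := by simp [path]
      rintro _ (((rfl | rfl) | ⟨⟨j, n⟩, rfl⟩) | ⟨n, rfl⟩)
      · rw [H.arrow_e₁]; split_ifs
        exacts [zero_mem _, pi ▸ bp _ _]
      · rw [H.arrow_e₂]; split_ifs
        exacts [pi ▸ bp _ _, zero_mem _]
      · dsimp only
        by_cases h : j = i + 1
        · rw [h]; exact bp i (n + 1)
        · by_cases h0 : i = 0 ∧ j = 0 ∧ n = 0
          · obtain ⟨rfl, rfl, rfl⟩ := h0
            obtain ⟨m, hm⟩ : ∃ m, 3 * k = m + 1 := ⟨3 * k - 1, by omega⟩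
            rw [← pi, H.sq, hm]
            exact Submodule.smul_mem _ _ (bp _ _)
          · rw [pi, H.path_mul_path_of_ne hk (by simpa using h) (by tauto)]
            exact zero_mem _
      · dsimp only; rw [pow_succ', ← mul_assoc, H.arrow_η, zero_mul]; exact zero_mem _
    · rintro _ (((rfl | rfl) | ⟨⟨j, n⟩, rfl⟩) | ⟨n, rfl⟩)
      · rw [H.η_e₁]; exact zero_mem _
      · rw [H.η_e₂]; simpa using bη 0
      · dsimp only; rw [H.η_path]; exact zero_mem _
      · dsimp only; rw [← pow_succ']; exact bη _
  have := hx 1 (by rw [← H.unit]; exact add_mem b₁ b₂)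
  rw [mul_one] at this
  exact hBM this

/-- The arrows span a nilpotent subspace. -/
lemma span_arrows_pow_eq_bot (hk : 1 ≤ k) :
    ∃ N, (Submodule.span F (insert η (Set.range a))) ^ N = ⊥ := by
  set J := Submodule.span F (insert η (Set.range a)) with hJ
  let G : ℕ → Submodule F A := fun n => Submodule.span F
    (insert (path a 0 (3 * k)) ({x | ∃ i m, n ≤ m ∧ x = path a i (m + 1)} ∪
      {x | ∃ m, n ≤ m ∧ x = η ^ (m + 1)}))
  have pi : ∀ i, a i = path a i (0 + 1) := fun i => by simp [path]
  obtain ⟨l, hl⟩ : ∃ l, 3 * k = l + 1 := ⟨3 * k - 1, by omega⟩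
  have hz : ∀ i, a i * path a 0 (3 * k) = 0 := fun i => by
    by_cases h : i = 0
    · rw [h, H.path_eq]
      have := H.path_succ_eq_zero hk 0
      rwa [path, zero_add] at this
    · by_cases h' : i = 1
      · rw [h', hl, pi, H.path_mul_path_of_ne hk (by decide) (by simp)]
      · rcases zmod_three_cases i with rfl | rfl | rfl
        exacts [absurd rfl h, absurd rfl h', H.γ_path hk]
  have hmul : ∀ n, J * G n ≤ G (n + 1) := fun n => by
    rw [hJ, Submodule.span_mul_span, Submodule.span_le]
    rintro _ ⟨q, rfl | ⟨i, rfl⟩, x, rfl | ⟨j, m, hm, rfl⟩ | ⟨m, hm, rfl⟩, rfl⟩ <;> dsimp only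
    · rw [hl, H.η_path]; exact zero_mem _
    · rw [H.η_path]; exact zero_mem _
    · rw [← pow_succ']
      exact Submodule.subset_span (Or.inr (Or.inr ⟨m + 1, by omega, rfl⟩))
    · rw [hz]; exact zero_mem _
    · by_cases h : j = i + 1
      · rw [h]
        exact Submodule.subset_span (Or.inr (Or.inl ⟨i, m + 1, by omega, rfl⟩))
      · by_cases h0 : i = 0 ∧ j = 0 ∧ m = 0
        · obtain ⟨rfl, rfl, rfl⟩ := h0
          rw [← pi, H.sq]
          exact Submodule.smul_mem _ _ (Submodule.subset_span (Or.inl rfl))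
        · rw [pi, H.path_mul_path_of_ne hk (by simpa using h) (by tauto)]
          exact zero_mem _
    · rw [pow_succ', ← mul_assoc, H.arrow_η, zero_mul]; exact zero_mem _
  have hpow : ∀ n, J ^ (n + 1) ≤ G n := fun n => by
    induction n with
    | zero =>
      rw [zero_add, pow_one, hJ, Submodule.span_le]
      rintro _ (rfl | ⟨i, rfl⟩)
      · exact Submodule.subset_span (Or.inr (Or.inr ⟨0, le_rfl, by simp⟩))
      · exact Submodule.subset_span (Or.inr (Or.inl ⟨i, 0, le_rfl, pi i⟩))
    | succ n ih => rw [pow_succ']; exact (mul_le_mul_right ih J).trans (hmul n)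
  refine ⟨3 * k + s + 1 + 1, ?_⟩
  rw [eq_bot_iff, pow_succ']
  refine (mul_le_mul_right (hpow _) J).trans ?_
  rw [hJ, Submodule.span_mul_span, Submodule.span_le]
  rintro _ ⟨q, rfl | ⟨i, rfl⟩, x, rfl | ⟨j, m, hm, rfl⟩ | ⟨m, hm, rfl⟩, rfl⟩ <;>
    dsimp only
  · rw [hl, H.η_path]; exact zero_mem _
  · rw [H.η_path]; exact zero_mem _
  · rw [H.η_pow_eq_zero hk (by omega), mul_zero]; exact zero_mem _
  · rw [hz]; exact zero_mem _
  · rw [H.path_eq_zero hk _ (by omega), mul_zero]; exact zero_mem _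
  · rw [H.η_pow_eq_zero hk (by omega), mul_zero]; exact zero_mem _

/-- The arrows annihilate the left socle. -/
lemma arrow_mul_of_mem_socle (hk : 1 ≤ k) {x : A} (hx : x ∈ socle A) :
    (∀ i, a i * x = 0) ∧ η * x = 0 := by
  let P : A → Prop := fun t => (∀ i, a i * t = 0) ∧ η * t = 0
  have P0 : P 0 := ⟨fun i => mul_zero _, mul_zero _⟩
  have Padd : ∀ {t u}, P t → P u → P (t + u) := fun ht hu =>
    ⟨fun i => by rw [mul_add, ht.1, hu.1, add_zero], by rw [mul_add, ht.2, hu.2, add_zero]⟩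
  let S : Subalgebra F A :=
    { carrier := {y | ∀ t, P t → P (y * t)}
      mul_mem' := fun {y z} hy hz t ht => by
        rw [mul_assoc]; exact hy _ (hz _ ht)
      add_mem' := fun {y z} hy hz t ht => by
        rw [add_mul]; exact Padd (hy _ ht) (hz _ ht)
      algebraMap_mem' := fun r t ht => by
        rw [← Algebra.smul_def]
        exact ⟨fun i => by rw [mul_smul_comm, ht.1, smul_zero],
          by rw [mul_smul_comm, ht.2, smul_zero]⟩ }
  have s₁ : e₁ ∈ S := fun t ht => by
    refine ⟨fun i => ?_, by rw [← mul_assoc, H.η_e₁, zero_mul]⟩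
    rw [← mul_assoc, H.arrow_e₁]
    split_ifs
    exacts [zero_mul _, ht.1 i]
  have s₂ : e₂ ∈ S := by rw [H.e₂_eq]; exact sub_mem (one_mem _) s₁
  have hS : ∀ y, y ∈ S := H.generates S s₁ s₂
    (fun i t ht => by rw [ht.1]; exact P0) (fun t ht => by rw [ht.2]; exact P0)
  let T : Submodule A A :=
    { carrier := {t | P t}
      zero_mem' := P0
      add_mem' := Padd
      smul_mem' := fun y t ht => hS y t ht }
  suffices h : socle A ≤ T from h hx
  refine sSup_le fun U (hU : IsAtom U) => ?_
  by_contra hUT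
  have hbot : U ⊓ T = ⊥ := by
    rcases hU.le_iff.1 (inf_le_left : U ⊓ T ≤ U) with h | h
    · exact h
    · exact absurd (inf_eq_left.1 h) hUT
  obtain ⟨N, hN⟩ := H.span_arrows_pow_eq_bot hk
  have hdesc : ∀ n, ∀ u ∈ U,
      (∀ w ∈ (Submodule.span F (insert η (Set.range a))) ^ n, w * u = 0) → u = 0 := by
    intro n
    induction n with
    | zero =>
      intro u _ h
      simpa using h 1 (by rw [pow_zero]; exact Submodule.one_le.1 le_rfl)
    | succ n ih =>
      intro u hu h
      have hq : ∀ q ∈ insert η (Set.range a), q * u = 0 := fun q hq =>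
        ih _ (U.smul_mem q hu) fun w hw => by
          rw [← mul_assoc]
          exact h _ (by rw [pow_succ]; exact Submodule.mul_mem_mul hw (Submodule.subset_span hq))
      have : u ∈ U ⊓ T := ⟨hu, fun i => hq _ (Or.inr ⟨i, rfl⟩), hq _ (Or.inl rfl)⟩
      rw [hbot] at this
      exact this
  refine hU.1 ((Submodule.eq_bot_iff _).2 fun u hu => hdesc N u hu fun w hw => ?_)
  rw [hN, Submodule.mem_bot] at hw
  rw [hw, zero_mul]

omit H in
lemma mem_socle_of_forall_smul {z : A} (h : ∀ x : A, ∃ t : F, x * z = t • z) : z ∈ socle A := by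
  by_cases hz : z = 0
  · rw [hz]; exact zero_mem _
  have hatom : IsAtom (Submodule.span A {z}) := by
    refine ⟨by simpa using hz, fun U hU => ?_⟩
    by_contra hne
    obtain ⟨u, hu, hu0⟩ := (Submodule.ne_bot_iff _).1 hne
    obtain ⟨x, rfl⟩ := Submodule.mem_span_singleton.1 (hU.le hu)
    obtain ⟨t, ht⟩ := h x
    rw [smul_eq_mul, ht] at hu hu0
    have ht0 : t ≠ 0 := fun h0 => hu0 (by rw [h0, zero_smul])
    refine hU.not_ge ((Submodule.span_singleton_le_iff_mem _ _).2 ?_)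
    have := U.smul_mem (algebraMap F A t⁻¹) hu
    rwa [smul_eq_mul, ← Algebra.smul_def, smul_smul, inv_mul_cancel₀ ht0, one_smul] at this
  exact le_sSup (a := Submodule.span A {z}) hatom (Submodule.mem_span_singleton_self z)

lemma path_mem_socle (hk : 1 ≤ k) (i : ZMod 3) : path a i (3 * k) ∈ socle A := by
  refine mem_socle_of_forall_smul (F := F) fun x => ?_
  have hl : 3 * k = 3 * k - 1 + 1 := by omega
  let M : Submodule F A :=
    { carrier := {x | ∃ t : F, x * path a i (3 * k) = t • path a i (3 * k)}
      zero_mem' := ⟨0, by simp⟩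
      add_mem' := by
        rintro x y ⟨t, ht⟩ ⟨u, hu⟩
        exact ⟨t + u, by rw [add_mul, ht, hu, add_smul]⟩
      smul_mem' := by
        rintro r x ⟨t, ht⟩
        exact ⟨r * t, by rw [smul_mul_assoc, ht, smul_smul]⟩ }
  refine H.induction hk M ?_ ?_ (fun j n => ⟨0, ?_⟩) (fun n => ⟨0, ?_⟩) x
  · have := H.e₁_path i (3 * k - 1)
    rw [← hl] at this
    split_ifs at this
    exacts [⟨0, by simpa using this⟩, ⟨1, by simpa using this⟩]
  · have := H.e₂_path i (3 * k - 1)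
    rw [← hl] at this
    split_ifs at this
    exacts [⟨1, by simpa using this⟩, ⟨0, by simpa using this⟩]
  · rw [zero_smul]
    by_cases h : i = j + (n + 1 : ℕ)
    · rw [h, ← path_add, H.path_eq_zero hk _ (by omega)]
    · rw [hl, H.path_mul_path_of_ne hk h (by omega)]
  · rw [zero_smul, hl, pow_succ, mul_assoc, H.η_path, mul_zero]

section Form

variable {ψ : A →ₗ[F] F} (h₁ : ψ e₁ = 0) (h₂ : ψ e₂ = 0)
  (hp : ∀ i n, ψ (path a i (n + 1)) = if n + 1 = 3 * k then 1 else 0)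
  (hη : ∀ n, ψ (η ^ (n + 1)) = if n + 1 = s then 1 else 0)

include hp in
lemma form_path_mul_path (hk : 1 ≤ k) (i j : ZMod 3) (n m : ℕ) :
    ψ (path a i (n + 1) * path a j (m + 1)) =
      (if j = i + (n + 1 : ℕ) ∧ n + 1 + (m + 1) = 3 * k then 1 else 0) +
        if i = 0 ∧ j = 0 ∧ n = 0 ∧ m = 0 then c else 0 := by
  by_cases h : j = i + (n + 1 : ℕ)
  · have h0 : ¬ (i = 0 ∧ j = 0 ∧ n = 0 ∧ m = 0) := by
      rintro ⟨rfl, rfl, rfl, rfl⟩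
      exact absurd h (by decide)
    rw [if_neg h0, add_zero]
    subst h
    rw [← path_add, show n + 1 + (m + 1) = n + 1 + m + 1 by ring, hp]
    simp
  · rw [if_neg (fun h' => h h'.1), zero_add]
    split_ifs with h0
    · obtain ⟨rfl, rfl, rfl, rfl⟩ := h0
      have hl : 3 * k = 3 * k - 1 + 1 := by omega
      have : ψ (path a 0 (3 * k)) = 1 := by rw [hl, hp, if_pos (by omega)]
      simp [path, H.sq, this]
    · rw [H.path_mul_path_of_ne hk h h0, map_zero]

include hp in
theorem form_symmetric (hk : 1 ≤ k) (x y : A) : ψ (x * y) = ψ (y * x) := by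
  let C : A → Submodule F A := fun y =>
    { carrier := {x | ψ (x * y) = ψ (y * x)}
      zero_mem' := by simp
      add_mem' := by
        intro u v (hu : _ = _) (hv : _ = _)
        change _ = _
        rw [add_mul, mul_add, map_add, map_add, hu, hv]
      smul_mem' := by
        intro r u (hu : _ = _)
        change _ = _
        rw [smul_mul_assoc, mul_smul_comm, map_smul, map_smul, hu] }
  have hC : ∀ {u v}, v ∈ C u → u ∈ C v := fun h => Eq.symm h
  have c₁ : ∀ x, e₁ ∈ C x := fun x => hC <| by
    refine H.induction hk (C e₁) ?_ ?_ (fun i n => ?_) (fun n => ?_) x <;> change _ = _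
    · rfl
    · rw [H.orth₁₂, H.orth₂₁]
    · rw [H.path_e₁, H.e₁_path]
      by_cases hn : n + 1 = 3 * k
      · have : (n : ZMod 3) = 2 := by
          have h := cast_three_mul k
          rw [← hn] at h
          push_cast at h
          rw [show (n : ZMod 3) = n + 1 - 1 by ring, h]; decide
        have h' : i + 2 = 1 ↔ i = 2 := by revert i; decide
        rw [this]; simp only [h']
      · have : ψ (path a i (n + 1)) = 0 := by rw [hp, if_neg hn]
        split_ifs <;> simp [this]
    · rw [pow_succ, mul_assoc, H.η_e₁, ← pow_succ, pow_succ', ← mul_assoc, H.e₁_η]; simp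
  have c₂ : ∀ x, e₂ ∈ C x := fun x => by
    rw [H.e₂_eq]
    exact sub_mem (show _ = _ by simp) (c₁ x)
  have cη : ∀ n x, η ^ (n + 1) ∈ C x := fun n x => hC <| by
    refine H.induction hk (C _) (c₁ _) (c₂ _) (fun i m => ?_) (fun m => ?_) x <;>
      change _ = _
    · rw [pow_succ, mul_assoc, H.η_path, ← pow_succ, pow_succ', ← mul_assoc, H.path_η]; simp
    · rw [← pow_add, ← pow_add, add_comm]
  refine H.induction hk (C y) (c₁ _) (c₂ _) (fun i n => ?_) (fun n => cη _ _) x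
  refine hC (H.induction hk (C _) (c₁ _) (c₂ _) (fun j m => ?_) (fun n => cη _ _) y)
  change _ = _
  rw [H.form_path_mul_path hp hk, H.form_path_mul_path hp hk]
  congr 1
  · refine if_congr ?_ rfl rfl
    rw [add_comm (m + 1)]
    refine and_congr_left fun h => ?_
    have h := congrArg (Nat.cast : ℕ → ZMod 3) h
    rw [cast_three_mul, Nat.cast_add] at h
    constructor
    · rintro rfl; rw [add_assoc, add_comm ((m + 1 : ℕ) : ZMod 3), h, add_zero]
    · rintro rfl; rw [add_assoc, h, add_zero]
  · exact if_congr (by tauto) rfl rfl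

include h₁ h₂ hp hη in
theorem form_nondegenerate (hk : 1 ≤ k) (hs : 1 ≤ s) (x : A) (hx : ∀ y, ψ (x * y) = 0) :
    x = 0 := by
  obtain ⟨l, hl⟩ : ∃ l, 3 * k = l + 1 + 1 := ⟨3 * k - 2, by omega⟩
  obtain ⟨r, rfl⟩ : ∃ r, s = r + 1 := ⟨s - 1, by omega⟩
  have hP := H.form_path_mul_path hp hk
  have hl0 : (l : ZMod 3) = 1 := by
    have h := cast_three_mul k
    rw [hl] at h
    push_cast at h
    rw [show (l : ZMod 3) = l + 1 + 1 - 2 by ring, h]; decide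
  have hz := H.path_eq
  have hw := H.η_pow
  rw [hl] at hz hw
  simp only [hl] at hp hP
  have he₁η : ∀ n, e₁ * η ^ (n + 1) = 0 := fun n => by
    rw [pow_succ', ← mul_assoc, H.e₁_η, zero_mul]
  have he₂η : ∀ n, e₂ * η ^ (n + 1) = η ^ (n + 1) := fun n => by
    rw [pow_succ', ← mul_assoc, H.e₂_η]
  have hηe₁ : ∀ n, η ^ (n + 1) * e₁ = 0 := fun n => by
    rw [pow_succ, mul_assoc, H.η_e₁, mul_zero]
  have hηe₂ : ∀ n, η ^ (n + 1) * e₂ = η ^ (n + 1) := fun n => by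
    rw [pow_succ, mul_assoc, H.η_e₂]
  have hpη : ∀ i n m, path a i (n + 1) * η ^ (m + 1) = 0 := fun i n m => by
    rw [pow_succ', ← mul_assoc, H.path_η, zero_mul]
  have hηp : ∀ i n m, η ^ (m + 1) * path a i (n + 1) = 0 := fun i n m => by
    rw [pow_succ, mul_assoc, H.η_path, mul_zero]
  let ev : A → A → (A →ₗ[F] A) := fun d b => (ψ ∘ₗ LinearMap.mulRight F d).smulRight b
  have hev : ∀ d b x, ev d b x = ψ (x * d) • b := fun _ _ _ => rfl
  let Φ : A →ₗ[F] A :=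
    ev (path a 0 (l + 1 + 1)) e₁ + ev (path a 2 (l + 1 + 1)) e₂ + ev e₁ (path a 0 (l + 1 + 1)) +
      ev e₂ (path a 2 (l + 1 + 1)) +
      (∑ n ∈ Finset.range (l + 1), ∑ i,
        ev (path a (i + (n + 1 : ℕ)) (l - n + 1)) (path a i (n + 1))) +
      (∑ n ∈ Finset.range r, ev (η ^ (r - 1 - n + 1)) (η ^ (n + 1))) -
      c • ev (path a 1 (l + 1)) (path a 1 (l + 1))
  have hΦ : ∀ x, Φ x = ψ (x * path a 0 (l + 1 + 1)) • e₁ + ψ (x * path a 2 (l + 1 + 1)) • e₂ +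
      ψ (x * e₁) • path a 0 (l + 1 + 1) + ψ (x * e₂) • path a 2 (l + 1 + 1) +
      (∑ n ∈ Finset.range (l + 1), ∑ i,
        ψ (x * path a (i + (n + 1 : ℕ)) (l - n + 1)) • path a i (n + 1)) +
      (∑ n ∈ Finset.range r, ψ (x * η ^ (r - 1 - n + 1)) • η ^ (n + 1)) -
      c • ψ (x * path a 1 (l + 1)) • path a 1 (l + 1) := fun x => by
    simp only [Φ, LinearMap.add_apply, LinearMap.sub_apply, LinearMap.smul_apply,
      LinearMap.sum_apply, hev]
  have hlen : ∀ n, l - n ≠ l + 1 := fun n => by omega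
  have hsum : ∀ j m, m ≤ l →
      (∑ n ∈ Finset.range (l + 1), ∑ i,
        ψ (path a j (m + 1) * path a (i + (n + 1 : ℕ)) (l - n + 1)) • path a i (n + 1)) =
      path a j (m + 1) + (if j = 0 ∧ m = 0 then c else 0) • path a 1 (l + 1) := by
    intro j m hm
    have hterm : ∀ n ∈ Finset.range (l + 1), ∀ i,
        ψ (path a j (m + 1) * path a (i + (n + 1 : ℕ)) (l - n + 1)) • path a i (n + 1) =
          (if n = m then if i = j then path a j (m + 1) else 0 else 0) +
            if n = l then if i = 1 then
              (if j = 0 ∧ m = 0 then c else 0) • path a 1 (l + 1) else 0 else 0 := by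
      intro n hn i
      have hn := Finset.mem_range.1 hn
      rw [hP, add_smul]
      congr 1
      · by_cases hnm : n = m
        · subst hnm
          by_cases hij : i = j
          · subst hij
            rw [if_pos ⟨rfl, by omega⟩, if_pos rfl, if_pos rfl, one_smul]
          · rw [if_neg (fun h => hij (add_right_cancel h.1)), if_pos rfl, if_neg hij, zero_smul]
        · rw [if_neg (fun h => hnm (by omega)), if_neg hnm, zero_smul]
      · by_cases hnl : n = l
        · subst hnl
          have h0 : i + ((n + 1 : ℕ) : ZMod 3) = 0 ↔ i = 1 := by
            rw [Nat.cast_add, hl0]; revert i; decide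
          simp only [h0]
          by_cases hi : i = 1
          · subst hi
            simp
          · simp [hi]
        · have : l - n ≠ 0 := by omega
          simp [hnl, this]
    rw [Finset.sum_congr rfl fun n hn => Finset.sum_congr rfl fun i _ => hterm n hn i]
    simp [Finset.sum_add_distrib, hm]
  have key : ∀ x, Φ x = x := fun x => by
    refine H.induction hk (LinearMap.eqLocus Φ LinearMap.id) ?_ ?_ (fun j m => ?_) (fun m => ?_) x <;>
      rw [LinearMap.mem_eqLocus, LinearMap.id_apply]
    · have h02 : (0 : ZMod 3) ≠ 2 := by decide
      rw [hΦ]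
      simp [H.e₁_path, H.idem₁, H.orth₁₂, h₁, he₁η, apply_ite ψ, hp, hlen, h02]
    · have h02 : (0 : ZMod 3) ≠ 2 := by decide
      rw [hΦ]
      simp only [H.e₂_path, H.idem₂, H.orth₂₁, he₂η]
      simp [h₂, apply_ite ψ, hp, hη, hlen, h02]
      refine Finset.sum_eq_zero fun n hn => if_neg ?_
      have := Finset.mem_range.1 hn
      omega
    · rcases lt_trichotomy m (l + 1) with hm | rfl | hm
      · have hm : m ≤ l := by omega
        rw [hΦ, hsum j m hm]
        have h20 : (2 : ZMod 3) ≠ 0 := by decide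
        have hne : m ≠ l + 1 := by omega
        have h1 : (1 = j + ((m + 1 : ℕ) : ZMod 3) ∧ m + 1 + (l + 1) = l + 1 + 1) ↔
            (j = 0 ∧ m = 0) := by
          constructor
          · rintro ⟨h, h'⟩
            obtain rfl : m = 0 := by omega
            exact ⟨by simpa using h.symm, rfl⟩
          · rintro ⟨rfl, rfl⟩
            exact ⟨by simp, by omega⟩
        simp only [hpη, map_zero, zero_smul, Finset.sum_const_zero, hP, H.path_e₁, H.path_e₂, h1]
        simp [apply_ite ψ, hp, hne]
      · have h0 : ∀ i n, ψ (path a j (l + 1 + 1) * path a i (n + 1)) = 0 := fun i n => by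
          rw [hP, if_neg (by omega), if_neg (by omega), add_zero]
        have hj : j + ((l + 1 : ℕ) : ZMod 3) = 1 ↔ j = 2 := by
          rw [Nat.cast_add, hl0]; clear h0; revert j; decide
        rw [hΦ]
        simp only [hpη, h0, H.path_e₁, H.path_e₂, hj]
        have h02 : (0 : ZMod 3) ≠ 2 := by decide
        have h12 : (1 : ZMod 3) ≠ 2 := by decide
        rcases zmod_three_cases j with rfl | rfl | rfl <;> simp [hp, hz, h02, h12]
      · rw [H.path_eq_zero hk _ (by omega), map_zero]
    · rcases lt_trichotomy m r with hm | rfl | hm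
      · have hterm : ∀ n ∈ Finset.range r,
            ψ (η ^ (m + 1 + (r - 1 - n) + 1)) • η ^ (n + 1) =
              if n = m then η ^ (m + 1) else 0 := fun n hn => by
          have hn := Finset.mem_range.1 hn
          rw [hη]
          by_cases hnm : n = m
          · rw [if_pos (by omega), if_pos hnm, one_smul, hnm]
          · rw [if_neg (by omega), if_neg hnm, zero_smul]
        rw [hΦ]
        simp only [hηp, hηe₁, hηe₂, ← pow_add, ← add_assoc]
        rw [Finset.sum_congr rfl hterm]
        simp [hη, hm, hm.ne]
      · have h0 : ∀ n, ψ (η ^ (m + 1 + n + 1)) = 0 := fun n => by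
          rw [hη, if_neg (by omega)]
        rw [hΦ]
        simp only [hηp, hηe₁, hηe₂, ← pow_add, ← add_assoc, h0]
        simp [hw, hp]
      · rw [H.η_pow_eq_zero hk (by omega), map_zero]
  rw [← key x, hΦ]
  simp [hx]

end Form

end IsDihedral

end Abstract

/-- The images of the arrows `α, β, γ`. -/
def arrows (i : ZMod 3) : DA F k s c :=
  if i = 0 then Al F k s c else if i = 1 then Be F k s c else Ga F k s c

lemma arrows_zero : arrows F k s c 0 = Al F k s c := rfl

lemma arrows_one : arrows F k s c 1 = Be F k s c := rfl

lemma arrows_two : arrows F k s c 2 = Ga F k s c := rfl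

lemma path_arrows_zero : path (arrows F k s c) 0 3 = ABG F k s c := by
  simp only [path, ABG, mul_one, ← mul_assoc]; rfl

lemma path_arrows_one : path (arrows F k s c) 1 3 = BGA F k s c := by
  simp only [path, BGA, mul_one, ← mul_assoc]; rfl

lemma path_arrows_two : path (arrows F k s c) 2 3 = GAB F k s c := by
  simp only [path, GAB, mul_one, ← mul_assoc]; rfl

lemma mk_eq_mk {x y : FreeAlgebra F Gen} (h : Rel F k s c x y) :
    mk F k s c x = mk F k s c y :=
  RingQuot.mkAlgHom_rel F h

lemma isDihedral :
    IsDihedral k s c (E1 F k s c) (E2 F k s c) (arrows F k s c) (Et F k s c) where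
  unit := by simpa [E1, E2] using mk_eq_mk F k s c Rel.unit
  idem₁ := by simpa [E1] using mk_eq_mk F k s c Rel.idem1
  idem₂ := by simpa [E2] using mk_eq_mk F k s c Rel.idem2
  orth₁₂ := by simpa [E1, E2] using mk_eq_mk F k s c Rel.orth12
  orth₂₁ := by simpa [E1, E2] using mk_eq_mk F k s c Rel.orth21
  e₁_α := by simpa [E1, arrows_zero, Al] using mk_eq_mk F k s c Rel.aL
  α_e₁ := by simpa [E1, arrows_zero, Al] using mk_eq_mk F k s c Rel.aR
  e₁_β := by simpa [E1, arrows_one, Be] using mk_eq_mk F k s c Rel.bL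
  β_e₂ := by simpa [E2, arrows_one, Be] using mk_eq_mk F k s c Rel.bR
  e₂_γ := by simpa [E2, arrows_two, Ga] using mk_eq_mk F k s c Rel.gL
  γ_e₁ := by simpa [E1, arrows_two, Ga] using mk_eq_mk F k s c Rel.gR
  e₂_η := by simpa [E2, Et] using mk_eq_mk F k s c Rel.hL
  η_e₂ := by simpa [E2, Et] using mk_eq_mk F k s c Rel.hR
  β_η := by simpa [arrows_one, Be, Et] using mk_eq_mk F k s c Rel.bh
  η_γ := by simpa [arrows_two, Ga, Et] using mk_eq_mk F k s c Rel.hg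
  γ_β := by simpa [arrows_one, arrows_two, Be, Ga] using mk_eq_mk F k s c Rel.gb
  sq := by
    rw [path_three_mul, path_arrows_zero]
    simpa [arrows_zero, ABG, Al, Be, Ga] using mk_eq_mk F k s c Rel.asq
  path_eq := by
    rw [path_three_mul, path_three_mul, path_arrows_zero, path_arrows_one]
    simpa [ABG, BGA, Al, Be, Ga] using mk_eq_mk F k s c Rel.abg
  η_pow := by
    rw [path_three_mul, path_arrows_two]
    simpa [GAB, Al, Be, Ga, Et] using mk_eq_mk F k s c Rel.hs
  generates S h₁ h₂ ha hη x := by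
    obtain ⟨f, rfl⟩ := RingQuot.mkAlgHom_surjective F (Rel F k s c) x
    change mk F k s c f ∈ S
    induction f using FreeAlgebra.induction with
    | grade0 r => rw [AlgHom.commutes]; exact S.algebraMap_mem r
    | grade1 t =>
      cases t
      exacts [h₁, h₂, ha 0, ha 1, ha 2, hη]
    | mul u v hu hv => rw [map_mul]; exact S.mul_mem hu hv
    | add u v hu hv => rw [map_add]; exact S.add_mem hu hv

lemma path_mem_BB {n : ℕ} (h0 : 0 < n) (hn : n < 3 * k) (i : ZMod 3) :
    path (arrows F k s c) i n ∈ BB F k s c := by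
  obtain ⟨q, r, hr, rfl⟩ : ∃ q r, r < 3 ∧ n = 3 * q + r :=
    ⟨n / 3, n % 3, Nat.mod_lt _ (by norm_num), (Nat.div_add_mod n 3).symm⟩
  rw [path_three_mul_add]
  have hq : q = 0 ∨ q ∈ Set.Icc 1 (k - 1) := by
    rw [Set.mem_Icc]; omega
  have hr' : r = 0 ∨ r = 1 ∨ r = 2 := by omega
  rcases zmod_three_cases i with rfl | rfl | rfl
  · rw [path_arrows_zero]
    rcases hr' with rfl | rfl | rfl
    · rcases hq with rfl | hq
      · omega
      · exact Or.inl (Or.inl (Or.inl (Or.inl (Or.inl (Or.inl (Or.inr ⟨q, hq, by simp [path]⟩))))))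
    · have h : path (arrows F k s c) 0 1 = Al F k s c := mul_one _
      rw [h]
      rcases hq with rfl | hq
      · simp [BB, B11]
      · exact Or.inl (Or.inl (Or.inl (Or.inl (Or.inl (Or.inr ⟨q, hq, rfl⟩)))))
    · have h : path (arrows F k s c) 0 2 = Al F k s c * Be F k s c :=
        congrArg (Al F k s c * ·) (mul_one _)
      rw [h]
      rcases hq with rfl | hq
      · simp [BB, B12]
      · exact Or.inl (Or.inl (Or.inr (Or.inr ⟨q, hq, rfl⟩)))
  · rw [path_arrows_one]
    rcases hr' with rfl | rfl | rfl
    · rcases hq with rfl | hq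
      · omega
      · exact Or.inl (Or.inl (Or.inl (Or.inl (Or.inr ⟨q, hq, by simp [path]⟩))))
    · have h : path (arrows F k s c) 1 1 = Be F k s c := mul_one _
      rw [h]
      rcases hq with rfl | hq
      · simp [BB, B12]
      · exact Or.inl (Or.inl (Or.inr (Or.inl (Or.inr ⟨q, hq, rfl⟩))))
    · have h : path (arrows F k s c) 1 2 = Be F k s c * Ga F k s c :=
        congrArg (Be F k s c * ·) (mul_one _)
      rw [h]
      rcases hq with rfl | hq
      · simp [BB, B11]
      · exact Or.inl (Or.inl (Or.inl (Or.inr ⟨q, hq, rfl⟩)))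
  · rw [path_arrows_two]
    rcases hr' with rfl | rfl | rfl
    · rcases hq with rfl | hq
      · omega
      · exact Or.inr (Or.inl (Or.inr ⟨q, hq, by simp [path]⟩))
    · have h : path (arrows F k s c) 2 1 = Ga F k s c := mul_one _
      rw [h]
      rcases hq with rfl | hq
      · simp [BB, B21]
      · exact Or.inl (Or.inr (Or.inl (Or.inr ⟨q, hq, rfl⟩)))
    · have h : path (arrows F k s c) 2 2 = Ga F k s c * Al F k s c :=
        congrArg (Ga F k s c * ·) (mul_one _)
      rw [h]
      rcases hq with rfl | hq
      · simp [BB, B21]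
      · exact Or.inl (Or.inr (Or.inr ⟨q, hq, rfl⟩))

lemma path_three_mul_mem_BB (hs : 1 ≤ s) (i : ZMod 3) :
    path (arrows F k s c) i (3 * k) ∈ BB F k s c := by
  have h : path (arrows F k s c) 0 (3 * k) ∈ BB F k s c := by
    rw [path_three_mul, path_arrows_zero]
    exact Or.inl (Or.inl (Or.inl (by simp [B11])))
  rcases zmod_three_cases i with rfl | rfl | rfl
  · exact h
  · rwa [← (isDihedral F k s c).path_eq]
  · rw [← (isDihedral F k s c).η_pow]
    exact Or.inr (Or.inr ⟨s, ⟨hs, le_rfl⟩, rfl⟩)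

/-- **Proposition (symmetrizing form, dihedral type).**  For `k, s ≥ 1` and
`c ∈ {0,1}` the bilinear form `⟨x, y⟩ = ψ(xy)` on `A^{k,s}_c` is associative,
symmetric and non-degenerate; in particular `A^{k,s}_c` is a symmetric F-algebra. -/
theorem dihedral_form_symmetric_nondegenerate
    (F : Type) [Field F] [IsAlgClosed F] [CharP F 2]
    (k s : ℕ) (hk : 1 ≤ k) (hs : 1 ≤ s) (c : F) (hc : c = 0 ∨ c = 1)
    (ψ : DA F k s c →ₗ[F] F) (hψ : SoclePsi F k s c ψ) :
    (∀ x y z : DA F k s c, ψ ((x * y) * z) = ψ (x * (y * z))) ∧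
    (∀ x y : DA F k s c, ψ (x * y) = ψ (y * x)) ∧
    (∀ x : DA F k s c, (∀ y : DA F k s c, ψ (x * y) = 0) → x = 0) ∧
    (∃ φ : DA F k s c →ₗ[F] F,
      (∀ x y : DA F k s c, φ (x * y) = φ (y * x)) ∧
      (∀ x : DA F k s c, (∀ y : DA F k s c, φ (x * y) = 0) → x = 0)) := by
  have H := isDihedral F k s c
  set a := arrows F k s c
  have hz : ∀ i, ψ (path a i (3 * k)) = 1 := fun i =>
    (hψ _ (path_three_mul_mem_BB F k s c hs i)).1 (H.path_mem_socle hk i)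
  have hzero : ∀ p ∈ BB F k s c, ∀ y q i, (∀ x ∈ socle (DA F k s c), q * x = 0) →
      (y * q) * p = path a i (3 * k) → ψ p = 0 := fun p hp y q i hq h =>
    (hψ p hp).2 fun hsoc => by
      have := hz i
      rw [← h, mul_assoc, hq p hsoc, mul_zero, map_zero] at this
      exact zero_ne_one this
  have harrow : ∀ i, ∀ x ∈ socle (DA F k s c), a i * x = 0 := fun i x hx =>
    (H.arrow_mul_of_mem_socle hk hx).1 i
  obtain ⟨l, hl⟩ : ∃ l, 3 * k = l + 1 := ⟨3 * k - 1, by omega⟩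
  have hl0 : (l : ZMod 3) = 2 := by
    have h := cast_three_mul k
    rw [hl, Nat.cast_add] at h
    rw [← add_sub_cancel_right (l : ZMod 3) ((1 : ℕ) : ZMod 3), h]; decide
  have h₁ : ψ (E1 F k s c) = 0 := by
    refine hzero _ (by simp [BB, B11]) (path a 1 l) (a (1 + l)) 1 (harrow _) ?_
    rw [← path_succ_right, H.path_e₁, hl0, if_neg (by decide), hl]
  have h₂ : ψ (E2 F k s c) = 0 := by
    refine hzero _ (by simp [BB, B22]) (path a 2 l) (a (2 + l)) 2 (harrow _) ?_
    rw [← path_succ_right, H.path_e₂, hl0, if_pos (by decide), hl]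
  have hp : ∀ i n, ψ (path a i (n + 1)) = if n + 1 = 3 * k then 1 else 0 := fun i n => by
    split_ifs with h
    · rw [h, hz]
    rcases Nat.lt_or_gt_of_ne h with h | h
    · obtain ⟨t, ht⟩ : ∃ t, 3 * k = (t + 1) + (n + 1) := ⟨3 * k - (n + 2), by omega⟩
      refine hzero _ (path_mem_BB F k s c n.succ_pos h i) (path a (i - (t + 1 : ℕ)) t)
        (a (i - (t + 1 : ℕ) + t)) (i - (t + 1 : ℕ)) (harrow _) ?_
      rw [← path_succ_right, ht, path_add a _ (t + 1), sub_add_cancel]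
    · rw [H.path_eq_zero hk i h, map_zero]
  have hη : ∀ n, ψ (Et F k s c ^ (n + 1)) = if n + 1 = s then 1 else 0 := fun n => by
    split_ifs with h
    · rw [h, H.η_pow, hz]
    rcases Nat.lt_or_gt_of_ne h with h | h
    · obtain ⟨t, ht⟩ : ∃ t, s = (t + 1) + (n + 1) := ⟨s - (n + 2), by omega⟩
      refine hzero _ (Or.inr (Or.inr ⟨n + 1, ⟨by omega, h.le⟩, rfl⟩)) (Et F k s c ^ t)
        (Et F k s c) 2 (fun x hx => (H.arrow_mul_of_mem_socle hk hx).2) ?_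
      rw [← H.η_pow, ← pow_succ, ← pow_add, ← ht]
    · rw [H.η_pow_eq_zero hk h, map_zero]
  have hsymm := H.form_symmetric hp hk
  have hnd := H.form_nondegenerate h₁ h₂ hp hη hk hs
  exact ⟨fun x y z => by rw [mul_assoc], hsymm, hnd, ψ, hsymm, hnd⟩

end DihedralPaper

end
end
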